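/- arXiv:2604.23751 — 2 statements merged into one kernel-verified Lean document; each statement's English description precedes it below -/
import Mathlib

section
/- Fix β > 0 and define f(x) = 1/2 + (1/β)·log((e^{βx} + e^{β/2})/(1 + e^{β/2} + e^β − e^{βx})) for x ∈ [0,1], and let ρ(x) = 1/(1 + e^{β(1/2 − x)}). Let μ_β be the measure on [0,1]² given by μ_β = (x ↦ (x, f(x)))_# [ρ(x) dx] + (x ↦ (f(x), x))_# [ρ(x) dx]; then μ_β is a permuton, and the permutons μ_{τ_n} of the 321-avoiding Mallows permutations τ_n = τ_n^{β,321} converge weakly in probability to μ_β, i.e. for every ε > 0 and any metric d metrizing weak convergence of probability measures on [0,1]², P(d(μ_{τ_n}, μ_β) > ε) → 0 as n → ∞. Moreover, if β ≤ 0, the permutons μ_{τ_n} converge weakly in probability to the diagonal permuton (x ↦ (x,x))_# Leb_{[0,1]}. -/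
open MeasureTheory Filter Set

attribute [local instance] Classical.propDecidable

noncomputable section

/-- Number of inversions of a permutation of `Fin n`. -/
def invCount {n : ℕ} (σ : Equiv.Perm (Fin n)) : ℕ :=
  (Finset.univ.filter (fun p : Fin n × Fin n => p.1 < p.2 ∧ σ p.2 < σ p.1)).card

/-- `σ` avoids the pattern `321`. -/
def Avoids321 {n : ℕ} (σ : Equiv.Perm (Fin n)) : Prop :=
  ¬ ∃ i j k : Fin n, i < j ∧ j < k ∧ σ j < σ i ∧ σ k < σ j

/-- Partition function of the 321-avoiding Mallows model with parameter `e^{β/n}`. -/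
def Z321 (β : ℝ) (n : ℕ) : ℝ :=
  ∑ σ ∈ Finset.univ.filter (fun σ : Equiv.Perm (Fin n) => Avoids321 σ),
    Real.exp (β / n * invCount σ)

/-- A permuton: a Borel probability measure on the plane (supported on `[0,1]²`) whose
two marginals are the Lebesgue measure on `[0,1]`. -/
def IsPermuton (μ : Measure (ℝ × ℝ)) : Prop :=
  IsProbabilityMeasure μ ∧
    μ.map Prod.fst = volume.restrict (Set.Icc (0:ℝ) 1) ∧
    μ.map Prod.snd = volume.restrict (Set.Icc (0:ℝ) 1)

/-- The permuton associated with a permutation: mass `1/n` spread uniformly on each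
cell `[(i-1)/n, i/n] × [(σ(i)-1)/n, σ(i)/n]` (0-indexed below). -/
def permutonOfPerm {n : ℕ} (σ : Equiv.Perm (Fin n)) : Measure (ℝ × ℝ) :=
  (n : ENNReal) • (volume.restrict (⋃ i : Fin n,
    Set.Icc (((i : ℕ) : ℝ) / n) ((((i : ℕ) : ℝ) + 1) / n) ×ˢ
      Set.Icc ((((σ i : Fin n) : ℕ) : ℝ) / n) (((((σ i : Fin n) : ℕ) : ℝ) + 1) / n)))

/-- The diagonal permuton `(x ↦ (x,x))_# Leb_{[0,1]}`. -/
def diagPermuton : Measure (ℝ × ℝ) :=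
  (volume.restrict (Set.Icc (0:ℝ) 1)).map (fun x => (x, x))

/-- `d` metrizes weak convergence of probability measures on `[0,1]²`:
for sequences of probability measures carried by `[0,1]²`, convergence of `d` to `0`
is equivalent to weak convergence. -/
def MetrizesWeakConvUnitSq (d : Measure (ℝ × ℝ) → Measure (ℝ × ℝ) → ℝ) : Prop :=
  ∀ (μs : ℕ → Measure (ℝ × ℝ)) (μ : Measure (ℝ × ℝ)),
    (∀ n, IsProbabilityMeasure (μs n)) → IsProbabilityMeasure μ →
    (∀ n, μs n (Set.Icc (0:ℝ) 1 ×ˢ Set.Icc (0:ℝ) 1) = 1) →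
    μ (Set.Icc (0:ℝ) 1 ×ˢ Set.Icc (0:ℝ) 1) = 1 →
    (Filter.Tendsto (fun n => d (μs n) μ) Filter.atTop (nhds 0) ↔
      ∀ g : BoundedContinuousFunction (ℝ × ℝ) ℝ,
        Filter.Tendsto (fun n => ∫ z, g z ∂(μs n)) Filter.atTop (nhds (∫ z, g z ∂μ)))

/-- The curve `f^{321}_β`. -/
def f321 (β : ℝ) (x : ℝ) : ℝ :=
  1 / 2 + (1 / β) * Real.log
    ((Real.exp (β * x) + Real.exp (β / 2)) /
      (1 + Real.exp (β / 2) + Real.exp β - Real.exp (β * x)))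

/-- The density `ρ(x) = 1/(1 + e^{β(1/2 − x)})`. -/
def rho321 (β : ℝ) (x : ℝ) : ℝ := 1 / (1 + Real.exp (β * (1 / 2 - x)))

/-- The limit permuton `μ^{321}_β`. -/
def mu321 (β : ℝ) : Measure (ℝ × ℝ) :=
  ((volume.restrict (Set.Icc (0:ℝ) 1)).withDensity
      (fun x => ENNReal.ofReal (rho321 β x))).map (fun x => (x, f321 β x)) +
  ((volume.restrict (Set.Icc (0:ℝ) 1)).withDensity
      (fun x => ENNReal.ofReal (rho321 β x))).map (fun x => (f321 β x, x))

/-! ### Weak excedances of 321-avoiding permutations -/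

/-- The set of weak excedances of a permutation. -/
def excSet {n : ℕ} (σ : Equiv.Perm (Fin n)) : Finset (Fin n) :=
  Finset.univ.filter fun i => i ≤ σ i

/-- The set of values of a permutation at its weak excedances. -/
def excVals {n : ℕ} (σ : Equiv.Perm (Fin n)) : Finset (Fin n) :=
  (excSet σ).map σ.toEmbedding

lemma mem_excSet {n : ℕ} {σ : Equiv.Perm (Fin n)} {i : Fin n} : i ∈ excSet σ ↔ i ≤ σ i := by
  simp [excSet]

lemma exists_lt_apply_gt {n : ℕ} (σ : Equiv.Perm (Fin n)) {i : Fin n} (hi : σ i < i) :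
    ∃ k < i, σ i < σ k := by
  by_contra! h
  have := Finset.card_le_card_of_injOn (s := Finset.Iio i) (t := Finset.Iio (σ i)) σ
    (fun k hk => by
      have hk' : k < i := by simpa using hk
      simpa using lt_of_le_of_ne (h k hk') (fun e => hk'.ne (σ.injective e)))
    σ.injective.injOn
  simp only [Fin.card_Iio] at this
  omega

lemma exists_gt_apply_lt {n : ℕ} (σ : Equiv.Perm (Fin n)) {i j : Fin n} (hij : i < j)
    (hσ : σ j < σ i) (hj : j ≤ σ j) : ∃ k, j < k ∧ σ k < σ j := by
  by_contra! h
  have := Finset.card_le_card_of_injOn (s := Finset.Iio (σ j)) (t := (Finset.Iio j).erase i) σ.symm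
    (fun v hv => by
      have hv' : v < σ j := by simpa using hv
      have h1 : σ.symm v ≤ j := by
        by_contra! h2
        have := h _ h2
        simp at this
        omega
      have h2 : σ.symm v ≠ j := by
        rintro rfl
        simp at hv'
      have h3 : σ.symm v ≠ i := by
        rintro rfl
        simp at hσ
        omega
      simp [h3, lt_of_le_of_ne h1 h2])
    σ.symm.injective.injOn
  rw [Finset.card_erase_of_mem (by simpa using hij)] at this
  simp only [Fin.card_Iio] at this
  omega

lemma Avoids321.strictMonoOn_excSet {n : ℕ} {σ : Equiv.Perm (Fin n)} (h : Avoids321 σ) :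
    StrictMonoOn σ (excSet σ : Set (Fin n)) := by
  intro i _ j hj hij
  by_contra! hle
  have hlt : σ j < σ i := lt_of_le_of_ne hle fun e => hij.ne' (σ.injective e)
  obtain ⟨k, hk, hk'⟩ := exists_gt_apply_lt σ hij hlt (mem_excSet.1 (by simpa using hj))
  exact h ⟨i, j, k, hij, hk, hlt, hk'⟩

lemma Avoids321.mem_excSet_of_inversion {n : ℕ} {σ : Equiv.Perm (Fin n)} (h : Avoids321 σ)
    {i j : Fin n} (hij : i < j) (hσ : σ j < σ i) : i ∈ excSet σ := by
  by_contra hi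
  obtain ⟨k, hk, hk'⟩ := exists_lt_apply_gt σ (not_le.1 (mt mem_excSet.2 hi))
  exact h ⟨k, i, j, hk, hij, hk', hσ⟩

lemma Avoids321.strictMonoOn_excSet_compl {n : ℕ} {σ : Equiv.Perm (Fin n)} (h : Avoids321 σ) :
    StrictMonoOn σ ((excSet σ : Set (Fin n))ᶜ) := by
  intro i hi j _ hij
  by_contra! hle
  have hlt : σ j < σ i := lt_of_le_of_ne hle fun e => hij.ne' (σ.injective e)
  exact hi (by simpa using h.mem_excSet_of_inversion hij hlt)

lemma Avoids321.invCount_add_sum {n : ℕ} {σ : Equiv.Perm (Fin n)} (h : Avoids321 σ) :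
    invCount σ + ∑ i ∈ excSet σ, (i : ℕ) = ∑ i ∈ excVals σ, (i : ℕ) := by
  have key : ∀ i : Fin n, (Finset.univ.filter fun j => i < j ∧ σ j < σ i).card
      + (if i ∈ excSet σ then (i : ℕ) else 0) = if i ∈ excSet σ then (σ i : ℕ) else 0 := by
    intro i
    split_ifs with hi
    · have hdisj : Disjoint (Finset.univ.filter fun j => i < j ∧ σ j < σ i) (Finset.Iio i) := by
        rw [Finset.disjoint_left]
        intro j hj hj'
        simp at hj hj'
        omega
      have hun : (Finset.univ.filter fun j => i < j ∧ σ j < σ i) ∪ Finset.Iio i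
          = (Finset.Iio (σ i)).map σ.symm.toEmbedding := by
        ext j
        simp only [Finset.mem_union, Finset.mem_filter, Finset.mem_univ, true_and, Finset.mem_Iio,
          Finset.mem_map_equiv, Equiv.symm_symm]
        constructor
        · rintro (⟨_, h2⟩ | h2)
          · exact h2
          · by_cases hj : j ∈ excSet σ
            · exact h.strictMonoOn_excSet (by simpa using hj) (by simpa using hi) h2
            · have h3 := mt mem_excSet.2 hj
              have h4 := mem_excSet.1 hi
              omega
        · intro hj
          rcases lt_trichotomy i j with hij | rfl | hij
          · exact Or.inl ⟨hij, hj⟩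
          · exact absurd hj (lt_irrefl _)
          · exact Or.inr hij
      have := congrArg Finset.card hun
      rw [Finset.card_union_of_disjoint hdisj] at this
      simpa using this
    · rw [add_zero, Finset.card_eq_zero, Finset.filter_eq_empty_iff]
      rintro j - ⟨h1, h2⟩
      exact hi (h.mem_excSet_of_inversion h1 h2)
  have hinv : invCount σ = ∑ i : Fin n, (Finset.univ.filter fun j => i < j ∧ σ j < σ i).card := by
    simp only [invCount, Finset.card_filter]
    rw [Fintype.sum_prod_type]
  have := Finset.sum_congr (rfl : (Finset.univ : Finset (Fin n)) = _) fun i _ => key i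
  rw [Finset.sum_add_distrib, ← hinv] at this
  simpa [Finset.sum_ite_mem, excVals] using this

lemma strictMonoOn_eq_of_image_eq {n : ℕ} {σ τ : Equiv.Perm (Fin n)} {s : Set (Fin n)}
    (hσ : StrictMonoOn σ s) (hτ : StrictMonoOn τ s) (h : σ '' s = τ '' s) : EqOn σ τ s := by
  have h1 : StrictMono (s.domRestrict σ) := fun a b hab => hσ a.2 b.2 hab
  have h2 : StrictMono (s.domRestrict τ) := fun a b hab => hτ a.2 b.2 hab
  have := (StrictMono.range_inj h1 h2).1 (by rw [Set.range_domRestrict, Set.range_domRestrict, h])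
  intro x hx
  exact congrFun this ⟨x, hx⟩

lemma coe_excVals {n : ℕ} (σ : Equiv.Perm (Fin n)) :
    (excVals σ : Set (Fin n)) = σ '' (excSet σ : Set (Fin n)) := by
  simp [excVals]

lemma Avoids321.eq_of_excSet_eq {n : ℕ} {σ τ : Equiv.Perm (Fin n)} (hσ : Avoids321 σ)
    (hτ : Avoids321 τ) (h : excSet σ = excSet τ) (h' : excVals σ = excVals τ) : σ = τ := by
  have himg : σ '' (excSet σ : Set (Fin n)) = τ '' (excSet σ : Set (Fin n)) := by
    rw [← coe_excVals, h', coe_excVals, h]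
  have h1 := strictMonoOn_eq_of_image_eq hσ.strictMonoOn_excSet
    (h ▸ hτ.strictMonoOn_excSet) himg
  have h2 := strictMonoOn_eq_of_image_eq hσ.strictMonoOn_excSet_compl
    (h ▸ hτ.strictMonoOn_excSet_compl)
    (by rw [image_compl_eq σ.bijective, image_compl_eq τ.bijective, himg])
  ext i : 1
  by_cases hi : i ∈ excSet σ
  · exact h1 (by simpa using hi)
  · exact h2 (by simpa using hi)

/-! ### Counting functions of subsets of `Fin n` -/

/-- The indicator of a subset of `Fin n`, extended by zero to all natural numbers. -/
def indic {n : ℕ} (A : Finset (Fin n)) (j : ℕ) : ℕ :=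
  if ∃ h : j < n, (⟨j, h⟩ : Fin n) ∈ A then 1 else 0

/-- The number of elements of `A` smaller than `t`. -/
def countBelow {n : ℕ} (A : Finset (Fin n)) (t : ℕ) : ℕ :=
  ∑ j ∈ Finset.range t, indic A j

lemma indic_coe {n : ℕ} (A : Finset (Fin n)) (i : Fin n) :
    indic A i = if i ∈ A then 1 else 0 := by
  simp [indic]

lemma countBelow_succ {n : ℕ} (A : Finset (Fin n)) (t : ℕ) :
    countBelow A (t + 1) = countBelow A t + indic A t := Finset.sum_range_succ _ _

lemma countBelow_mono {n : ℕ} (A : Finset (Fin n)) : Monotone (countBelow A) :=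
  monotone_nat_of_le_succ fun t => by rw [countBelow_succ]; omega

lemma countBelow_eq_card {n : ℕ} (A : Finset (Fin n)) (t : ℕ) :
    countBelow A t = (A.filter fun i : Fin n => (i : ℕ) < t).card := by
  induction t with
  | zero => simp [countBelow]
  | succ t ih =>
    rw [countBelow_succ, ih]
    by_cases h : ∃ h : t < n, (⟨t, h⟩ : Fin n) ∈ A
    · obtain ⟨h1, h2⟩ := h
      have : (A.filter fun i : Fin n => (i : ℕ) < t + 1)
          = insert ⟨t, h1⟩ (A.filter fun i : Fin n => (i : ℕ) < t) := by
        ext i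
        simp only [Finset.mem_filter, Finset.mem_insert, Fin.ext_iff]
        constructor
        · rintro ⟨h3, h4⟩
          by_cases h5 : (i : ℕ) = t
          · exact Or.inl h5
          · exact Or.inr ⟨h3, by omega⟩
        · rintro (h3 | ⟨h3, h4⟩)
          · obtain rfl : i = ⟨t, h1⟩ := Fin.ext h3
            exact ⟨h2, by simp⟩
          · exact ⟨h3, by omega⟩
      rw [this, Finset.card_insert_of_notMem (by simp)]
      simp [indic, h1, h2]
    · have : (A.filter fun i : Fin n => (i : ℕ) < t + 1) = (A.filter fun i : Fin n => (i : ℕ) < t) := by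
        ext i
        simp only [Finset.mem_filter]
        constructor
        · rintro ⟨h3, h4⟩
          refine ⟨h3, ?_⟩
          by_contra h5
          exact h ⟨by omega, by convert h3 using 1; ext; simp; omega⟩
        · rintro ⟨h3, h4⟩
          exact ⟨h3, by omega⟩
      rw [this]
      simp only [indic, if_neg h, add_zero]

lemma countBelow_self {n : ℕ} (A : Finset (Fin n)) : countBelow A n = A.card := by
  simp [countBelow_eq_card]

lemma countBelow_compl {n : ℕ} (A : Finset (Fin n)) {t : ℕ} (ht : t ≤ n) :
    countBelow A t + countBelow Aᶜ t = t := by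
  induction t with
  | zero => simp [countBelow]
  | succ t ih =>
    have h1 := ih (by omega)
    have : indic A t + indic Aᶜ t = 1 := by
      have h2 := indic_coe A ⟨t, ht⟩
      have h3 := indic_coe Aᶜ ⟨t, ht⟩
      simp only [Finset.mem_compl] at h2 h3
      rw [h2, h3]
      split_ifs <;> simp
    rw [countBelow_succ, countBelow_succ]
    omega

lemma countBelow_map_of_strictMonoOn {n : ℕ} {σ : Equiv.Perm (Fin n)} {s : Finset (Fin n)}
    (hσ : StrictMonoOn σ (s : Set (Fin n))) {i : Fin n} (hi : i ∈ s) :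
    countBelow (s.map σ.toEmbedding) (σ i) = countBelow s i := by
  rw [countBelow_eq_card, countBelow_eq_card, Finset.filter_map, Finset.card_map]
  congr 1
  ext j
  simp only [Finset.mem_filter, Function.comp, and_congr_right_iff]
  intro hj
  exact hσ.lt_iff_lt (by simpa using hj) (by simpa using hi)

lemma sum_add_sum_countBelow {n : ℕ} (A : Finset (Fin n)) :
    ∑ i ∈ A, (i : ℕ) + ∑ t ∈ Finset.range n, countBelow A (t + 1) = n * A.card := by
  have h1 : ∀ t, countBelow A (t + 1) = ∑ i ∈ A, if (i : ℕ) ≤ t then 1 else 0 := by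
    intro t
    rw [countBelow_eq_card, Finset.card_filter]
    exact Finset.sum_congr rfl fun i _ => by simp
  simp only [h1]
  rw [Finset.sum_comm, ← Finset.sum_add_distrib, mul_comm, ← smul_eq_mul, ← Finset.sum_const]
  refine Finset.sum_congr rfl fun i _ => ?_
  rw [← Finset.card_filter]
  have : (Finset.range n).filter (fun t => (i : ℕ) ≤ t) = Finset.Ico (i : ℕ) n := by
    ext t; simp; omega
  rw [this, Nat.card_Ico]
  omega

/-! ### The pairs of subsets coming from 321-avoiding permutations -/

/-- The condition under which a pair of subsets is realised as the weak excedances and their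
values of a 321-avoiding permutation. -/
def Admissible {n : ℕ} (A B : Finset (Fin n)) : Prop :=
  A.card = B.card ∧ (∀ i : Fin n, countBelow B i ≤ countBelow A i) ∧
    ∀ i : Fin n, i ∉ A → countBelow B i < countBelow A i

lemma avoids321_of_strictMonoOn {n : ℕ} {σ : Equiv.Perm (Fin n)} {s : Set (Fin n)}
    (h1 : StrictMonoOn σ s) (h2 : StrictMonoOn σ sᶜ) : Avoids321 σ := by
  rintro ⟨i, j, k, hij, hjk, h3, h4⟩
  have h5 := h4.trans h3
  have hik := hij.trans hjk
  by_cases hi : i ∈ s <;> by_cases hj : j ∈ s <;> by_cases hk : k ∈ s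
  all_goals first
    | exact absurd (h1 hi hj hij) h3.asymm
    | exact absurd (h1 hj hk hjk) h4.asymm
    | exact absurd (h1 hi hk hik) h5.asymm
    | exact absurd (h2 hi hj hij) h3.asymm
    | exact absurd (h2 hj hk hjk) h4.asymm
    | exact absurd (h2 hi hk hik) h5.asymm

lemma exists_perm_strictMonoOn {n : ℕ} {A B : Finset (Fin n)} (h : A.card = B.card) :
    ∃ σ : Equiv.Perm (Fin n), StrictMonoOn σ (A : Set (Fin n)) ∧
      StrictMonoOn σ (A : Set (Fin n))ᶜ ∧ A.map σ.toEmbedding = B := by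
  have hc : Aᶜ.card = Bᶜ.card := by rw [Finset.card_compl, Finset.card_compl, h]
  let e : A ≃o B := (A.orderIsoOfFin rfl).symm.trans (B.orderIsoOfFin h.symm)
  let e' : (Aᶜ : Finset (Fin n)) ≃o (Bᶜ : Finset (Fin n)) :=
    (Aᶜ.orderIsoOfFin rfl).symm.trans (Bᶜ.orderIsoOfFin hc.symm)
  let g : {x // x ∉ A} ≃ {x // x ∉ B} :=
    ((Equiv.subtypeEquivRight fun x => by simp).trans e'.toEquiv).trans
      (Equiv.subtypeEquivRight fun x => by simp)
  let σ : Equiv.Perm (Fin n) := Equiv.subtypeCongr (p := (· ∈ A)) (q := (· ∈ B)) e.toEquiv g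
  have h1 : ∀ i (hi : i ∈ A), σ i = e ⟨i, hi⟩ := fun i hi => by
    simp [σ, Equiv.subtypeCongr, Equiv.sumCompl_symm_apply_of_pos hi]
  have h2 : ∀ i (hi : i ∉ A), σ i = e' ⟨i, by simpa using hi⟩ := fun i hi => by
    simp [σ, g, Equiv.subtypeCongr, Equiv.sumCompl_symm_apply_of_neg hi]
    rfl
  refine ⟨σ, ?_, ?_, ?_⟩
  · intro i hi j hj hij
    rw [h1 i (by simpa using hi), h1 j (by simpa using hj)]
    exact e.strictMono hij
  · intro i hi j hj hij
    rw [h2 i (by simpa using hi), h2 j (by simpa using hj)]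
    exact e'.strictMono hij
  · apply Finset.eq_of_subset_of_card_le
    · intro x hx
      obtain ⟨i, hi, rfl⟩ := Finset.mem_map.1 hx
      simp only [Equiv.coe_toEmbedding, h1 i hi]
      exact (e ⟨i, hi⟩).2
    · rw [Finset.card_map, h]

lemma Admissible.exists_perm {n : ℕ} {A B : Finset (Fin n)} (h : Admissible A B) :
    ∃ σ : Equiv.Perm (Fin n), Avoids321 σ ∧ excSet σ = A ∧ excVals σ = B := by
  obtain ⟨hcard, hle, hlt⟩ := h
  obtain ⟨σ, h1, h2, h3⟩ := exists_perm_strictMonoOn hcard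
  have h4 : Aᶜ.map σ.toEmbedding = Bᶜ := by
    rw [← h3]
    ext x
    simp
  have hA : excSet σ = A := by
    ext i
    rw [mem_excSet]
    constructor
    · intro hi
      by_contra hiA
      have h5 := countBelow_map_of_strictMonoOn (σ := σ) (s := Aᶜ) (i := i) (by simpa using h2)
        (by simpa using hiA)
      rw [h4] at h5
      have h6 := countBelow_mono Bᶜ (show (i : ℕ) ≤ σ i from hi)
      have h7 := countBelow_compl A i.2.le
      have h8 := countBelow_compl B i.2.le
      have h9 := hlt i hiA
      omega
    · intro hiA
      by_contra! hi
      have h5 := countBelow_map_of_strictMonoOn (σ := σ) h1 hiA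
      rw [h3] at h5
      have h6 := countBelow_mono B (show (σ i : ℕ) + 1 ≤ i from hi)
      have h7 := hle i
      have h8 : indic B (σ i) = 1 := by
        rw [indic_coe, if_pos]
        rw [← h3]
        simpa using hiA
      rw [countBelow_succ] at h6
      omega
  exact ⟨σ, avoids321_of_strictMonoOn h1 h2, hA, by rw [excVals, hA, h3]⟩

lemma card_excVals {n : ℕ} (σ : Equiv.Perm (Fin n)) : (excVals σ).card = (excSet σ).card :=
  Finset.card_map _

/-! ### Turning a typical pair of subsets into an admissible one -/

/-- Add every `i < M`, keep `A` on `[M, N)`, and beyond `N` keep only the `i ≥ N + v`. -/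
def bridgeFst {n : ℕ} (M N v : ℕ) (A : Finset (Fin n)) : Finset (Fin n) :=
  Finset.univ.filter fun i : Fin n => (i : ℕ) < M ∨ ((i : ℕ) < N ∧ i ∈ A) ∨ N + v ≤ i

/-- Remove every `i < M`, keep `B` on `[M, N)`, and add every `i ≥ N`. -/
def bridgeSnd {n : ℕ} (M N : ℕ) (B : Finset (Fin n)) : Finset (Fin n) :=
  Finset.univ.filter fun i : Fin n => M ≤ (i : ℕ) ∧ ((i : ℕ) < N → i ∈ B)

section

variable {n M N v : ℕ} {A B : Finset (Fin n)}

lemma mem_bridgeFst {i : Fin n} :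
    i ∈ bridgeFst M N v A ↔ (i : ℕ) < M ∨ ((i : ℕ) < N ∧ i ∈ A) ∨ N + v ≤ i := by
  simp [bridgeFst]

lemma mem_bridgeSnd {i : Fin n} :
    i ∈ bridgeSnd M N B ↔ M ≤ (i : ℕ) ∧ ((i : ℕ) < N → i ∈ B) := by
  simp [bridgeSnd]

lemma countBelow_bridgeFst_of_le (hMN : M ≤ N) (hN : N ≤ n) {t : ℕ} (ht : t ≤ M) :
    countBelow (bridgeFst M N v A) t = t := by
  induction t with
  | zero => simp [countBelow]
  | succ t ih =>
    rw [countBelow_succ, ih (by omega)]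
    have := indic_coe (bridgeFst M N v A) ⟨t, by omega⟩
    rw [if_pos (mem_bridgeFst.2 (Or.inl (by simpa using ht)))] at this
    simp only [this]

lemma countBelow_bridgeSnd_of_le (hMN : M ≤ N) (hN : N ≤ n) {t : ℕ} (ht : t ≤ M) :
    countBelow (bridgeSnd M N B) t = 0 := by
  induction t with
  | zero => simp [countBelow]
  | succ t ih =>
    rw [countBelow_succ, ih (by omega)]
    have := indic_coe (bridgeSnd M N B) ⟨t, by omega⟩
    rw [if_neg (fun h => by have := (mem_bridgeSnd.1 h).1; simp at this; omega)] at this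
    simpa using this

lemma countBelow_bridgeFst_mid (hN : N ≤ n) {t : ℕ} (hMt : M ≤ t) (ht : t ≤ N) :
    countBelow (bridgeFst M N v A) t + countBelow A M = M + countBelow A t := by
  induction t, hMt using Nat.le_induction with
  | base => rw [countBelow_bridgeFst_of_le ht hN le_rfl]
  | succ t hMt ih =>
    have h1 := indic_coe (bridgeFst M N v A) ⟨t, by omega⟩
    have h2 := indic_coe A ⟨t, by omega⟩
    have h3 : (⟨t, by omega⟩ : Fin n) ∈ bridgeFst M N v A ↔ (⟨t, by omega⟩ : Fin n) ∈ A := by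
      rw [mem_bridgeFst]
      constructor
      · rintro (h | h | h)
        · simp at h; omega
        · exact h.2
        · simp at h; omega
      · intro h
        exact Or.inr (Or.inl ⟨by simpa using ht, h⟩)
    simp only [h3, ← h2] at h1
    rw [countBelow_succ, countBelow_succ, h1]
    have := ih (by omega)
    omega

lemma countBelow_bridgeSnd_mid (hN : N ≤ n) {t : ℕ} (hMt : M ≤ t) (ht : t ≤ N) :
    countBelow (bridgeSnd M N B) t + countBelow B M = countBelow B t := by
  induction t, hMt using Nat.le_induction with
  | base => rw [countBelow_bridgeSnd_of_le ht hN le_rfl, zero_add]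
  | succ t hMt ih =>
    have h1 := indic_coe (bridgeSnd M N B) ⟨t, by omega⟩
    have h2 := indic_coe B ⟨t, by omega⟩
    have h3 : (⟨t, by omega⟩ : Fin n) ∈ bridgeSnd M N B ↔ (⟨t, by omega⟩ : Fin n) ∈ B := by
      rw [mem_bridgeSnd]
      exact ⟨fun h => h.2 (by simpa using ht), fun h => ⟨hMt, fun _ => h⟩⟩
    simp only [h3, ← h2] at h1
    rw [countBelow_succ, countBelow_succ, h1]
    have := ih (by omega)
    omega

lemma countBelow_bridgeFst_end (hMN : M ≤ N) {s : ℕ} (hs : N + s ≤ n) :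
    countBelow (bridgeFst M N v A) (N + s) + countBelow A M
      = M + countBelow A N + (s - v) := by
  induction s with
  | zero => simpa using countBelow_bridgeFst_mid hs hMN le_rfl
  | succ s ih =>
    have h1 := indic_coe (bridgeFst M N v A) ⟨N + s, by omega⟩
    have h3 : (⟨N + s, by omega⟩ : Fin n) ∈ bridgeFst M N v A ↔ v ≤ s := by
      rw [mem_bridgeFst]
      simp
      omega
    simp only [h3] at h1
    have := ih (by omega)
    rw [← add_assoc, countBelow_succ, h1]
    split_ifs <;> omega

lemma countBelow_bridgeSnd_end (hMN : M ≤ N) {s : ℕ} (hs : N + s ≤ n) :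
    countBelow (bridgeSnd M N B) (N + s) + countBelow B M = countBelow B N + s := by
  induction s with
  | zero => simpa using countBelow_bridgeSnd_mid hs hMN le_rfl
  | succ s ih =>
    have h1 := indic_coe (bridgeSnd M N B) ⟨N + s, by omega⟩
    rw [if_pos (mem_bridgeSnd.2 ⟨by simp; omega, by simp⟩)] at h1
    simp only at h1
    have := ih (by omega)
    rw [← add_assoc, countBelow_succ, h1]
    omega

lemma bridge_walk (hMN : M ≤ N) (hN : N ≤ n) (hv : countBelow B N + countBelow A M + v =
      M + countBelow A N + countBelow B M) (t : ℕ) (ht : t ≤ n) :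
    (t ≤ M ∧ countBelow (bridgeFst M N v A) t = countBelow (bridgeSnd M N B) t + t) ∨
    (M ≤ t ∧ t ≤ N ∧ countBelow (bridgeFst M N v A) t + countBelow B t + countBelow A M =
      countBelow (bridgeSnd M N B) t + M + countBelow A t + countBelow B M) ∨
    (N ≤ t ∧ countBelow (bridgeFst M N v A) t =
      countBelow (bridgeSnd M N B) t + (v - (t - N))) := by
  rcases le_total t M with h | h
  · left
    rw [countBelow_bridgeFst_of_le hMN hN h, countBelow_bridgeSnd_of_le hMN hN h]
    omega
  rcases le_total t N with h' | h'
  · right; left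
    have h1 := countBelow_bridgeFst_mid (v := v) (A := A) hN h h'
    have h2 := countBelow_bridgeSnd_mid (B := B) hN h h'
    omega
  · right; right
    obtain ⟨s, rfl⟩ := Nat.exists_eq_add_of_le h'
    have h1 := countBelow_bridgeFst_end (v := v) (A := A) hMN ht
    have h2 := countBelow_bridgeSnd_end (B := B) hMN ht
    omega

lemma admissible_bridge (hMN : M ≤ N) (hN : N ≤ n)
    (hv : countBelow B N + countBelow A M + v = M + countBelow A N + countBelow B M)
    (hv' : v ≤ n - N)
    (hpos : ∀ t, M ≤ t → t ≤ N →
      countBelow B t + countBelow A M < M + countBelow A t + countBelow B M) :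
    Admissible (bridgeFst M N v A) (bridgeSnd M N B) := by
  have hw := bridge_walk hMN hN hv
  refine ⟨?_, fun i => ?_, fun i hi => ?_⟩
  · rw [← countBelow_self, ← countBelow_self]
    rcases hw n le_rfl with h | h | h
    · have h1 := hpos M le_rfl hMN
      have h2 : n = M := by omega
      have h3 : n = N := by omega
      have h4 : v = M := by subst h2; subst h3; omega
      omega
    · have h3 : n = N := by omega
      subst h3
      omega
    · omega
  · have := hpos i
    rcases hw i i.2.le with h | h | h <;> omega
  · have h2 := hpos i
    have h5 := hpos M le_rfl hMN
    have h3 : ¬ (i : ℕ) < M := fun h => hi (mem_bridgeFst.2 (Or.inl h))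
    have h4 : ¬ N + v ≤ (i : ℕ) := fun h => hi (mem_bridgeFst.2 (Or.inr (Or.inr h)))
    rcases hw i i.2.le with h | h | h <;> omega

lemma bridge_walk_le (hMN : M ≤ N) (hN : N ≤ n)
    (hv : countBelow B N + countBelow A M + v = M + countBelow A N + countBelow B M)
    {D : ℕ} (hD : ∀ t, M ≤ t → t ≤ N →
      M + countBelow A t + countBelow B M ≤ countBelow B t + countBelow A M + D)
    (t : ℕ) (ht : t ≤ n) :
    countBelow (bridgeFst M N v A) t ≤ countBelow (bridgeSnd M N B) t + D := by
  have h1 := hD M le_rfl hMN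
  have h2 := hD N hMN le_rfl
  have h3 := hD t
  rcases bridge_walk hMN hN hv t ht with h | h | h <;> omega

end

/-! ### Random subsets with independent memberships -/

/-- The probability of `A` when each `i : Fin n` is included independently with probability
`p i`. -/
def bernoulliWeight {n : ℕ} (p : ℕ → ℝ) (A : Finset (Fin n)) : ℝ :=
  ∏ i : Fin n, if i ∈ A then p i else 1 - p i

/-- All initial counts of `A` are within `δ n` of their means. -/
def Concentrated {n : ℕ} (p : ℕ → ℝ) (δ : ℝ) (A : Finset (Fin n)) : Prop :=
  ∀ t ≤ n, |(countBelow A t : ℝ) - ∑ j ∈ Finset.range t, p j| ≤ δ * n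

lemma sum_prod_ite_mem {ι : Type*} [Fintype ι] [∀ (A : Finset ι) (i : ι), Decidable (i ∈ A)]
    (f g : ι → ℝ) :
    ∑ A : Finset ι, ∏ i, (if i ∈ A then f i else g i) = ∏ i, (f i + g i) := by
  rw [Finset.prod_add, Finset.powerset_univ]
  refine Finset.sum_congr rfl fun A _ => ?_
  rw [Finset.prod_ite]
  congr 1 <;> refine Finset.prod_congr ?_ fun _ _ => rfl <;> ext <;> simp

lemma sum_bernoulliWeight (n : ℕ) (p : ℕ → ℝ) :
    ∑ A : Finset (Fin n), bernoulliWeight p A = 1 := by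
  simp [bernoulliWeight, sum_prod_ite_mem]

lemma bernoulliWeight_nonneg {n : ℕ} {p : ℕ → ℝ} (hp : ∀ j < n, 0 ≤ p j ∧ p j ≤ 1)
    (A : Finset (Fin n)) : 0 ≤ bernoulliWeight p A :=
  Finset.prod_nonneg fun i _ => by
    have := hp i i.2
    split_ifs <;> linarith

lemma sum_range_eq_sum_fin {n t : ℕ} (ht : t ≤ n) (F : ℕ → ℝ) :
    ∑ j ∈ Finset.range t, F j = ∑ i : Fin n, if (i : ℕ) < t then F i else 0 := by
  rw [Fin.sum_univ_eq_sum_range (fun j => if j < t then F j else 0) n, ← Finset.sum_filter]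
  refine Finset.sum_congr ?_ fun _ _ => rfl
  ext j
  simp
  omega

lemma bernoulli_exp_le {p s : ℝ} (hp : 0 ≤ p) (hp' : p ≤ 1) (hs : |s| ≤ 1) :
    p * Real.exp (s * (1 - p)) + (1 - p) * Real.exp (s * (0 - p)) ≤ Real.exp (s ^ 2) := by
  have key : ∀ u : ℝ, |u| ≤ 1 → Real.exp u ≤ 1 + u + u ^ 2 := fun u hu => by
    have := (abs_le.1 (Real.abs_exp_sub_one_sub_id_le hu)).2
    linarith
  have h1 := key (s * (1 - p)) (by
    rw [abs_mul, abs_of_nonneg (by linarith : 0 ≤ 1 - p)]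
    nlinarith [abs_nonneg s])
  have h2 := key (s * (0 - p)) (by
    rw [abs_mul, abs_of_nonpos (by linarith : 0 - p ≤ 0)]
    nlinarith [abs_nonneg s])
  have h3 := Real.add_one_le_exp (s ^ 2)
  have h4 : 0 ≤ s ^ 2 := sq_nonneg s
  have h5 := mul_le_mul_of_nonneg_left h1 hp
  have h6 := mul_le_mul_of_nonneg_left h2 (by linarith : 0 ≤ 1 - p)
  have h7 : s ^ 2 * (p * (1 - p)) ≤ s ^ 2 * 1 :=
    mul_le_mul_of_nonneg_left (by nlinarith [sq_nonneg p]) h4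
  nlinarith

lemma sum_bernoulliWeight_mul_exp_le {n : ℕ} {p : ℕ → ℝ} (hp : ∀ j < n, 0 ≤ p j ∧ p j ≤ 1)
    {s : ℝ} (hs : |s| ≤ 1) {t : ℕ} (ht : t ≤ n) :
    ∑ A : Finset (Fin n), bernoulliWeight p A *
      Real.exp (s * (countBelow A t - ∑ j ∈ Finset.range t, p j)) ≤ Real.exp (s ^ 2 * n) := by
  let e : Fin n → ℝ → ℝ := fun i x => if (i : ℕ) < t then Real.exp (s * (x - p i)) else 1
  have h1 : ∀ A : Finset (Fin n),
      Real.exp (s * (countBelow A t - ∑ j ∈ Finset.range t, p j))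
        = ∏ i, e i (if i ∈ A then 1 else 0) := by
    intro A
    have : (countBelow A t : ℝ) = ∑ j ∈ Finset.range t, (indic A j : ℝ) := by
      simp [countBelow]
    rw [this, ← Finset.sum_sub_distrib, Finset.mul_sum, sum_range_eq_sum_fin ht, Real.exp_sum]
    refine Finset.prod_congr rfl fun i _ => ?_
    rw [indic_coe]
    by_cases h : (i : ℕ) < t <;> by_cases h' : i ∈ A <;> simp [e, h, h']
  have h2 : ∀ A : Finset (Fin n), bernoulliWeight p A *
      Real.exp (s * (countBelow A t - ∑ j ∈ Finset.range t, p j))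
        = ∏ i : Fin n, if i ∈ A then p i * e i 1 else (1 - p i) * e i 0 := by
    intro A
    rw [h1, bernoulliWeight, ← Finset.prod_mul_distrib]
    exact Finset.prod_congr rfl fun i _ => by split_ifs <;> rfl
  simp only [h2]
  rw [sum_prod_ite_mem]
  have h3 : Real.exp (s ^ 2 * n) = ∏ _i : Fin n, Real.exp (s ^ 2) := by
    rw [Finset.prod_const, Finset.card_univ, Fintype.card_fin, ← Real.exp_nat_mul, mul_comm]
  rw [h3]
  refine Finset.prod_le_prod (fun i _ => ?_) fun i _ => ?_
  · have := hp i i.2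
    have h5 : 0 ≤ 1 - p i := by linarith
    have h6 : ∀ x, 0 ≤ e i x := fun x => by
      simp only [e]; split_ifs <;> positivity
    exact add_nonneg (mul_nonneg this.1 (h6 _)) (mul_nonneg h5 (h6 _))
  · by_cases h : (i : ℕ) < t
    · simp only [e, h, if_true]
      exact bernoulli_exp_le (hp i i.2).1 (hp i i.2).2 hs
    · simp only [e, h, if_false]
      have := Real.add_one_le_exp (s ^ 2)
      nlinarith [sq_nonneg s]

lemma sum_bernoulliWeight_tail_le {n : ℕ} {p : ℕ → ℝ} (hp : ∀ j < n, 0 ≤ p j ∧ p j ≤ 1)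
    {δ : ℝ} (hδ : 0 ≤ δ) (hδ' : δ ≤ 2) {t : ℕ} (ht : t ≤ n) :
    ∑ A : Finset (Fin n) with δ * n < |(countBelow A t : ℝ) - ∑ j ∈ Finset.range t, p j|,
      bernoulliWeight p A ≤ 2 * Real.exp (-(δ ^ 2 / 4) * n) := by
  have h1 := sum_bernoulliWeight_mul_exp_le hp (s := δ / 2)
    (abs_le.2 ⟨by linarith, by linarith⟩) ht
  have h2 := sum_bernoulliWeight_mul_exp_le hp (s := -(δ / 2))
    (abs_le.2 ⟨by linarith, by linarith⟩) ht
  have h3 : ∀ A : Finset (Fin n),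
      (if δ * n < |(countBelow A t : ℝ) - ∑ j ∈ Finset.range t, p j| then
        bernoulliWeight p A else 0) ≤ Real.exp (-(δ / 2 * (δ * n))) * (bernoulliWeight p A *
          Real.exp (δ / 2 * (countBelow A t - ∑ j ∈ Finset.range t, p j)) + bernoulliWeight p A *
          Real.exp (-(δ / 2) * (countBelow A t - ∑ j ∈ Finset.range t, p j))) := by
    intro A
    set X : ℝ := (countBelow A t : ℝ) - ∑ j ∈ Finset.range t, p j
    have h0 := bernoulliWeight_nonneg hp A
    split_ifs with h
    · rw [← mul_add, mul_left_comm]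
      refine le_mul_of_one_le_right h0 ?_
      rw [mul_add, ← Real.exp_add, ← Real.exp_add]
      rcases lt_abs.1 h with h | h
      · have : 1 ≤ Real.exp (-(δ / 2 * (δ * n)) + δ / 2 * X) := Real.one_le_exp (by nlinarith)
        have := Real.exp_pos (-(δ / 2 * (δ * n)) + -(δ / 2) * X)
        linarith
      · have : 1 ≤ Real.exp (-(δ / 2 * (δ * n)) + -(δ / 2) * X) := Real.one_le_exp (by nlinarith)
        have := Real.exp_pos (-(δ / 2 * (δ * n)) + δ / 2 * X)
        linarith
    · positivity
  rw [Finset.sum_filter]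
  refine (Finset.sum_le_sum fun A _ => h3 A).trans ?_
  rw [← Finset.mul_sum, Finset.sum_add_distrib]
  have h4 : Real.exp (-(δ ^ 2 / 4) * n)
      = Real.exp (-(δ / 2 * (δ * n))) * Real.exp ((δ / 2) ^ 2 * n) := by
    rw [← Real.exp_add]; congr 1; ring
  rw [h4]
  rw [neg_sq] at h2
  have := mul_le_mul_of_nonneg_left (add_le_add h1 h2) (Real.exp_pos (-(δ / 2 * (δ * n)))).le
  linarith

lemma sum_bernoulliWeight_not_concentrated_le {n : ℕ} {p : ℕ → ℝ}
    (hp : ∀ j < n, 0 ≤ p j ∧ p j ≤ 1) {δ : ℝ} (hδ : 0 ≤ δ) (hδ' : δ ≤ 2) :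
    ∑ A : Finset (Fin n) with ¬ Concentrated p δ A, bernoulliWeight p A
      ≤ (n + 1) * (2 * Real.exp (-(δ ^ 2 / 4) * n)) := by
  have h0 := bernoulliWeight_nonneg hp
  have hle : ∀ A : Finset (Fin n), (if ¬ Concentrated p δ A then bernoulliWeight p A else 0) ≤
      ∑ t ∈ Finset.range (n + 1),
        if δ * n < |(countBelow A t : ℝ) - ∑ j ∈ Finset.range t, p j| then
          bernoulliWeight p A else 0 := by
    intro A
    have hnn : ∀ t ∈ Finset.range (n + 1),
        0 ≤ if δ * n < |(countBelow A t : ℝ) - ∑ j ∈ Finset.range t, p j| then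
          bernoulliWeight p A else 0 := fun t _ => by
      split_ifs
      · exact h0 A
      · exact le_rfl
    split_ifs with hA
    · exact Finset.sum_nonneg hnn
    · unfold Concentrated at hA
      push Not at hA
      obtain ⟨t, ht, h⟩ := hA
      refine le_trans ?_ (Finset.single_le_sum hnn (Finset.mem_range.2 (Nat.lt_succ_of_le ht)))
      rw [if_pos h]
  rw [Finset.sum_filter]
  refine (Finset.sum_le_sum fun A _ => hle A).trans ?_
  rw [Finset.sum_comm]
  have := Finset.sum_le_card_nsmul (Finset.range (n + 1)) (fun t => ∑ A : Finset (Fin n),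
      if δ * n < |(countBelow A t : ℝ) - ∑ j ∈ Finset.range t, p j| then
          bernoulliWeight p A else 0) (2 * Real.exp (-(δ ^ 2 / 4) * n)) fun t ht => by
    rw [← Finset.sum_filter]
    exact sum_bernoulliWeight_tail_le hp hδ hδ' (Nat.lt_succ_iff.1 (Finset.mem_range.1 ht))
  simpa using this

/-! ### Admissible pairs have subexponentially small probability at worst -/

lemma bernoulliWeight_le_of_agree {n : ℕ} {p : ℕ → ℝ} {c : ℝ} (hc : 1 ≤ c)
    (hp : ∀ j < n, 1 / c ≤ p j ∧ p j ≤ 1 - 1 / c) {A A' O : Finset (Fin n)}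
    (h : ∀ i ∉ O, (i ∈ A ↔ i ∈ A')) :
    bernoulliWeight p A ≤ c ^ O.card * bernoulliWeight p A' := by
  have hc0 : 0 < c := by linarith
  have hc1 : 0 < 1 / c := by positivity
  have : c ^ O.card = ∏ i : Fin n, if i ∈ O then c else 1 := by
    rw [← Finset.prod_filter, Finset.prod_const]
    congr 2
    ext; simp
  rw [this, bernoulliWeight, bernoulliWeight, ← Finset.prod_mul_distrib]
  refine Finset.prod_le_prod (fun i _ => ?_) fun i _ => ?_
  · have := hp i i.2
    split_ifs <;> linarith
  · have h1 := hp i i.2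
    by_cases hi : i ∈ O
    · rw [if_pos hi]
      have h2 : ∀ x, 1 / c ≤ x → 1 ≤ c * x := fun x hx => by
        have := mul_le_mul_of_nonneg_left hx hc0.le
        rwa [mul_one_div_cancel hc0.ne'] at this
      refine le_trans (b := 1) ?_ (h2 _ ?_) <;> split_ifs <;> linarith
    · rw [if_neg hi, one_mul]
      simp only [h i hi]
      exact le_rfl

/-- The indices outside `[M, N)`. -/
def outerIdx (n M N : ℕ) : Finset (Fin n) :=
  Finset.univ.filter fun i : Fin n => (i : ℕ) < M ∨ N ≤ i

lemma mem_outerIdx {n M N : ℕ} {i : Fin n} : i ∈ outerIdx n M N ↔ (i : ℕ) < M ∨ N ≤ i := by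
  simp [outerIdx]

lemma card_outerIdx_le (n M N : ℕ) : (outerIdx n M N).card ≤ M + (n - N) := by
  have := Finset.card_le_card_of_injOn (s := outerIdx n M N)
    (t := Finset.range M ∪ Finset.Ico N n) (fun i => (i : ℕ))
    (fun i hi => by
      have := mem_outerIdx.1 hi
      simpa using this) Fin.val_injective.injOn
  refine this.trans ((Finset.card_union_le _ _).trans ?_)
  simp

lemma mem_bridgeFst_iff {n M N v : ℕ} {A : Finset (Fin n)} {i : Fin n}
    (hi : i ∉ outerIdx n M N) : i ∈ A ↔ i ∈ bridgeFst M N v A := by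
  rw [mem_outerIdx, not_or, not_lt, not_le] at hi
  rw [mem_bridgeFst]
  constructor
  · exact fun h => Or.inr (Or.inl ⟨hi.2, h⟩)
  · rintro (h | h | h)
    · omega
    · exact h.2
    · omega

lemma mem_bridgeSnd_iff {n M N : ℕ} {B : Finset (Fin n)} {i : Fin n}
    (hi : i ∉ outerIdx n M N) : i ∈ B ↔ i ∈ bridgeSnd M N B := by
  rw [mem_outerIdx, not_or, not_lt, not_le] at hi
  rw [mem_bridgeSnd]
  exact ⟨fun h => ⟨hi.1, fun _ => h⟩, fun h => h.2 hi.2⟩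

/-- The probability of a pair `(A, B)` of independent subsets, `A` with inclusion probabilities
`1 - r` and `B` with inclusion probabilities `r`. -/
def pairWeight {n : ℕ} (r : ℕ → ℝ) (P : Finset (Fin n) × Finset (Fin n)) : ℝ :=
  bernoulliWeight (fun j => 1 - r j) P.1 * bernoulliWeight r P.2

/-- All initial counts of both subsets are close to their means. -/
def TypicalPair {n : ℕ} (r : ℕ → ℝ) (δ : ℝ) (P : Finset (Fin n) × Finset (Fin n)) : Prop :=
  Concentrated (fun j => 1 - r j) δ P.1 ∧ Concentrated r δ P.2

/-- Admissible pairs whose walk stays below `D`. -/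
def BoundedAdmissible {n : ℕ} (D : ℕ) (P : Finset (Fin n) × Finset (Fin n)) : Prop :=
  Admissible P.1 P.2 ∧ ∀ t ≤ n, countBelow P.1 t ≤ countBelow P.2 t + D

/-- The defect used to close up the walk of a pair of subsets. -/
def bridgeDefect {n : ℕ} (M N : ℕ) (P : Finset (Fin n) × Finset (Fin n)) : ℕ :=
  (M + countBelow P.1 N + countBelow P.2 M) - (countBelow P.2 N + countBelow P.1 M)

/-- The admissible pair built from a typical one. -/
def bridgePair {n : ℕ} (M N : ℕ) (P : Finset (Fin n) × Finset (Fin n)) :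
    Finset (Fin n) × Finset (Fin n) :=
  (bridgeFst M N (bridgeDefect M N P) P.1, bridgeSnd M N P.2)

lemma pairWeight_nonneg {n : ℕ} {r : ℕ → ℝ} (hr : ∀ j < n, 0 ≤ r j ∧ r j ≤ 1)
    (P : Finset (Fin n) × Finset (Fin n)) : 0 ≤ pairWeight r P :=
  mul_nonneg (bernoulliWeight_nonneg (fun j hj => by have := hr j hj; constructor <;> linarith) _)
    (bernoulliWeight_nonneg hr _)

lemma pairWeight_le_bridgePair {n : ℕ} {r : ℕ → ℝ} {c : ℝ} (hc : 1 ≤ c)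
    (hr : ∀ j < n, 1 / c ≤ r j ∧ r j ≤ 1 - 1 / c) (M N : ℕ)
    (P : Finset (Fin n) × Finset (Fin n)) :
    pairWeight r P ≤ (c ^ 2) ^ (outerIdx n M N).card * pairWeight r (bridgePair M N P) := by
  have hc1 : 0 < 1 / c := by positivity
  have h1 := bernoulliWeight_le_of_agree hc (p := fun j => 1 - r j)
    (fun j hj => by have := hr j hj; constructor <;> linarith)
    (A := P.1) (A' := (bridgePair M N P).1) (O := outerIdx n M N) fun i hi => mem_bridgeFst_iff hi
  have h2 := bernoulliWeight_le_of_agree hc hr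
    (A := P.2) (A' := (bridgePair M N P).2) (O := outerIdx n M N) fun i hi => mem_bridgeSnd_iff hi
  have h3 : ∀ j < n, 0 ≤ r j ∧ r j ≤ 1 := fun j hj => by
    have := hr j hj; constructor <;> linarith
  have h4 := mul_le_mul h1 h2 (bernoulliWeight_nonneg h3 _)
    (mul_nonneg (by positivity) (bernoulliWeight_nonneg
      (fun j hj => by have := h3 j hj; constructor <;> linarith) _))
  refine h4.trans (le_of_eq ?_)
  rw [pairWeight, ← pow_mul, mul_comm 2, pow_mul]
  ring

lemma sum_pairWeight_le_of_bridgePair {n : ℕ} {r : ℕ → ℝ} {c : ℝ} (hc : 1 ≤ c)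
    (hr : ∀ j < n, 1 / c ≤ r j ∧ r j ≤ 1 - 1 / c) {M N : ℕ}
    {S T : Finset (Finset (Fin n) × Finset (Fin n))} (h : ∀ P ∈ S, bridgePair M N P ∈ T) :
    ∑ P ∈ S, pairWeight r P ≤ (4 * c ^ 2) ^ (M + (n - N)) * ∑ P ∈ T, pairWeight r P := by
  have hc1 : 0 < 1 / c := by positivity
  have h0 : ∀ P : Finset (Fin n) × Finset (Fin n), 0 ≤ pairWeight r P := pairWeight_nonneg
    fun j hj => by have := hr j hj; constructor <;> linarith
  set O := outerIdx n M N with hO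
  let f : Finset (Fin n) × Finset (Fin n) → (Finset (Fin n) × Finset (Fin n)) ×
      (Finset (Fin n) × Finset (Fin n)) := fun P => (bridgePair M N P, (P.1 ∩ O, P.2 ∩ O))
  have hf : Function.Injective f := by
    rintro ⟨A, B⟩ ⟨A', B'⟩ hP
    simp only [f, bridgePair, Prod.mk.injEq] at hP
    obtain ⟨⟨h1, h2⟩, h3, h4⟩ := hP
    rw [Prod.mk.injEq]
    constructor <;> ext i <;> by_cases hi : i ∈ O
    · have := Finset.ext_iff.1 h3 i
      simpa [hi] using this
    · rw [mem_bridgeFst_iff hi, h1, ← mem_bridgeFst_iff hi]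
    · have := Finset.ext_iff.1 h4 i
      simpa [hi] using this
    · rw [mem_bridgeSnd_iff hi, h2, ← mem_bridgeSnd_iff hi]
  calc ∑ P ∈ S, pairWeight r P
      ≤ ∑ P ∈ S, (c ^ 2) ^ O.card * pairWeight r (f P).1 :=
        Finset.sum_le_sum fun P _ => pairWeight_le_bridgePair hc hr M N P
    _ = ∑ y ∈ S.image f, (c ^ 2) ^ O.card * pairWeight r y.1 :=
        (Finset.sum_image (f := fun y : (Finset (Fin n) × Finset (Fin n)) ×
          (Finset (Fin n) × Finset (Fin n)) => (c ^ 2) ^ O.card * pairWeight r y.1)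
          hf.injOn).symm
    _ ≤ ∑ y ∈ T ×ˢ (O.powerset ×ˢ O.powerset), (c ^ 2) ^ O.card * pairWeight r y.1 := by
        refine Finset.sum_le_sum_of_subset_of_nonneg ?_ fun y _ _ => by
          have := h0 y.1
          positivity
        intro y hy
        obtain ⟨P, hP, rfl⟩ := Finset.mem_image.1 hy
        simp only [f, Finset.mem_product, Finset.mem_powerset]
        exact ⟨h P hP, Finset.inter_subset_right, Finset.inter_subset_right⟩
    _ = (4 * c ^ 2) ^ O.card * ∑ P ∈ T, pairWeight r P := by
        rw [Finset.sum_product]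
        simp only [Finset.sum_const, Finset.card_product, Finset.card_powerset, nsmul_eq_mul]
        rw [← Finset.mul_sum, ← Finset.mul_sum, ← mul_assoc, mul_pow]
        congr 2
        push_cast
        rw [← mul_pow]
        norm_num
    _ ≤ _ := by
        refine mul_le_mul_of_nonneg_right ?_ (Finset.sum_nonneg fun P _ => h0 P)
        exact pow_le_pow_right₀ (by nlinarith) (card_outerIdx_le n M N)

lemma TypicalPair.boundedAdmissible_bridgePair {n : ℕ} {r : ℕ → ℝ} {C : ℕ} (hC : 1 ≤ C)
    (hr : ∀ j < n, 1 / (C : ℝ) ≤ r j ∧ r j ≤ 1 - 1 / (C : ℝ)) {e δ : ℝ} {D K : ℕ}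
    (hS : ∀ t ≤ n, 2 * ∑ j ∈ Finset.range t, r j ≤ t + e)
    (hSn : (n : ℝ) ≤ 2 * ∑ j ∈ Finset.range n, r j + e)
    (hSD : ∀ t ≤ n, (t : ℝ) ≤ 2 * ∑ j ∈ Finset.range t, r j + D)
    (hK : 4 * (δ * n) + 2 * e + 1 ≤ K) (he : 0 ≤ e) (hδ : 0 ≤ δ)
    (hn : C * K + C * (C + 1) * K ≤ n)
    {P : Finset (Fin n) × Finset (Fin n)} (hP : TypicalPair r δ P) :
    BoundedAdmissible (C * K + K + D)
      (bridgePair (C * K) (n - C * (C + 1) * K) P) := by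
  obtain ⟨A, B⟩ := P
  obtain ⟨hA, hB⟩ := hP
  dsimp only at hA hB
  set S : ℕ → ℝ := fun t => ∑ j ∈ Finset.range t, r j with hSdef
  change ∀ t ≤ n, 2 * S t ≤ t + e at hS
  change (n : ℝ) ≤ 2 * S n + e at hSn
  change ∀ t ≤ n, (t : ℝ) ≤ 2 * S t + D at hSD
  have hA' : ∀ t ≤ n, |(countBelow A t : ℝ) - (t - S t)| ≤ δ * n := by
    intro t ht
    have := hA t ht
    rwa [Finset.sum_sub_distrib, Finset.sum_const, Finset.card_range, nsmul_one] at this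
  have hB' : ∀ t ≤ n, |(countBelow B t : ℝ) - S t| ≤ δ * n := hB
  set k : ℝ := δ * n with hk
  have hk0 : 0 ≤ k := by positivity
  obtain ⟨M, hM⟩ : ∃ M, M = C * K := ⟨_, rfl⟩
  obtain ⟨L, hL⟩ : ∃ L, L = C * (C + 1) * K := ⟨_, rfl⟩
  obtain ⟨N, hN⟩ : ∃ N, N = n - L := ⟨_, rfl⟩
  rw [← hM, ← hL] at hn
  have hNL : N + L = n := by omega
  have hMN : M ≤ N := by omega
  rw [← hL, ← hN, ← hM]
  have hC0 : (0 : ℝ) < C := by exact_mod_cast hC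
  have hMR : (M : ℝ) = C * K := by exact_mod_cast hM
  have hLR : (L : ℝ) = C * (C + 1) * K := by exact_mod_cast hL
  have hNR : (N : ℝ) + L = n := by exact_mod_cast hNL
  have hSM : (K : ℝ) ≤ S M := by
    have := Finset.card_nsmul_le_sum (Finset.range M) r (1 / C) fun j hj =>
      (hr j (by have := Finset.mem_range.1 hj; omega)).1
    rw [Finset.card_range, nsmul_eq_mul, hMR] at this
    field_simp at this
    exact this
  have hSN : S n - S N ≤ L - (C + 1) * K := by
    have h1 := Finset.sum_range_add_sum_Ico r (show N ≤ n by omega)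
    have := Finset.sum_le_card_nsmul (Finset.Ico N n) r (1 - 1 / C) fun j hj =>
      (hr j (by have := Finset.mem_Ico.1 hj; omega)).2
    rw [Nat.card_Ico, show n - N = L by omega, nsmul_eq_mul, mul_sub, mul_one,
      show (L : ℝ) * (1 / C) = (C + 1) * K by rw [hLR]; field_simp] at this
    simp only [hSdef]
    linarith
  have hCK : (0 : ℝ) ≤ C * K := by positivity
  have hKK : (0 : ℝ) ≤ K := by positivity
  have hAM := abs_le.1 (hA' M (by omega))
  have hBM := abs_le.1 (hB' M (by omega))
  have hAN := abs_le.1 (hA' N (by omega))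
  have hBN := abs_le.1 (hB' N (by omega))
  have hpos : ∀ t, M ≤ t → t ≤ N →
      countBelow B t + countBelow A M < M + countBelow A t + countBelow B M := by
    intro t h1 h2
    have h3 := abs_le.1 (hA' t (by omega))
    have h4 := abs_le.1 (hB' t (by omega))
    have h5 := hS t (by omega)
    have : (countBelow B t : ℝ) + countBelow A M < M + countBelow A t + countBelow B M := by
      linarith
    exact_mod_cast this
  have hv : countBelow B N + countBelow A M + bridgeDefect M N (A, B) =
      M + countBelow A N + countBelow B M := by
    have := hpos N hMN le_rfl
    simp only [bridgeDefect]
    omega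
  have hSM' := hS M (by omega)
  have hv' : bridgeDefect M N (A, B) ≤ n - N := by
    have h1 : (M : ℝ) + countBelow A N + countBelow B M
        ≤ L + (countBelow B N + countBelow A M) := by
      linarith
    have h2 : M + countBelow A N + countBelow B M
        ≤ L + (countBelow B N + countBelow A M) := by exact_mod_cast h1
    omega
  refine ⟨admissible_bridge hMN (by omega) hv hv' hpos, ?_⟩
  refine bridge_walk_le hMN (by omega) hv fun t h1 h2 => ?_
  have h3 := abs_le.1 (hA' t (by omega))
  have h4 := abs_le.1 (hB' t (by omega))
  have h5 := hSD t (by omega)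
  have : (M : ℝ) + countBelow A t + countBelow B M
      ≤ countBelow B t + countBelow A M + (M + K + D) := by
    linarith
  exact_mod_cast this

/-! ### Comparison of the conditioned Mallows measure with independent subsets -/

/-- The weak excedances of a permutation and their values. -/
def excPair {n : ℕ} (σ : Equiv.Perm (Fin n)) : Finset (Fin n) × Finset (Fin n) :=
  (excSet σ, excVals σ)

/-- The normalising product relating `pairWeight` to exponential weights. -/
def pairNorm (n : ℕ) (r : ℕ → ℝ) : ℝ := ∏ i : Fin n, r i * (1 - r i)

lemma pairNorm_pos {n : ℕ} {r : ℕ → ℝ} (hr : ∀ j < n, 0 < r j ∧ r j < 1) : 0 < pairNorm n r :=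
  Finset.prod_pos fun i _ => mul_pos (hr i i.2).1 (by have := (hr i i.2).2; linarith)

lemma bernoulliWeight_eq_mul_exp {n : ℕ} {p : ℕ → ℝ} {u : ℕ → ℝ}
    (h : ∀ j < n, p j = (1 - p j) * Real.exp (u j)) (A : Finset (Fin n)) :
    bernoulliWeight p A = (∏ i : Fin n, (1 - p i)) * Real.exp (∑ i ∈ A, u i) := by
  have : Real.exp (∑ i ∈ A, u i) = ∏ i : Fin n, if i ∈ A then Real.exp (u i) else 1 := by
    rw [Real.exp_sum, ← Finset.prod_filter]
    refine Finset.prod_congr ?_ fun _ _ => rfl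
    ext; simp
  rw [this, ← Finset.prod_mul_distrib, bernoulliWeight]
  refine Finset.prod_congr rfl fun i _ => ?_
  split_ifs
  · exact h i i.2
  · rw [mul_one]

lemma pairWeight_eq {n : ℕ} {r : ℕ → ℝ} {θ c : ℝ}
    (h : ∀ j < n, 1 - r j = r j * Real.exp (θ * (c - j))) {A B : Finset (Fin n)}
    (hcard : A.card = B.card) :
    pairWeight r (A, B) =
      pairNorm n r * Real.exp (θ * (∑ i ∈ B, (i : ℝ) - ∑ i ∈ A, (i : ℝ))) := by
  have h1 := bernoulliWeight_eq_mul_exp (n := n) (p := fun j => 1 - r j)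
    (u := fun j => θ * (c - j)) (fun j hj => by simp only [sub_sub_cancel]; exact h j hj) A
  have h2 := bernoulliWeight_eq_mul_exp (n := n) (p := r)
    (u := fun j => -(θ * (c - j))) (fun j hj => by
      rw [h j hj, mul_assoc, ← Real.exp_add]; simp) B
  rw [pairWeight, h1, h2, pairNorm, Finset.prod_mul_distrib]
  simp only [sub_sub_cancel]
  have h3 : Real.exp (θ * (∑ i ∈ B, (i : ℝ) - ∑ i ∈ A, (i : ℝ)))
      = Real.exp (∑ i ∈ A, θ * (c - (i : ℕ))) * Real.exp (∑ i ∈ B, -(θ * (c - (i : ℕ)))) := by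
    rw [← Real.exp_add]
    congr 1
    rw [Finset.sum_neg_distrib, ← Finset.mul_sum, ← Finset.mul_sum, Finset.sum_sub_distrib,
      Finset.sum_sub_distrib, Finset.sum_const, Finset.sum_const, hcard]
    ring
  rw [h3]
  ring

lemma Avoids321.pairWeight_excPair {n : ℕ} {r : ℕ → ℝ} {θ c : ℝ}
    (h : ∀ j < n, 1 - r j = r j * Real.exp (θ * (c - j))) {σ : Equiv.Perm (Fin n)}
    (hσ : Avoids321 σ) :
    pairWeight r (excPair σ) = pairNorm n r * Real.exp (θ * invCount σ) := by
  rw [excPair, pairWeight_eq h (card_excVals σ).symm]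
  have : (invCount σ : ℝ) + ∑ i ∈ excSet σ, (i : ℝ) = ∑ i ∈ excVals σ, (i : ℝ) := by
    exact_mod_cast hσ.invCount_add_sum
  rw [← this]
  congr 3
  ring

lemma injOn_excPair (n : ℕ) :
    InjOn (excPair (n := n)) {σ : Equiv.Perm (Fin n) | Avoids321 σ} := by
  intro σ hσ τ hτ h
  rw [excPair, excPair, Prod.mk.injEq] at h
  exact Avoids321.eq_of_excSet_eq hσ hτ h.1 h.2

lemma sum_exp_not_typical_le {n : ℕ} {r : ℕ → ℝ} {β b c δ : ℝ} (hβ : β ≤ b)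
    (hr : ∀ j < n, 0 < r j ∧ r j < 1)
    (h : ∀ j < n, 1 - r j = r j * Real.exp (b / n * (c - j))) :
    pairNorm n r * ∑ σ : Equiv.Perm (Fin n) with Avoids321 σ ∧ ¬ TypicalPair r δ (excPair σ),
      Real.exp (β / n * invCount σ) ≤
      ∑ P : Finset (Fin n) × Finset (Fin n) with ¬ TypicalPair r δ P, pairWeight r P := by
  have h0 := pairNorm_pos hr
  set S : Finset (Equiv.Perm (Fin n)) :=
    Finset.univ.filter fun σ => Avoids321 σ ∧ ¬ TypicalPair r δ (excPair σ) with hS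
  have hmem : ∀ σ ∈ S, Avoids321 σ ∧ ¬ TypicalPair r δ (excPair σ) := fun σ hσ =>
    (Finset.mem_filter.1 hσ).2
  rw [Finset.mul_sum]
  calc ∑ σ ∈ S, pairNorm n r * Real.exp (β / n * invCount σ)
      ≤ ∑ σ ∈ S, pairWeight r (excPair σ) := by
        refine Finset.sum_le_sum fun σ hσ => ?_
        rw [(hmem σ hσ).1.pairWeight_excPair h]
        gcongr
    _ = ∑ P ∈ S.image excPair, pairWeight r P :=
        (Finset.sum_image fun σ hσ τ hτ =>
          injOn_excPair n (hmem σ hσ).1 (hmem τ hτ).1).symm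
    _ ≤ _ := by
        refine Finset.sum_le_sum_of_subset_of_nonneg ?_ fun P _ _ =>
          pairWeight_nonneg (fun j hj => ⟨(hr j hj).1.le, (hr j hj).2.le⟩) P
        intro P hP
        obtain ⟨σ, hσ, rfl⟩ := Finset.mem_image.1 hP
        exact Finset.mem_filter.2 ⟨Finset.mem_univ _, (hmem σ hσ).2⟩

lemma Avoids321.invCount_le {n D : ℕ} {σ : Equiv.Perm (Fin n)} (hσ : Avoids321 σ)
    (h : BoundedAdmissible D (excPair σ)) : invCount σ ≤ n * D := by
  have h1 := hσ.invCount_add_sum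
  have h2 := sum_add_sum_countBelow (excSet σ)
  have h3 := sum_add_sum_countBelow (excVals σ)
  rw [card_excVals] at h3
  have h4 : ∑ t ∈ Finset.range n, countBelow (excSet σ) (t + 1)
      ≤ ∑ t ∈ Finset.range n, (countBelow (excVals σ) (t + 1) + D) :=
    Finset.sum_le_sum fun t ht => h.2 (t + 1) (Finset.mem_range.1 ht)
  rw [Finset.sum_add_distrib, Finset.sum_const, Finset.card_range, smul_eq_mul] at h4
  omega

lemma sum_boundedAdmissible_le {n D : ℕ} {r : ℕ → ℝ} {β b c : ℝ} (hβ : β ≤ b) (hn : 1 ≤ n)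
    (hr : ∀ j < n, 0 < r j ∧ r j < 1)
    (h : ∀ j < n, 1 - r j = r j * Real.exp (b / n * (c - j))) :
    ∑ P : Finset (Fin n) × Finset (Fin n) with BoundedAdmissible D P, pairWeight r P ≤
      Real.exp ((b - β) * D) * (pairNorm n r * Z321 β n) := by
  have h0 := pairNorm_pos hr
  have hn0 : (0 : ℝ) < n := by exact_mod_cast hn
  set T : Finset (Finset (Fin n) × Finset (Fin n)) :=
    Finset.univ.filter fun P => BoundedAdmissible D P
  set S : Finset (Equiv.Perm (Fin n)) :=
    Finset.univ.filter fun σ => Avoids321 σ ∧ BoundedAdmissible D (excPair σ)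
  have hmem : ∀ σ ∈ S, Avoids321 σ ∧ BoundedAdmissible D (excPair σ) := fun σ hσ =>
    (Finset.mem_filter.1 hσ).2
  have hnn : ∀ P : Finset (Fin n) × Finset (Fin n), 0 ≤ pairWeight r P :=
    pairWeight_nonneg (fun j hj => ⟨(hr j hj).1.le, (hr j hj).2.le⟩)
  calc ∑ P ∈ T, pairWeight r P ≤ ∑ P ∈ S.image excPair, pairWeight r P := by
        refine Finset.sum_le_sum_of_subset_of_nonneg ?_ fun P _ _ => hnn P
        intro P hP
        have hP' := (Finset.mem_filter.1 hP).2
        obtain ⟨σ, h1, h2, h3⟩ := hP'.1.exists_perm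
        have h4 : excPair σ = P := by rw [excPair, h2, h3]
        exact Finset.mem_image.2 ⟨σ, Finset.mem_filter.2
          ⟨Finset.mem_univ _, h1, by rwa [h4]⟩, h4⟩
    _ = ∑ σ ∈ S, pairWeight r (excPair σ) :=
        Finset.sum_image fun σ hσ τ hτ => injOn_excPair n (hmem σ hσ).1 (hmem τ hτ).1
    _ ≤ ∑ σ ∈ S, Real.exp ((b - β) * D) * (pairNorm n r * Real.exp (β / n * invCount σ)) := by
        refine Finset.sum_le_sum fun σ hσ => ?_
        rw [(hmem σ hσ).1.pairWeight_excPair h, mul_left_comm, ← Real.exp_add]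
        have h1 : (invCount σ : ℝ) ≤ n * D := by
          exact_mod_cast (hmem σ hσ).1.invCount_le (hmem σ hσ).2
        gcongr
        have h2 : (b - β) * ((invCount σ : ℝ) / n) ≤ (b - β) * D :=
          mul_le_mul_of_nonneg_left ((div_le_iff₀' hn0).2 h1) (by linarith)
        have h3 : b / n * invCount σ
            = (b - β) * ((invCount σ : ℝ) / n) + β / n * invCount σ := by ring
        linarith
    _ ≤ _ := by
        rw [← Finset.mul_sum, ← Finset.mul_sum, Z321]
        gcongr
        intro σ hσ
        exact Finset.mem_filter.2 ⟨Finset.mem_univ _, (hmem σ hσ).1⟩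

lemma sum_pairWeight (n : ℕ) (r : ℕ → ℝ) :
    ∑ P : Finset (Fin n) × Finset (Fin n), pairWeight r P = 1 := by
  simp only [pairWeight]
  rw [Fintype.sum_prod_type]
  simp only [← Finset.mul_sum, sum_bernoulliWeight, mul_one]

lemma sum_not_typical_le {n : ℕ} {r : ℕ → ℝ} (hr : ∀ j < n, 0 < r j ∧ r j < 1) {δ : ℝ}
    (hδ : 0 ≤ δ) (hδ' : δ ≤ 2) :
    ∑ P : Finset (Fin n) × Finset (Fin n) with ¬ TypicalPair r δ P, pairWeight r P
      ≤ 4 * (n + 1) * Real.exp (-(δ ^ 2 / 4) * n) := by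
  have hr0 : ∀ j < n, 0 ≤ r j ∧ r j ≤ 1 := fun j hj => ⟨(hr j hj).1.le, (hr j hj).2.le⟩
  have hr1 : ∀ j < n, 0 ≤ 1 - r j ∧ 1 - r j ≤ 1 := fun j hj => by
    have := hr0 j hj; constructor <;> linarith
  have h1 := sum_bernoulliWeight_not_concentrated_le hr1 hδ hδ'
  have h2 := sum_bernoulliWeight_not_concentrated_le hr0 hδ hδ'
  rw [Finset.sum_filter] at h1 h2 ⊢
  have h3 : ∀ P : Finset (Fin n) × Finset (Fin n),
      (if ¬ TypicalPair r δ P then pairWeight r P else 0) ≤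
      (if ¬ Concentrated (fun j => 1 - r j) δ P.1 then bernoulliWeight (fun j => 1 - r j) P.1
        else 0) * bernoulliWeight r P.2 + bernoulliWeight (fun j => 1 - r j) P.1 *
      (if ¬ Concentrated r δ P.2 then bernoulliWeight r P.2 else 0) := by
    intro P
    have h4 := bernoulliWeight_nonneg hr1 P.1
    have h5 := bernoulliWeight_nonneg hr0 P.2
    have h6 := mul_nonneg h4 h5
    by_cases hA : Concentrated (fun j => 1 - r j) δ P.1 <;> by_cases hB : Concentrated r δ P.2 <;>
      simp [TypicalPair, pairWeight, hA, hB, h6]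
  refine (Finset.sum_le_sum fun P _ => h3 P).trans ?_
  rw [Finset.sum_add_distrib, Fintype.sum_prod_type, Fintype.sum_prod_type]
  simp only [← Finset.mul_sum, ← Finset.sum_mul, sum_bernoulliWeight, mul_one, one_mul]
  linarith

/-! ### Limit shapes and exponential concentration -/

/-- A density `ρ` on `[0,1]` together with the associated curve `f`. -/
structure LimitShape (ρ f : ℝ → ℝ) (C : ℕ) (L : ℝ) : Prop where
  one_le : 1 ≤ C
  nonneg : 0 ≤ L
  abs_sub_le : ∀ x y, |ρ x - ρ y| ≤ L * |x - y|
  bound : ∀ x ∈ Icc (0 : ℝ) 1, 1 / (C : ℝ) ≤ ρ x ∧ ρ x ≤ 1 - 1 / (C : ℝ)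
  integral_le : ∀ x ∈ Icc (0 : ℝ) 1, ∫ u in (0 : ℝ)..x, ρ u ≤ x / 2
  integral_one : ∫ u in (0 : ℝ)..1, ρ u = 1 / 2
  mem : ∀ x ∈ Icc (0 : ℝ) 1, f x ∈ Icc (0 : ℝ) 1
  eq : ∀ x ∈ Icc (0 : ℝ) 1, f x - ∫ u in (0 : ℝ)..f x, ρ u = ∫ u in (0 : ℝ)..x, ρ u

lemma continuousOn_of_abs_sub_le {H : ℝ → ℝ} {s : Set ℝ} {L : ℝ}
    (hH : ∀ x ∈ s, ∀ y ∈ s, |H x - H y| ≤ L * |x - y|) : ContinuousOn H s := by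
  have : LipschitzOnWith L.toNNReal H s := LipschitzOnWith.of_dist_le_mul fun x hx y hy => by
    rw [Real.dist_eq, Real.dist_eq]
    exact (hH x hx y hy).trans
      (mul_le_mul_of_nonneg_right (Real.le_coe_toNNReal L) (abs_nonneg _))
  exact this.continuousOn

lemma abs_cell_sub_le {H : ℝ → ℝ} {L : ℝ} (hL : 0 ≤ L) {n : ℕ} (hn : 1 ≤ n)
    (hH : ∀ x ∈ Icc (0 : ℝ) 1, ∀ y ∈ Icc (0 : ℝ) 1, |H x - H y| ≤ L * |x - y|)
    {j : ℕ} (hj : j < n) :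
    |H (j / n) - n * ∫ u in (j / n : ℝ)..((j + 1 : ℕ) / n : ℝ), H u| ≤ L / n := by
  have hn0 : (0 : ℝ) < n := by exact_mod_cast hn
  have hj1 : ((j + 1 : ℕ) : ℝ) ≤ n := by exact_mod_cast hj
  have hle : (j / n : ℝ) ≤ ((j + 1 : ℕ) / n : ℝ) := by gcongr; simp
  have hsub : Icc (j / n : ℝ) ((j + 1 : ℕ) / n : ℝ) ⊆ Icc 0 1 :=
    Icc_subset_Icc (by positivity) ((div_le_one hn0).2 hj1)
  have hlen : ((j + 1 : ℕ) / n : ℝ) - j / n = 1 / n := by push_cast; ring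
  have h_integrable : IntervalIntegrable H volume (j / n : ℝ) ((j + 1 : ℕ) / n : ℝ) := by
    apply ContinuousOn.intervalIntegrable
    rw [uIcc_of_le hle]
    exact (continuousOn_of_abs_sub_le hH).mono hsub
  have h1 : H (j / n) - n * ∫ u in (j / n : ℝ)..((j + 1 : ℕ) / n : ℝ), H u
      = n * ∫ u in (j / n : ℝ)..((j + 1 : ℕ) / n : ℝ), (H (j / n) - H u) := by
    rw [intervalIntegral.integral_sub intervalIntegrable_const h_integrable,
      intervalIntegral.integral_const, hlen, smul_eq_mul]
    field_simp
  have h2 : ‖∫ u in (j / n : ℝ)..((j + 1 : ℕ) / n : ℝ), (H (j / n) - H u)‖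
      ≤ L * (1 / n) * |((j + 1 : ℕ) / n : ℝ) - j / n| := by
    refine intervalIntegral.norm_integral_le_of_norm_le_const fun u hu => ?_
    rw [uIoc_of_le hle] at hu
    have hu' := Ioc_subset_Icc_self hu
    refine (hH _ (hsub (left_mem_Icc.2 hle)) _ (hsub hu')).trans ?_
    gcongr
    rw [abs_sub_comm, abs_of_nonneg (by linarith [hu.1])]
    linarith [hu.2]
  rw [h1, abs_mul, abs_of_pos hn0]
  rw [hlen, abs_of_pos (by positivity), Real.norm_eq_abs] at h2
  calc _ ≤ (n : ℝ) * (L * (1 / n) * (1 / n)) := by gcongr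
    _ = L / n := by field_simp

lemma abs_sum_sub_integral_le {H : ℝ → ℝ} {L : ℝ} (hL : 0 ≤ L) {n : ℕ} (hn : 1 ≤ n)
    (hH : ∀ x ∈ Icc (0 : ℝ) 1, ∀ y ∈ Icc (0 : ℝ) 1, |H x - H y| ≤ L * |x - y|)
    {t : ℕ} (ht : t ≤ n) :
    |∑ j ∈ Finset.range t, H (j / n) - n * ∫ u in (0 : ℝ)..(t / n : ℝ), H u| ≤ L := by
  have hn0 : (0 : ℝ) < n := by exact_mod_cast hn
  have hsum : ∫ u in (0 : ℝ)..(t / n : ℝ), H u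
      = ∑ j ∈ Finset.range t, ∫ u in (j / n : ℝ)..((j + 1 : ℕ) / n : ℝ), H u := by
    rw [intervalIntegral.sum_integral_adjacent_intervals (a := fun j : ℕ => (j / n : ℝ))]
    · simp
    · intro j hj
      apply ContinuousOn.intervalIntegrable
      have hle : (j / n : ℝ) ≤ ((j + 1 : ℕ) / n : ℝ) := by gcongr; simp
      rw [uIcc_of_le hle]
      refine (continuousOn_of_abs_sub_le hH).mono
        (Icc_subset_Icc (by positivity) ((div_le_one hn0).2 ?_))
      exact_mod_cast (Nat.succ_le_of_lt hj).trans ht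
  rw [hsum, Finset.mul_sum, ← Finset.sum_sub_distrib]
  calc _ ≤ ∑ j ∈ Finset.range t, L / n := (Finset.abs_sum_le_sum_abs _ _).trans
        (Finset.sum_le_sum fun j hj =>
          abs_cell_sub_le hL hn hH ((Finset.mem_range.1 hj).trans_le ht))
    _ = t * (L / n) := by rw [Finset.sum_const, Finset.card_range, nsmul_eq_mul]
    _ ≤ n * (L / n) := by gcongr
    _ = L := by field_simp

lemma natCast_div_mem {n j : ℕ} (h : j ≤ n) : (j / n : ℝ) ∈ Icc (0 : ℝ) 1 :=
  ⟨by positivity, div_le_one_of_le₀ (by exact_mod_cast h) (by positivity)⟩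

namespace LimitShape

variable {ρ f : ℝ → ℝ} {C : ℕ} {L : ℝ}

lemma abs_sum_sub_le (h : LimitShape ρ f C L) {n : ℕ} (hn : 1 ≤ n) {t : ℕ} (ht : t ≤ n) :
    |∑ j ∈ Finset.range t, ρ (j / n) - n * ∫ u in (0 : ℝ)..(t / n : ℝ), ρ u| ≤ L :=
  abs_sum_sub_integral_le h.nonneg hn (fun x _ y _ => h.abs_sub_le x y) ht

lemma two_mul_sum_le (h : LimitShape ρ f C L) {n : ℕ} (hn : 1 ≤ n) {t : ℕ} (ht : t ≤ n) :
    2 * ∑ j ∈ Finset.range t, ρ (j / n) ≤ t + 2 * L := by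
  have hn0 : (0 : ℝ) < n := by exact_mod_cast hn
  have h1 := (abs_le.1 (h.abs_sum_sub_le hn ht)).2
  have h2 := mul_le_mul_of_nonneg_left (h.integral_le _ (natCast_div_mem ht)) hn0.le
  have h3 : (n : ℝ) * (t / n / 2) = t / 2 := by field_simp
  linarith

lemma le_two_mul_sum (h : LimitShape ρ f C L) {n : ℕ} (hn : 1 ≤ n) :
    (n : ℝ) ≤ 2 * ∑ j ∈ Finset.range n, ρ (j / n) + 2 * L := by
  have hn0 : (0 : ℝ) < n := by exact_mod_cast hn
  have h1 := (abs_le.1 (h.abs_sum_sub_le hn le_rfl)).1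
  rw [div_self hn0.ne', h.integral_one] at h1
  linarith

lemma sum_not_typical_div_le (h : LimitShape ρ f C L) {β b : ℝ} (hβ : β ≤ b)
    (hcase : b = β ∨ ∀ x, ρ x = 1 / 2) {n : ℕ} (hn : 1 ≤ n)
    (hw : ∀ j < n, 1 - ρ (j / n) = ρ (j / n) * Real.exp (b / n * (n / 2 - j)))
    {δ δ' : ℝ} (hδ : 0 ≤ δ) (hδ2 : δ ≤ 2) (hδ' : 0 ≤ δ') (hδ2' : δ' ≤ 2) {K : ℕ}
    (hK : 4 * (δ' * n) + 4 * L + 1 ≤ K) (hKn : C * K + C * (C + 1) * K ≤ n)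
    (hhalf : 4 * (n + 1) * Real.exp (-(δ' ^ 2 / 4) * n) ≤ 1 / 2) :
    (∑ σ : Equiv.Perm (Fin n) with
        Avoids321 σ ∧ ¬ TypicalPair (fun j => ρ (j / n)) δ (excPair σ),
      Real.exp (β / n * invCount σ)) / Z321 β n ≤
    8 * (n + 1) * Real.exp (-(δ ^ 2 / 4) * n +
      ((C + C * (C + 1)) * Real.log (4 * C ^ 2) + (b - β) * (C + 1)) * K) := by
  have hC : (1 : ℝ) ≤ C := by exact_mod_cast h.one_le
  set r : ℕ → ℝ := fun j => ρ (j / n) with hrdef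
  have hrC : ∀ j < n, 1 / (C : ℝ) ≤ r j ∧ r j ≤ 1 - 1 / (C : ℝ) := fun j hj =>
    h.bound _ (natCast_div_mem hj.le)
  have hC0 : (0 : ℝ) < 1 / C := by positivity
  have hr : ∀ j < n, 0 < r j ∧ r j < 1 := fun j hj =>
    ⟨hC0.trans_le (hrC j hj).1, by linarith [(hrC j hj).2]⟩
  have hN := pairNorm_pos hr
  obtain ⟨D, hD, hDle⟩ : ∃ D : ℕ, (∀ t ≤ n, (t : ℝ) ≤ 2 * ∑ j ∈ Finset.range t, r j + D) ∧
      (b - β) * ((C * K + K + D : ℕ) : ℝ) ≤ (b - β) * (C + 1) * K := by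
    rcases hcase with hb | hρ
    · refine ⟨n, fun t ht => ?_, by simp [hb]⟩
      have h1 : 0 ≤ ∑ j ∈ Finset.range t, r j := Finset.sum_nonneg fun j hj =>
        (hr j ((Finset.mem_range.1 hj).trans_le ht)).1.le
      have h2 : (t : ℝ) ≤ n := by exact_mod_cast ht
      linarith
    · refine ⟨0, fun t _ => ?_, by push_cast; linarith⟩
      simp only [hrdef, hρ, Finset.sum_const, Finset.card_range, nsmul_eq_mul]
      push_cast
      linarith
  have hmap : ∀ P ∈ Finset.univ.filter
      (fun P : Finset (Fin n) × Finset (Fin n) => TypicalPair r δ' P),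
      bridgePair (C * K) (n - C * (C + 1) * K) P ∈ Finset.univ.filter
        (fun P : Finset (Fin n) × Finset (Fin n) => BoundedAdmissible (C * K + K + D) P) := by
    intro P hP
    refine Finset.mem_filter.2 ⟨Finset.mem_univ _, ?_⟩
    exact TypicalPair.boundedAdmissible_bridgePair (e := 2 * L) h.one_le hrC
      (fun t ht => h.two_mul_sum_le hn ht) (h.le_two_mul_sum hn) hD (by linarith)
      (by linarith [h.nonneg]) hδ' hKn (Finset.mem_filter.1 hP).2
  have h1 := sum_pairWeight_le_of_bridgePair hC hrC hmap
  have h2 := sum_boundedAdmissible_le (D := C * K + K + D) hβ hn hr hw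
  have h3 := sum_exp_not_typical_le (δ := δ) hβ hr hw
  have h4 := sum_not_typical_le hr hδ hδ2
  have h5 := sum_not_typical_le hr hδ' hδ2'
  have h6 : 1 / 2 ≤ ∑ P : Finset (Fin n) × Finset (Fin n) with TypicalPair r δ' P,
      pairWeight r P := by
    have := Finset.sum_filter_add_sum_filter_not
      (Finset.univ : Finset (Finset (Fin n) × Finset (Fin n)))
      (fun P => TypicalPair r δ' P) (pairWeight r)
    rw [sum_pairWeight] at this
    linarith
  set m := C * K + (n - (n - C * (C + 1) * K)) with hm
  have hm' : m = C * K + C * (C + 1) * K := by omega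
  have hZ : 0 < Z321 β n := by
    have : 0 < pairNorm n r * Z321 β n := by
      by_contra hneg
      push Not at hneg
      have h7 : Real.exp ((b - β) * ((C * K + K + D : ℕ) : ℝ)) * (pairNorm n r * Z321 β n) ≤ 0 :=
        mul_nonpos_of_nonneg_of_nonpos (Real.exp_pos _).le hneg
      have h8 : (4 * (C : ℝ) ^ 2) ^ m * ∑ P : Finset (Fin n) × Finset (Fin n) with
          BoundedAdmissible (C * K + K + D) P, pairWeight r P ≤ 0 :=
        mul_nonpos_of_nonneg_of_nonpos (by positivity) (h2.trans h7)
      linarith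
    exact pos_of_mul_pos_right this hN.le
  have h9 : (4 * (C : ℝ) ^ 2) ^ m = Real.exp ((C + C * (C + 1)) * Real.log (4 * C ^ 2) * K) := by
    rw [← Real.exp_log (show (0 : ℝ) < 4 * C ^ 2 by positivity), ← Real.exp_nat_mul, hm',
      Real.exp_log (by positivity)]
    congr 1
    push_cast
    ring
  have h10 : 1 / 2 ≤ Real.exp (((C + C * (C + 1)) * Real.log (4 * C ^ 2) +
      (b - β) * (C + 1)) * K) * (pairNorm n r * Z321 β n) := by
    calc _ ≤ _ := h6
      _ ≤ _ := h1
      _ ≤ (4 * (C : ℝ) ^ 2) ^ m * (Real.exp ((b - β) * (C + 1) * K) *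
          (pairNorm n r * Z321 β n)) := by
        gcongr
        exact h2.trans (by gcongr)
      _ = _ := by rw [h9, ← mul_assoc, ← Real.exp_add]; congr 2; ring
  rw [div_le_iff₀ hZ]
  refine le_of_mul_le_mul_left ?_ hN
  refine (h3.trans h4).trans ?_
  rw [Real.exp_add]
  have h11 : (0 : ℝ) ≤ 8 * (n + 1) * Real.exp (-(δ ^ 2 / 4) * n) := by positivity
  have h12 := mul_le_mul_of_nonneg_left h10 h11
  linarith

/-- The `321`-avoiding permutations that are not typical have negligible weight. -/
lemma tendsto_sum_not_typical_div (h : LimitShape ρ f C L) {β b : ℝ} (hβ : β ≤ b)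
    (hcase : b = β ∨ ∀ x, ρ x = 1 / 2)
    (hw : ∀ n : ℕ, ∀ j < n, 1 - ρ (j / n) = ρ (j / n) * Real.exp (b / n * (n / 2 - j)))
    {δ : ℝ} (hδ : 0 < δ) (hδ2 : δ ≤ 2) :
    Tendsto (fun n : ℕ => (∑ σ : Equiv.Perm (Fin n) with
        Avoids321 σ ∧ ¬ TypicalPair (fun j => ρ (j / n)) δ (excPair σ),
      Real.exp (β / n * invCount σ)) / Z321 β n) atTop (nhds 0) := by
  have hC : (1 : ℝ) ≤ C := by exact_mod_cast h.one_le
  have hL := h.nonneg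
  set Λ : ℝ := (C + C * (C + 1)) * Real.log (4 * C ^ 2) + (b - β) * (C + 1) with hΛ
  have hΛ0 : 0 ≤ Λ := by
    have : 0 ≤ Real.log (4 * (C : ℝ) ^ 2) := Real.log_nonneg (by nlinarith)
    have : 0 ≤ b - β := by linarith
    positivity
  set δ' : ℝ := min (min 2 (δ ^ 2 / (32 * (Λ + 1)))) (1 / (8 * (C + C * (C + 1)))) with hδ'
  have hδ'0 : 0 < δ' := by
    refine lt_min (lt_min two_pos (by positivity)) (by positivity)
  have hδ'2 : δ' ≤ 2 := (min_le_left _ _).trans (min_le_left _ _)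
  have hδ'Λ : 4 * δ' * Λ ≤ δ ^ 2 / 8 := by
    have h1 : δ' ≤ δ ^ 2 / (32 * (Λ + 1)) := (min_le_left _ _).trans (min_le_right _ _)
    rw [le_div_iff₀ (by positivity)] at h1
    nlinarith
  have hδ'C : (C + C * (C + 1)) * (4 * δ') ≤ 1 / 2 := by
    have h1 : δ' ≤ 1 / (8 * (C + C * (C + 1))) := min_le_right _ _
    rw [le_div_iff₀ (by positivity)] at h1
    linarith
  have hlim : ∀ a : ℝ, 0 < a → ∀ c : ℝ,
      Tendsto (fun n : ℕ => c * ((n + 1 : ℝ) * Real.exp (-a * n))) atTop (nhds 0) := by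
    intro a ha c
    have h1 : Tendsto (fun x : ℝ => x ^ (1 : ℝ) * Real.exp (-a * x)) atTop (nhds 0) :=
      tendsto_rpow_mul_exp_neg_mul_atTop_nhds_zero 1 a ha
    have h2 : Tendsto (fun x : ℝ => x ^ (0 : ℝ) * Real.exp (-a * x)) atTop (nhds 0) :=
      tendsto_rpow_mul_exp_neg_mul_atTop_nhds_zero 0 a ha
    have h3 := ((h1.add h2).const_mul c).comp tendsto_natCast_atTop_atTop
    simp only [Real.rpow_one, Real.rpow_zero, add_zero, mul_zero] at h3
    refine h3.congr fun n => ?_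
    simp only [Function.comp_apply]
    ring
  have hup := hlim (δ ^ 2 / 8) (by positivity) (8 * Real.exp (Λ * (4 * L + 2)))
  have hhalf := (hlim (δ' ^ 2 / 4) (by positivity) 4).eventually_le_const
    (show (0 : ℝ) < 1 / 2 by norm_num)
  have hbig := tendsto_natCast_atTop_atTop (R := ℝ) |>.eventually_ge_atTop
    (2 * (C + C * (C + 1)) * (4 * L + 2))
  refine squeeze_zero' (Eventually.of_forall fun n => ?_) ?_ hup
  · exact div_nonneg (Finset.sum_nonneg fun _ _ => (Real.exp_pos _).le)
      (Finset.sum_nonneg fun _ _ => (Real.exp_pos _).le)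
  · filter_upwards [hhalf, hbig, eventually_ge_atTop 1] with n h1 h2 h3
    have hn0 : (0 : ℝ) < n := by exact_mod_cast h3
    have hpos : 0 ≤ 4 * (δ' * n) + 4 * L + 1 := by positivity
    set K : ℕ := ⌈4 * (δ' * n) + 4 * L + 1⌉₊
    have hK1 : 4 * (δ' * n) + 4 * L + 1 ≤ K := Nat.le_ceil _
    have hK2 : (K : ℝ) ≤ 4 * (δ' * n) + 4 * L + 2 := by
      have := (Nat.ceil_lt_add_one hpos).le
      linarith
    have hKn : C * K + C * (C + 1) * K ≤ n := by
      have h4 : ((C : ℝ) + C * (C + 1)) * K ≤ (C + C * (C + 1)) * (4 * (δ' * n) + 4 * L + 2) := by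
        gcongr
      have h5 := mul_le_mul_of_nonneg_right hδ'C hn0.le
      have h6 : ((C : ℝ) + C * (C + 1)) * K ≤ n := by linarith
      have h7 : ((C * K + C * (C + 1) * K : ℕ) : ℝ) ≤ n := by push_cast; linarith
      exact_mod_cast h7
    refine (h.sum_not_typical_div_le hβ hcase h3 (hw n) hδ.le hδ2 hδ'0.le hδ'2 hK1 hKn
      (by linarith)).trans ?_
    have h8 : Real.exp (-(δ ^ 2 / 4) * n + Λ * K)
        ≤ Real.exp (Λ * (4 * L + 2)) * Real.exp (-(δ ^ 2 / 8) * n) := by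
      rw [← Real.exp_add]
      refine Real.exp_le_exp.2 ?_
      have h9 := mul_le_mul_of_nonneg_left hK2 hΛ0
      have h10 := mul_le_mul_of_nonneg_right hδ'Λ hn0.le
      linarith
    calc _ ≤ 8 * ((n : ℝ) + 1) *
          (Real.exp (Λ * (4 * L + 2)) * Real.exp (-(δ ^ 2 / 8) * n)) := by gcongr
      _ = _ := by ring

end LimitShape

/-! ### Typical permutations are close to the limit shape -/

lemma Concentrated.abs_compl_sub_le {n : ℕ} {p : ℕ → ℝ} {δ : ℝ} {A : Finset (Fin n)}
    (h : Concentrated p δ A) : Concentrated (fun j => 1 - p j) δ Aᶜ := by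
  intro t ht
  have h1 : (countBelow A t : ℝ) + countBelow Aᶜ t = t := by exact_mod_cast countBelow_compl A ht
  rw [Finset.sum_sub_distrib, Finset.sum_const, Finset.card_range, nsmul_eq_mul, mul_one,
    abs_sub_comm]
  convert h t ht using 2
  linarith

lemma sum_mul_eq_sub_sum (a G : ℕ → ℝ) (t : ℕ) :
    ∑ j ∈ Finset.range t, a j * G j = (∑ j ∈ Finset.range t, a j) * G t -
      ∑ j ∈ Finset.range t, (∑ k ∈ Finset.range (j + 1), a k) * (G (j + 1) - G j) := by
  induction t with
  | zero => simp
  | succ t ih =>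
    rw [Finset.sum_range_succ, ih, Finset.sum_range_succ a t, Finset.sum_range_succ
      (fun j => (∑ k ∈ Finset.range (j + 1), a k) * (G (j + 1) - G j)) t,
      Finset.sum_range_succ a t]
    ring

lemma abs_sum_mul_le {a G : ℕ → ℝ} {n : ℕ} {M c l : ℝ} (hM : 0 ≤ M)
    (ha : ∀ t ≤ n, |∑ j ∈ Finset.range t, a j| ≤ M) (hG : |G n| ≤ c)
    (hG' : ∀ j < n, |G (j + 1) - G j| ≤ l) :
    |∑ j ∈ Finset.range n, a j * G j| ≤ M * (c + n * l) := by
  rw [sum_mul_eq_sub_sum]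
  refine (abs_sub _ _).trans ?_
  rw [mul_add, abs_mul]
  have h1 : |∑ j ∈ Finset.range n, (∑ k ∈ Finset.range (j + 1), a k) * (G (j + 1) - G j)|
      ≤ ∑ j ∈ Finset.range n, M * l := by
    refine (Finset.abs_sum_le_sum_abs _ _).trans (Finset.sum_le_sum fun j hj => ?_)
    have hj' := Finset.mem_range.1 hj
    rw [abs_mul]
    exact mul_le_mul (ha _ hj') (hG' _ hj') (abs_nonneg _) hM
  rw [Finset.sum_const, Finset.card_range, nsmul_eq_mul] at h1
  have h2 : |∑ j ∈ Finset.range n, a j| * |G n| ≤ M * c :=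
    mul_le_mul (ha n le_rfl) hG (abs_nonneg _) hM
  linarith

/-- Sums over a concentrated set are close to integrals. -/
lemma Concentrated.abs_sum_sub_integral_le {n : ℕ} (hn : 1 ≤ n) {ρ G : ℝ → ℝ} {δ : ℝ}
    {S : Finset (Fin n)} (h : Concentrated (fun j => ρ (j / n)) δ S) (hδ : 0 ≤ δ)
    {L c l : ℝ} (hL : 0 ≤ L) (hl : 0 ≤ l)
    (hρ : ∀ x y, |ρ x - ρ y| ≤ L * |x - y|) (hρ1 : ∀ x ∈ Icc (0 : ℝ) 1, |ρ x| ≤ 1)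
    (hG : ∀ x ∈ Icc (0 : ℝ) 1, |G x| ≤ c)
    (hGl : ∀ x ∈ Icc (0 : ℝ) 1, ∀ y ∈ Icc (0 : ℝ) 1, |G x - G y| ≤ l * |x - y|) :
    |∑ i ∈ S, G (i / n) - n * ∫ x in (0 : ℝ)..1, ρ x * G x| ≤
      δ * n * (c + l) + (l + c * L) := by
  have hn0 : (0 : ℝ) < n := by exact_mod_cast hn
  have hc : 0 ≤ c := (abs_nonneg _).trans (hG 0 (by simp))
  have h1 : ∑ i ∈ S, G (i / n) = ∑ j ∈ Finset.range n, (indic S j : ℝ) * G (j / n) := by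
    rw [Finset.sum_range]
    simp only [indic_coe]
    push_cast
    simp only [ite_mul, one_mul, zero_mul]
    rw [← Finset.sum_filter]
    refine Finset.sum_congr ?_ fun _ _ => rfl
    ext; simp
  have h2 := abs_sum_mul_le (a := fun j => (indic S j : ℝ) - ρ (j / n)) (G := fun j => G (j / n))
    (n := n) (M := δ * n) (c := c) (l := l / n) (by positivity)
    (fun t ht => by
      rw [Finset.sum_sub_distrib]
      have := h t ht
      rw [countBelow] at this
      push_cast at this
      exact this)
    (hG _ (natCast_div_mem le_rfl))
    (fun j hj => by
      refine (hGl _ (natCast_div_mem hj) _ (natCast_div_mem hj.le)).trans ?_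
      have : ((j + 1 : ℕ) / n : ℝ) - j / n = 1 / n := by push_cast; ring
      rw [this, abs_of_pos (by positivity), mul_one_div])
  have h3 := _root_.abs_sum_sub_integral_le (H := fun x => ρ x * G x) (L := l + c * L)
    (by positivity) hn (fun x hx y hy => by
      have e : ρ x * G x - ρ y * G y = ρ x * (G x - G y) + G y * (ρ x - ρ y) := by ring
      rw [e]
      refine (abs_add_le _ _).trans ?_
      rw [abs_mul, abs_mul, add_mul]
      have h4 : |ρ x| * |G x - G y| ≤ 1 * (l * |x - y|) :=
        mul_le_mul (hρ1 x hx) (hGl x hx y hy) (abs_nonneg _) zero_le_one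
      have h5 : |G y| * |ρ x - ρ y| ≤ c * (L * |x - y|) :=
        mul_le_mul (hG y hy) (hρ x y) (abs_nonneg _) hc
      linarith) le_rfl
  rw [div_self hn0.ne'] at h3
  have h4 : (n : ℝ) * (l / n) = l := by field_simp
  rw [h4] at h2
  have h5 : ∑ i ∈ S, G (i / n) - n * ∫ x in (0 : ℝ)..1, ρ x * G x =
      ∑ j ∈ Finset.range n, ((indic S j : ℝ) - ρ (j / n)) * G (j / n) +
      (∑ j ∈ Finset.range n, ρ (j / n) * G (j / n) - n * ∫ x in (0 : ℝ)..1, ρ x * G x) := by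
    simp only [sub_mul]
    rw [Finset.sum_sub_distrib, h1]
    ring
  rw [h5]
  exact (abs_add_le _ _).trans (add_le_add h2 h3)

namespace LimitShape

variable {ρ f : ℝ → ℝ} {C : ℕ} {L : ℝ}

lemma continuous (h : LimitShape ρ f C L) : Continuous ρ := by
  rw [← continuousOn_univ]
  exact continuousOn_of_abs_sub_le fun x _ y _ => h.abs_sub_le x y

lemma abs_le_one (h : LimitShape ρ f C L) {x : ℝ} (hx : x ∈ Icc (0 : ℝ) 1) : |ρ x| ≤ 1 := by
  have h1 := h.bound x hx
  have h2 : (0 : ℝ) ≤ 1 / C := by positivity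
  exact abs_le.2 ⟨by linarith, by linarith⟩

lemma sub_div_le (h : LimitShape ρ f C L) {x y : ℝ} (hx : x ∈ Icc (0 : ℝ) 1)
    (hy : y ∈ Icc (0 : ℝ) 1) (hxy : x ≤ y) :
    (y - x) / C ≤ (y - ∫ u in (0 : ℝ)..y, ρ u) - (x - ∫ u in (0 : ℝ)..x, ρ u) := by
  have hi : ∀ a b, IntervalIntegrable ρ volume a b := h.continuous.intervalIntegrable
  have h1 : ∫ u in x..y, ρ u ≤ ∫ _ in x..y, (1 - 1 / (C : ℝ)) :=
    intervalIntegral.integral_mono_on hxy (hi _ _) intervalIntegrable_const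
      fun u hu => (h.bound u ⟨hx.1.trans hu.1, hu.2.trans hy.2⟩).2
  rw [intervalIntegral.integral_const, smul_eq_mul,
    ← intervalIntegral.integral_interval_sub_left (hi 0 _) (hi 0 _)] at h1
  rw [div_eq_mul_one_div]
  linarith

lemma abs_sub_le_of_abs (h : LimitShape ρ f C L) {x y : ℝ} (hx : x ∈ Icc (0 : ℝ) 1)
    (hy : y ∈ Icc (0 : ℝ) 1) :
    |x - y| ≤ C * |(x - ∫ u in (0 : ℝ)..x, ρ u) - (y - ∫ u in (0 : ℝ)..y, ρ u)| := by
  have hC : (0 : ℝ) < C := by exact_mod_cast h.one_le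
  wlog hxy : y ≤ x generalizing x y
  · rw [abs_sub_comm, abs_sub_comm (x - _)]
    exact this hy hx (le_of_not_ge hxy)
  have h1 := h.sub_div_le hy hx hxy
  rw [abs_of_nonneg (sub_nonneg.2 hxy)]
  rw [div_le_iff₀' hC] at h1
  exact h1.trans (mul_le_mul_of_nonneg_left (le_abs_self _) hC.le)

lemma abs_apply_sub_le (h : LimitShape ρ f C L) {x y : ℝ} (hx : x ∈ Icc (0 : ℝ) 1)
    (hy : y ∈ Icc (0 : ℝ) 1) : |f x - f y| ≤ C * |x - y| := by
  have hC : (0 : ℝ) < C := by exact_mod_cast h.one_le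
  refine (h.abs_sub_le_of_abs (h.mem x hx) (h.mem y hy)).trans ?_
  rw [h.eq x hx, h.eq y hy, intervalIntegral.integral_interval_sub_left
    (h.continuous.intervalIntegrable _ _) (h.continuous.intervalIntegrable _ _)]
  refine mul_le_mul_of_nonneg_left ?_ hC.le
  have := intervalIntegral.norm_integral_le_of_norm_le_const (a := y) (b := x) (f := ρ) (C := 1)
    fun u hu => h.abs_le_one (by
      rcases le_total x y with hxy | hxy
      · rw [uIoc_of_ge hxy] at hu
        exact ⟨hx.1.trans hu.1.le, hu.2.trans hy.2⟩
      · rw [uIoc_of_le hxy] at hu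
        exact ⟨hy.1.trans hu.1.le, hu.2.trans hx.2⟩)
  simpa using this

/-- A pair of points whose counts agree lies near the curve. -/
lemma abs_sub_apply_le_of_counts (h : LimitShape ρ f C L) {n : ℕ} (hn : 1 ≤ n) {δ : ℝ}
    {S T : Finset (Fin n)} (hS : Concentrated (fun j => ρ (j / n)) δ S)
    (hT : Concentrated (fun j => 1 - ρ (j / n)) δ T) {s t : ℕ} (hs : s ≤ n) (ht : t ≤ n)
    (hst : countBelow S s = countBelow T t) :
    |(t / n : ℝ) - f (s / n)| ≤ C * (2 * δ + 2 * L / n) := by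
  have hn0 : (0 : ℝ) < n := by exact_mod_cast hn
  have h1 := abs_le.1 (hS s hs)
  have h2 := abs_le.1 (hT t ht)
  have h3 := abs_le.1 (h.abs_sum_sub_le hn hs)
  have h4 := abs_le.1 (h.abs_sum_sub_le hn ht)
  rw [hst] at h1
  rw [Finset.sum_sub_distrib, Finset.sum_const, Finset.card_range, nsmul_eq_mul, mul_one] at h2
  refine (h.abs_sub_le_of_abs (natCast_div_mem ht) (h.mem _ (natCast_div_mem hs))).trans ?_
  gcongr
  rw [h.eq _ (natCast_div_mem hs)]
  have h5 : (t / n : ℝ) * n = t := by field_simp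
  have h6 : 2 * L / n * n = 2 * L := by field_simp
  refine le_of_mul_le_mul_right ?_ hn0
  rw [← abs_of_pos hn0, ← abs_mul, abs_of_pos hn0, add_mul, h6, abs_le]
  constructor <;> nlinarith

lemma abs_sub_apply_le_of_notMem (h : LimitShape ρ f C L) {n : ℕ} (hn : 1 ≤ n) {δ : ℝ}
    {σ : Equiv.Perm (Fin n)} (hσ : Avoids321 σ)
    (ht : TypicalPair (fun j => ρ (j / n)) δ (excPair σ)) {i : Fin n} (hi : i ∉ excSet σ) :
    |(σ i / n : ℝ) - f (i / n)| ≤ C * (2 * δ + 2 * L / n) := by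
  refine h.abs_sub_apply_le_of_counts hn (S := (excSet σ)ᶜ) (T := (excVals σ)ᶜ) ?_ ?_
    i.2.le (σ i).2.le ?_
  · have := ht.1.abs_compl_sub_le
    simp only [sub_sub_cancel] at this
    exact this
  · exact ht.2.abs_compl_sub_le
  · have h1 := countBelow_map_of_strictMonoOn (s := (excSet σ)ᶜ)
      (by rw [Finset.coe_compl]; exact hσ.strictMonoOn_excSet_compl) (Finset.mem_compl.2 hi)
    have h2 : ((excSet σ)ᶜ).map σ.toEmbedding = (excVals σ)ᶜ := by
      ext x
      simp [excVals]
    rw [← h1, h2]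

lemma abs_sub_apply_le_of_mem (h : LimitShape ρ f C L) {n : ℕ} (hn : 1 ≤ n) {δ : ℝ}
    {σ : Equiv.Perm (Fin n)} (hσ : Avoids321 σ)
    (ht : TypicalPair (fun j => ρ (j / n)) δ (excPair σ)) {i : Fin n} (hi : i ∈ excSet σ) :
    |(i / n : ℝ) - f (σ i / n)| ≤ C * (2 * δ + 2 * L / n) :=
  h.abs_sub_apply_le_of_counts hn (S := excVals σ) (T := excSet σ) ht.2 ht.1
    (σ i).2.le i.2.le (countBelow_map_of_strictMonoOn hσ.strictMonoOn_excSet hi)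

/-- Empirical averages along a typical permutation approximate the limiting integral. -/
lemma abs_sum_sub_integral_le (h : LimitShape ρ f C L) {n : ℕ} (hn : 1 ≤ n) {δ : ℝ}
    (hδ : 0 ≤ δ) {σ : Equiv.Perm (Fin n)} (hσ : Avoids321 σ)
    (ht : TypicalPair (fun j => ρ (j / n)) δ (excPair σ)) {g : ℝ × ℝ → ℝ} {c l : ℝ}
    (hl : 0 ≤ l) (hg : ∀ z, |g z| ≤ c) (hgl : ∀ z w, |g z - g w| ≤ l * dist z w) :
    |∑ i : Fin n, g (i / n, σ i / n) - n * ((∫ x in (0 : ℝ)..1, ρ x * g (x, f x)) +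
        ∫ x in (0 : ℝ)..1, ρ x * g (f x, x))| ≤
      n * (l * (C * (2 * δ + 2 * L / n))) + 2 * (δ * n * (c + l * C) + (l * C + c * L)) := by
  have hC : (1 : ℝ) ≤ C := by exact_mod_cast h.one_le
  set G₁ : ℝ → ℝ := fun x => g (x, f x) with hG₁
  set G₂ : ℝ → ℝ := fun x => g (f x, x) with hG₂
  have hdist : ∀ x ∈ Icc (0 : ℝ) 1, ∀ y ∈ Icc (0 : ℝ) 1,
      |x - y| ≤ C * |x - y| ∧ |f x - f y| ≤ C * |x - y| := fun x hx y hy =>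
    ⟨le_mul_of_one_le_left (abs_nonneg _) hC, h.abs_apply_sub_le hx hy⟩
  have hl₁ : ∀ x ∈ Icc (0 : ℝ) 1, ∀ y ∈ Icc (0 : ℝ) 1, |G₁ x - G₁ y| ≤ l * C * |x - y| := by
    intro x hx y hy
    refine (hgl _ _).trans ?_
    rw [mul_assoc]
    gcongr
    rw [Prod.dist_eq]
    exact max_le (hdist x hx y hy).1 (hdist x hx y hy).2
  have hl₂ : ∀ x ∈ Icc (0 : ℝ) 1, ∀ y ∈ Icc (0 : ℝ) 1, |G₂ x - G₂ y| ≤ l * C * |x - y| := by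
    intro x hx y hy
    refine (hgl _ _).trans ?_
    rw [mul_assoc]
    gcongr
    rw [Prod.dist_eq]
    exact max_le (hdist x hx y hy).2 (hdist x hx y hy).1
  have hS : Concentrated (fun j => ρ (j / n)) δ (excSet σ)ᶜ := by
    have := ht.1.abs_compl_sub_le
    simp only [sub_sub_cancel] at this
    exact this
  have h1 := hS.abs_sum_sub_integral_le (G := G₁) hn hδ h.nonneg (by positivity) h.abs_sub_le
    (fun x hx => h.abs_le_one hx) (fun x _ => hg _) hl₁
  have hT : Concentrated (fun j => ρ (j / n)) δ (excVals σ) := ht.2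
  have h2 := hT.abs_sum_sub_integral_le (G := G₂) hn hδ h.nonneg (by positivity) h.abs_sub_le
    (fun x hx => h.abs_le_one hx) (fun x _ => hg _) hl₂
  have h3 : ∑ j ∈ excVals σ, G₂ (j / n) = ∑ i ∈ excSet σ, G₂ (σ i / n) := by
    rw [excVals, Finset.sum_map]
    rfl
  rw [h3] at h2
  have h4 : |∑ i ∈ (excSet σ)ᶜ, (g (i / n, σ i / n) - G₁ (i / n))| +
      |∑ i ∈ excSet σ, (g (i / n, σ i / n) - G₂ (σ i / n))| ≤
      n * (l * (C * (2 * δ + 2 * L / n))) := by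
    have h5 : |∑ i ∈ (excSet σ)ᶜ, (g (i / n, σ i / n) - G₁ (i / n))| ≤
        ((excSet σ)ᶜ.card : ℝ) * (l * (C * (2 * δ + 2 * L / n))) := by
      refine (Finset.abs_sum_le_sum_abs _ _).trans ?_
      rw [← nsmul_eq_mul]
      refine Finset.sum_le_card_nsmul _ _ _ fun i hi => (hgl _ _).trans ?_
      gcongr
      rw [Prod.dist_eq, dist_self, Real.dist_eq]
      exact max_le (by have := h.nonneg; positivity)
        (h.abs_sub_apply_le_of_notMem hn hσ ht (Finset.mem_compl.1 hi))
    have h6 : |∑ i ∈ excSet σ, (g (i / n, σ i / n) - G₂ (σ i / n))| ≤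
        ((excSet σ).card : ℝ) * (l * (C * (2 * δ + 2 * L / n))) := by
      refine (Finset.abs_sum_le_sum_abs _ _).trans ?_
      rw [← nsmul_eq_mul]
      refine Finset.sum_le_card_nsmul _ _ _ fun i hi => (hgl _ _).trans ?_
      gcongr
      rw [Prod.dist_eq, dist_self, Real.dist_eq]
      exact max_le (h.abs_sub_apply_le_of_mem hn hσ ht hi) (by have := h.nonneg; positivity)
    have h7 : ((excSet σ).card : ℝ) + (excSet σ)ᶜ.card = n := by
      exact_mod_cast (Finset.card_add_card_compl (excSet σ)).trans (Fintype.card_fin n)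
    refine (add_le_add h5 h6).trans (le_of_eq ?_)
    rw [← add_mul, add_comm _ ((excSet σ).card : ℝ), h7]
  rw [Finset.sum_sub_distrib, Finset.sum_sub_distrib] at h4
  rw [← Finset.sum_add_sum_compl (excSet σ)]
  set a := ∑ i ∈ excSet σ, g (i / n, σ i / n)
  set b := ∑ i ∈ (excSet σ)ᶜ, g (i / n, σ i / n)
  set a' := ∑ i ∈ excSet σ, G₂ (σ i / n)
  set b' := ∑ i ∈ (excSet σ)ᶜ, G₁ (i / n)
  set I := ∫ x in (0 : ℝ)..1, ρ x * G₁ x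
  set J := ∫ x in (0 : ℝ)..1, ρ x * G₂ x
  have h8 : a + b - n * (I + J) = ((b - b') + (a - a')) + ((b' - n * I) + (a' - n * J)) := by ring
  rw [h8]
  refine (abs_add_le _ _).trans (add_le_add ((abs_add_le _ _).trans h4) ?_)
  refine (abs_add_le _ _).trans ?_
  linarith

end LimitShape

/-! ### The permuton of a permutation -/

/-- The cell of the diagram of `σ` over the column `i`. -/
def permCell {n : ℕ} (σ : Equiv.Perm (Fin n)) (i : Fin n) : Set (ℝ × ℝ) :=
  Set.Icc (((i : ℕ) : ℝ) / n) ((((i : ℕ) : ℝ) + 1) / n) ×ˢ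
    Set.Icc ((((σ i : Fin n) : ℕ) : ℝ) / n) (((((σ i : Fin n) : ℕ) : ℝ) + 1) / n)

lemma permutonOfPerm_eq {n : ℕ} (σ : Equiv.Perm (Fin n)) :
    permutonOfPerm σ = (n : ENNReal) • volume.restrict (⋃ i, permCell σ i) := rfl

lemma measurableSet_permCell {n : ℕ} (σ : Equiv.Perm (Fin n)) (i : Fin n) :
    MeasurableSet (permCell σ i) := measurableSet_Icc.prod measurableSet_Icc

lemma volume_permCell {n : ℕ} (σ : Equiv.Perm (Fin n)) (i : Fin n) :
    volume (permCell σ i) = ENNReal.ofReal (1 / n) * ENNReal.ofReal (1 / n) := by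
  rw [permCell, Measure.volume_eq_prod, Measure.prod_prod, Real.volume_Icc, Real.volume_Icc]
  congr 2 <;> ring

lemma aedisjoint_permCell {n : ℕ} (σ : Equiv.Perm (Fin n)) :
    Pairwise (Function.onFun (AEDisjoint volume) (permCell σ)) := by
  have key : ∀ i j : Fin n, i < j → AEDisjoint volume (permCell σ i) (permCell σ j) := by
    intro i j hij
    have hsub : permCell σ i ∩ permCell σ j ⊆ {((j : ℕ) : ℝ) / n} ×ˢ univ := by
      rintro ⟨x, y⟩ ⟨⟨h1, -⟩, ⟨h2, -⟩⟩
      refine ⟨le_antisymm (h1.2.trans ?_) h2.1, mem_univ _⟩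
      gcongr
      exact_mod_cast Nat.succ_le_of_lt hij
    refine measure_mono_null hsub ?_
    rw [Measure.volume_eq_prod, Measure.prod_prod]
    simp
  intro i j hij
  rcases lt_or_gt_of_ne hij with h | h
  · exact key i j h
  · exact (key j i h).symm

lemma restrict_iUnion_permCell {n : ℕ} (σ : Equiv.Perm (Fin n)) :
    volume.restrict (⋃ i, permCell σ i) = Measure.sum fun i => volume.restrict (permCell σ i) :=
  Measure.restrict_iUnion_ae (aedisjoint_permCell σ)
    fun i => (measurableSet_permCell σ i).nullMeasurableSet

lemma permutonOfPerm_univ {n : ℕ} (hn : 1 ≤ n) (σ : Equiv.Perm (Fin n)) :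
    permutonOfPerm σ univ = 1 := by
  have hn0 : (0 : ℝ) < n := by exact_mod_cast hn
  rw [permutonOfPerm_eq, Measure.smul_apply, restrict_iUnion_permCell, Measure.sum_apply _ .univ,
    tsum_fintype]
  simp only [Measure.restrict_apply_univ, volume_permCell]
  rw [Finset.sum_const, Finset.card_univ, Fintype.card_fin, nsmul_eq_mul, smul_eq_mul,
    ← ENNReal.ofReal_natCast, ← ENNReal.ofReal_mul (by positivity),
    ← ENNReal.ofReal_mul (by positivity), ← ENNReal.ofReal_mul (by positivity),
    ← ENNReal.ofReal_one]
  congr 1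
  field_simp

lemma isProbabilityMeasure_permutonOfPerm {n : ℕ} (hn : 1 ≤ n) (σ : Equiv.Perm (Fin n)) :
    IsProbabilityMeasure (permutonOfPerm σ) := ⟨permutonOfPerm_univ hn σ⟩

lemma permCell_subset {n : ℕ} (σ : Equiv.Perm (Fin n)) (i : Fin n) :
    permCell σ i ⊆ Icc (0 : ℝ) 1 ×ˢ Icc (0 : ℝ) 1 := by
  have hle : ∀ j : Fin n, (((j : ℕ) : ℝ) + 1) / n ≤ 1 := fun j =>
    div_le_one_of_le₀ (by exact_mod_cast j.2) (by positivity)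
  exact prod_mono (Icc_subset_Icc (by positivity) (hle _)) (Icc_subset_Icc (by positivity) (hle _))

lemma permutonOfPerm_unitSquare {n : ℕ} (hn : 1 ≤ n) (σ : Equiv.Perm (Fin n)) :
    permutonOfPerm σ (Icc (0 : ℝ) 1 ×ˢ Icc (0 : ℝ) 1) = 1 := by
  rw [← permutonOfPerm_univ hn σ, permutonOfPerm_eq, Measure.smul_apply, Measure.smul_apply,
    Measure.restrict_apply (measurableSet_Icc.prod measurableSet_Icc),
    inter_eq_self_of_subset_right (iUnion_subset (permCell_subset σ)),
    Measure.restrict_apply_univ]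

lemma abs_setIntegral_permCell_sub_le {n : ℕ} (σ : Equiv.Perm (Fin n)) (i : Fin n)
    {g : ℝ × ℝ → ℝ} {l : ℝ} (hl : 0 ≤ l) (hgl : ∀ z w, |g z - g w| ≤ l * dist z w)
    (hg : Continuous g) :
    |n * (∫ z in permCell σ i, g z) - g (i / n, σ i / n) / n| ≤ l / n / n := by
  have hn0 : (0 : ℝ) < n := by exact_mod_cast (Nat.zero_le _).trans_lt i.2
  have hvol : (volume : Measure (ℝ × ℝ)).real (permCell σ i) = 1 / n * (1 / n) := by
    rw [measureReal_def, volume_permCell, ENNReal.toReal_mul, ENNReal.toReal_ofReal (by positivity)]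
  have hfin : volume (permCell σ i) < ⊤ := by
    rw [volume_permCell]
    exact ENNReal.mul_lt_top ENNReal.ofReal_lt_top ENNReal.ofReal_lt_top
  have h_integrable : IntegrableOn g (permCell σ i) :=
    hg.continuousOn.integrableOn_compact (isCompact_Icc.prod isCompact_Icc)
  have h1 : n * (∫ z in permCell σ i, g z) - g (i / n, σ i / n) / n =
      n * ∫ z in permCell σ i, (g z - g (i / n, σ i / n)) := by
    rw [integral_sub h_integrable (integrableOn_const hfin.ne), setIntegral_const, hvol, smul_eq_mul]
    field_simp
  have h2 : ‖∫ z in permCell σ i, (g z - g (i / n, σ i / n))‖ ≤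
      l / n * (volume : Measure (ℝ × ℝ)).real (permCell σ i) := by
    refine norm_setIntegral_le_of_norm_le_const hfin fun z hz => (hgl _ _).trans ?_
    rw [div_eq_mul_one_div l]
    refine mul_le_mul_of_nonneg_left ?_ hl
    have hlen : ∀ (a : ℝ), ∀ x ∈ Icc (a / n) ((a + 1) / n), dist x (a / n) ≤ 1 / n := by
      intro a x hx
      rw [Real.dist_eq, abs_of_nonneg (by linarith [hx.1])]
      have := hx.2
      rw [add_div] at this
      linarith
    rw [Prod.dist_eq]
    exact max_le (hlen _ _ hz.1) (hlen _ _ hz.2)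
  rw [h1, abs_mul, abs_of_pos hn0]
  rw [hvol, Real.norm_eq_abs] at h2
  calc _ ≤ (n : ℝ) * (l / n * (1 / n * (1 / n))) := by gcongr
    _ = l / n / n := by field_simp

lemma abs_integral_permutonOfPerm_sub_le {n : ℕ} (hn : 1 ≤ n) (σ : Equiv.Perm (Fin n))
    {g : ℝ × ℝ → ℝ} {l : ℝ} (hl : 0 ≤ l) (hgl : ∀ z w, |g z - g w| ≤ l * dist z w)
    (hg : Continuous g) :
    |∫ z, g z ∂(permutonOfPerm σ) - (∑ i : Fin n, g (i / n, σ i / n)) / n| ≤ l / n := by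
  have hn0 : (0 : ℝ) < n := by exact_mod_cast hn
  have h_integrable : ∀ i, Integrable g (volume.restrict (permCell σ i)) := fun i =>
    hg.continuousOn.integrableOn_compact (isCompact_Icc.prod isCompact_Icc)
  have h1 : ∫ z, g z ∂(permutonOfPerm σ) = ∑ i : Fin n, n * ∫ z in permCell σ i, g z := by
    rw [permutonOfPerm_eq, integral_smul_measure, restrict_iUnion_permCell,
      Measure.sum_fintype, integral_finsetSum_measure fun i _ => h_integrable i, Finset.smul_sum]
    simp
  rw [h1, Finset.sum_div, ← Finset.sum_sub_distrib]
  calc _ ≤ ∑ _i : Fin n, l / n / n := (Finset.abs_sum_le_sum_abs _ _).trans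
        (Finset.sum_le_sum fun i _ => abs_setIntegral_permCell_sub_le σ i hl hgl hg)
    _ = l / n := by
        rw [Finset.sum_const, Finset.card_univ, Fintype.card_fin, nsmul_eq_mul]
        field_simp

/-! ### Weak convergence along typical permutations -/

/-- `μ` is the permuton with density `ρ` along the graph of `f` and its transpose. -/
structure IsShapePermuton (ρ f : ℝ → ℝ) (μ : Measure (ℝ × ℝ)) : Prop where
  isProbabilityMeasure : IsProbabilityMeasure μ
  unitSquare : μ (Icc (0 : ℝ) 1 ×ˢ Icc (0 : ℝ) 1) = 1
  integral_eq : ∀ g : BoundedContinuousFunction (ℝ × ℝ) ℝ, ∫ z, g z ∂μ =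
    (∫ x in (0 : ℝ)..1, ρ x * g (x, f x)) + ∫ x in (0 : ℝ)..1, ρ x * g (f x, x)

namespace LimitShape

variable {ρ f : ℝ → ℝ} {C : ℕ} {L : ℝ} {μ : Measure (ℝ × ℝ)}

lemma tendsto_integral_of_typical (h : LimitShape ρ f C L) (hμ : IsShapePermuton ρ f μ)
    {m : ℕ → ℕ} (hm : ∀ k, 1 ≤ m k) (hm' : Tendsto m atTop atTop) {δ : ℕ → ℝ}
    (hδ0 : ∀ k, 0 ≤ δ k) (hδ : Tendsto δ atTop (nhds 0)) {σ : (k : ℕ) → Equiv.Perm (Fin (m k))}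
    (hσ : ∀ k, Avoids321 (σ k))
    (ht : ∀ k, TypicalPair (fun j => ρ (j / m k)) (δ k) (excPair (σ k)))
    (g : BoundedContinuousFunction (ℝ × ℝ) ℝ) :
    Tendsto (fun k => ∫ z, g z ∂(permutonOfPerm (σ k))) atTop (nhds (∫ z, g z ∂μ)) := by
  have hprob := hμ.isProbabilityMeasure
  let P : ℕ → ProbabilityMeasure (ℝ × ℝ) := fun k =>
    ⟨permutonOfPerm (σ k), isProbabilityMeasure_permutonOfPerm (hm k) (σ k)⟩
  let Q : ProbabilityMeasure (ℝ × ℝ) := ⟨μ, hprob⟩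
  suffices hw : Tendsto P atTop (nhds Q) by
    simpa using! ProbabilityMeasure.tendsto_iff_forall_integral_tendsto.1 hw g
  rw [tendsto_iff_forall_lipschitz_integral_tendsto]
  rintro g ⟨c₀, hc₀⟩ ⟨l, hl⟩
  set c := c₀ + |g 0| with hc
  have hg : ∀ z, |g z| ≤ c := fun z => by
    have h1 := hc₀ z 0
    rw [Real.dist_eq] at h1
    have h2 := abs_sub_abs_le_abs_sub (g z) (g 0)
    linarith
  have hgl : ∀ z w, |g z - g w| ≤ l * dist z w := fun z w => by
    rw [← Real.dist_eq]; exact hl.dist_le_mul z w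
  let G : BoundedContinuousFunction (ℝ × ℝ) ℝ := ⟨⟨g, hl.continuous⟩, c₀, hc₀⟩
  have hG := hμ.integral_eq G
  change ∫ z, g z ∂μ = (∫ x in (0 : ℝ)..1, ρ x * g (x, f x)) +
    ∫ x in (0 : ℝ)..1, ρ x * g (f x, x) at hG
  have hinv : Tendsto (fun k => 1 / (m k : ℝ)) atTop (nhds 0) :=
    tendsto_one_div_atTop_nhds_zero_nat.comp hm'
  have hbound : Tendsto (fun k => l * (1 / (m k : ℝ)) +
      (l * (C * (2 * δ k + 2 * L * (1 / m k))) +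
        2 * (δ k * (c + l * C) + (l * C + c * L) * (1 / m k)))) atTop (nhds 0) := by
    have := (hinv.const_mul (l : ℝ)).add
      (((((hδ.const_mul 2).add (hinv.const_mul (2 * L))).const_mul (C : ℝ)).const_mul (l : ℝ)).add
        (((hδ.mul_const (c + l * C)).add (hinv.const_mul (l * C + c * L))).const_mul 2))
    simpa using this
  rw [tendsto_iff_dist_tendsto_zero]
  refine squeeze_zero (fun _ => dist_nonneg) (fun k => ?_) hbound
  have hn0 : (0 : ℝ) < m k := by exact_mod_cast hm k
  have h1 := abs_integral_permutonOfPerm_sub_le (hm k) (σ k) l.coe_nonneg hgl hl.continuous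
  have h2 := h.abs_sum_sub_integral_le (hm k) (hδ0 k) (hσ k) (ht k) l.coe_nonneg hg hgl
  rw [Real.dist_eq]
  change |∫ z, g z ∂(permutonOfPerm (σ k)) - ∫ z, g z ∂μ| ≤ _
  rw [hG]
  set I := (∫ x in (0 : ℝ)..1, ρ x * g (x, f x)) + ∫ x in (0 : ℝ)..1, ρ x * g (f x, x)
  set S := ∑ i : Fin (m k), g (i / m k, σ k i / m k)
  have h3 : |S / m k - I| ≤ l * (C * (2 * δ k + 2 * L * (1 / m k))) +
      2 * (δ k * (c + l * C) + (l * C + c * L) * (1 / m k)) := by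
    have e : S / m k - I = (S - m k * I) / m k := by field_simp
    rw [e, abs_div, abs_of_pos hn0, div_le_iff₀ hn0]
    refine h2.trans (le_of_eq ?_)
    field_simp
  calc _ = |(∫ z, g z ∂(permutonOfPerm (σ k)) - S / m k) + (S / m k - I)| := by congr 1; ring
    _ ≤ _ := (abs_add_le _ _).trans (add_le_add (by rw [mul_one_div]; exact h1) h3)

/-- Large typical permutations have permutons close to the limit shape. -/
lemma exists_forall_typical_le (h : LimitShape ρ f C L) (hμ : IsShapePermuton ρ f μ)
    {d : Measure (ℝ × ℝ) → Measure (ℝ × ℝ) → ℝ} (hd : MetrizesWeakConvUnitSq d) {ε : ℝ}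
    (hε : 0 < ε) :
    ∃ δ > 0, δ ≤ 2 ∧ ∃ N, ∀ n ≥ N, ∀ σ : Equiv.Perm (Fin n), Avoids321 σ →
      TypicalPair (fun j => ρ (j / n)) δ (excPair σ) → d (permutonOfPerm σ) μ ≤ ε := by
  by_contra! hcon
  have hpos : ∀ k : ℕ, (0 : ℝ) < 1 / ((k : ℝ) + 1) := fun k => Nat.one_div_pos_of_nat
  have hle : ∀ k : ℕ, 1 / ((k : ℝ) + 1) ≤ 2 := fun k => by
    rw [div_le_iff₀ (by positivity)]
    have : (0 : ℝ) ≤ k := k.cast_nonneg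
    linarith
  choose m hm σ hσ ht hlt using fun k : ℕ => hcon (1 / ((k : ℝ) + 1)) (hpos k) (hle k) (k + 1)
  have hm1 : ∀ k, 1 ≤ m k := fun k => (Nat.le_add_left 1 k).trans (hm k)
  have hm' : Tendsto m atTop atTop :=
    tendsto_atTop_mono (fun k => (Nat.le_succ k).trans (hm k)) tendsto_id
  have hlim := (hd (fun k => permutonOfPerm (σ k)) μ
    (fun k => isProbabilityMeasure_permutonOfPerm (hm1 k) _) hμ.isProbabilityMeasure
    (fun k => permutonOfPerm_unitSquare (hm1 k) _) hμ.unitSquare).2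
    (h.tendsto_integral_of_typical hμ hm1 hm' (fun k => (hpos k).le)
      tendsto_one_div_add_atTop_nhds_zero_nat hσ ht)
  obtain ⟨k, hk⟩ := (hlim.eventually_lt_const hε).exists
  exact lt_asymm hk (hlt k)

/-- The permutons of `321`-avoiding Mallows permutations converge in probability to the permuton
of the limit shape. -/
lemma tendsto_volume_lt (h : LimitShape ρ f C L) (hμ : IsShapePermuton ρ f μ) {β b : ℝ}
    (hβ : β ≤ b) (hcase : b = β ∨ ∀ x, ρ x = 1 / 2)
    (hw : ∀ n : ℕ, ∀ j < n, 1 - ρ (j / n) = ρ (j / n) * Real.exp (b / n * (n / 2 - j)))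
    {Ω : Type} [MeasureSpace Ω]
    (τ : (n : ℕ) → Ω → Equiv.Perm (Fin n))
    (hlaw : ∀ (n : ℕ), 1 ≤ n → ∀ σ : Equiv.Perm (Fin n),
      volume {ω | τ n ω = σ} =
        ENNReal.ofReal
          (if Avoids321 σ then Real.exp (β / n * invCount σ) / Z321 β n else 0))
    {d : Measure (ℝ × ℝ) → Measure (ℝ × ℝ) → ℝ} (hd : MetrizesWeakConvUnitSq d) {ε : ℝ}
    (hε : 0 < ε) :
    Tendsto (fun n => volume {ω | ε < d (permutonOfPerm (τ n ω)) μ}) atTop (nhds 0) := by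
  obtain ⟨δ, hδ, hδ2, N, hN⟩ := h.exists_forall_typical_le hμ hd hε
  have hlim := ENNReal.tendsto_ofReal (h.tendsto_sum_not_typical_div hβ hcase hw hδ hδ2)
  rw [ENNReal.ofReal_zero] at hlim
  refine tendsto_of_tendsto_of_tendsto_of_le_of_le' tendsto_const_nhds hlim
    (Eventually.of_forall fun _ => zero_le) ?_
  filter_upwards [eventually_ge_atTop N, eventually_ge_atTop 1] with n hn hn1
  set S : Finset (Equiv.Perm (Fin n)) := Finset.univ.filter
    fun σ => Avoids321 σ ∧ ¬ TypicalPair (fun j => ρ (j / n)) δ (excPair σ) with hS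
  set S' : Finset (Equiv.Perm (Fin n)) := Finset.univ.filter fun σ => ¬ Avoids321 σ with hS'
  have hsub : {ω | ε < d (permutonOfPerm (τ n ω)) μ} ⊆
      (⋃ σ ∈ S, {ω | τ n ω = σ}) ∪ ⋃ σ ∈ S', {ω | τ n ω = σ} := by
    intro ω hω
    by_cases hav : Avoids321 (τ n ω)
    · refine Or.inl (mem_iUnion₂.2 ⟨τ n ω, Finset.mem_filter.2 ⟨Finset.mem_univ _, hav, ?_⟩, rfl⟩)
      exact fun ht => not_lt.2 (hN n hn _ hav ht) hω
    · exact Or.inr (mem_iUnion₂.2 ⟨τ n ω, Finset.mem_filter.2 ⟨Finset.mem_univ _, hav⟩, rfl⟩)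
  have hZ : 0 ≤ Z321 β n := Finset.sum_nonneg fun _ _ => (Real.exp_pos _).le
  have h1 : ∑ σ ∈ S, volume {ω | τ n ω = σ} =
      ENNReal.ofReal ((∑ σ ∈ S, Real.exp (β / n * invCount σ)) / Z321 β n) := by
    rw [Finset.sum_div, ENNReal.ofReal_sum_of_nonneg fun σ _ => div_nonneg (Real.exp_pos _).le hZ]
    refine Finset.sum_congr rfl fun σ hσ => ?_
    rw [hlaw n hn1, if_pos (Finset.mem_filter.1 hσ).2.1]
  have h2 : ∑ σ ∈ S', volume {ω | τ n ω = σ} = 0 := by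
    refine Finset.sum_eq_zero fun σ hσ => ?_
    rw [hlaw n hn1, if_neg (Finset.mem_filter.1 hσ).2, ENNReal.ofReal_zero]
  calc _ ≤ _ := measure_mono hsub
    _ ≤ _ := measure_union_le _ _
    _ ≤ ∑ σ ∈ S, volume {ω | τ n ω = σ} + ∑ σ ∈ S', volume {ω | τ n ω = σ} :=
        add_le_add (measure_biUnion_finset_le _ _) (measure_biUnion_finset_le _ _)
    _ = _ := by rw [h1, h2, add_zero]

end LimitShape

/-! ### The explicit limit shape -/

lemma IsPermuton.unitSquare {μ : Measure (ℝ × ℝ)} (h : IsPermuton μ) :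
    μ (Icc (0 : ℝ) 1 ×ˢ Icc (0 : ℝ) 1) = 1 := by
  obtain ⟨hp, h1, h2⟩ := h
  have hz : volume.restrict (Icc (0 : ℝ) 1) (Icc (0 : ℝ) 1)ᶜ = 0 := by
    rw [Measure.restrict_apply measurableSet_Icc.compl, compl_inter_self, measure_empty]
  have e1 : μ (Prod.fst ⁻¹' (Icc (0 : ℝ) 1)ᶜ) = 0 := by
    rw [← Measure.map_apply measurable_fst measurableSet_Icc.compl, h1, hz]
  have e2 : μ (Prod.snd ⁻¹' (Icc (0 : ℝ) 1)ᶜ) = 0 := by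
    rw [← Measure.map_apply measurable_snd measurableSet_Icc.compl, h2, hz]
  rw [← prob_compl_eq_zero_iff (measurableSet_Icc.prod measurableSet_Icc)]
  refine measure_mono_null (t := _ ∪ _) ?_ (measure_union_null e1 e2)
  intro z hz
  by_contra hcon
  simp only [mem_union, mem_preimage, mem_compl_iff, not_or, not_not] at hcon
  exact hz ⟨hcon.1, hcon.2⟩

lemma limitShape_diag : LimitShape (fun _ => 1 / 2) (fun x => x) 2 0 where
  one_le := by norm_num
  nonneg := le_rfl
  abs_sub_le x y := by simp
  bound x _ := by norm_num
  integral_le x _ := by simp [div_eq_mul_inv]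
  integral_one := by simp
  mem x hx := hx
  eq x _ := by
    simp only [intervalIntegral.integral_const, sub_zero, smul_eq_mul]
    ring

lemma isShapePermuton_diag : IsShapePermuton (fun _ => 1 / 2) (fun x => x) diagPermuton := by
  have hm : Measurable fun x : ℝ => (x, x) := measurable_id.prodMk measurable_id
  have hvol : volume.restrict (Icc (0 : ℝ) 1) univ = 1 := by simp
  have hp : IsPermuton diagPermuton := by
    refine ⟨⟨by rw [diagPermuton, Measure.map_apply hm .univ, preimage_univ, hvol]⟩, ?_, ?_⟩
    · rw [diagPermuton, Measure.map_map measurable_fst hm]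
      exact Measure.map_id
    · rw [diagPermuton, Measure.map_map measurable_snd hm]
      exact Measure.map_id
  refine ⟨hp.1, hp.unitSquare, fun g => ?_⟩
  rw [diagPermuton, integral_map hm.aemeasurable g.continuous.aestronglyMeasurable,
    integral_Icc_eq_integral_Ioc, ← intervalIntegral.integral_of_le zero_le_one,
    intervalIntegral.integral_const_mul]
  ring

section rho

variable {β : ℝ}

lemma rho321_eq (β x : ℝ) :
    rho321 β x = Real.exp (β * x) / (Real.exp (β * x) + Real.exp (β / 2)) := by
  have h : Real.exp (β * (1 / 2 - x)) = Real.exp (β / 2) / Real.exp (β * x) := by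
    rw [← Real.exp_sub]; congr 1; ring
  rw [rho321, h]
  have := Real.exp_pos (β * x)
  have := Real.exp_pos (β / 2)
  field_simp

lemma hasDerivAt_exp_mul (β x : ℝ) :
    HasDerivAt (fun y => Real.exp (β * y)) (β * Real.exp (β * x)) x := by
  simpa [mul_comm] using ((hasDerivAt_id x).const_mul β).exp

lemma continuous_rho321 (β : ℝ) : Continuous (rho321 β) := by
  unfold rho321
  exact continuous_const.div (by fun_prop) fun x => by positivity

lemma measurable_f321 (β : ℝ) : Measurable (f321 β) := by
  unfold f321
  fun_prop

lemma integral_rho321 (hβ : 0 < β) (x : ℝ) : ∫ u in (0 : ℝ)..x, rho321 β u =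
    (1 / β) * (Real.log (Real.exp (β * x) + Real.exp (β / 2)) -
      Real.log (1 + Real.exp (β / 2))) := by
  have hd : ∀ y : ℝ, HasDerivAt
      (fun y => (1 / β) * Real.log (Real.exp (β * y) + Real.exp (β / 2))) (rho321 β y) y := by
    intro y
    have h1 := (((hasDerivAt_exp_mul β y).add_const (Real.exp (β / 2))).log
      (by positivity)).const_mul (1 / β)
    refine h1.congr_deriv ?_
    rw [rho321_eq]
    field_simp
  rw [intervalIntegral.integral_eq_sub_of_hasDerivAt (fun y _ => hd y)
    ((continuous_rho321 β).intervalIntegrable _ _), mul_zero, Real.exp_zero]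
  ring

lemma abs_rho321_sub_le (hβ : 0 < β) (x y : ℝ) : |rho321 β x - rho321 β y| ≤ β * |x - y| := by
  have hd : ∀ z ∈ (univ : Set ℝ), HasDerivWithinAt (rho321 β)
      (β * Real.exp (β * z) * Real.exp (β / 2) /
        (Real.exp (β * z) + Real.exp (β / 2)) ^ 2) univ z := by
    intro z _
    have h1 := (hasDerivAt_exp_mul β z).div
      ((hasDerivAt_exp_mul β z).add_const (Real.exp (β / 2))) (by positivity)
    rw [funext (rho321_eq β)]
    refine HasDerivAt.hasDerivWithinAt ?_
    exact h1.congr_deriv (by ring)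
  have h2 := convex_univ.norm_image_sub_le_of_norm_hasDerivWithin_le (C := β) hd
    (fun z _ => by
      have h3 := Real.exp_pos (β * z)
      have h4 := Real.exp_pos (β / 2)
      rw [Real.norm_eq_abs, abs_of_nonneg (by positivity), div_le_iff₀ (by positivity), mul_assoc]
      refine mul_le_mul_of_nonneg_left ?_ hβ.le
      nlinarith) (mem_univ y) (mem_univ x)
  simpa [Real.norm_eq_abs] using h2

lemma exp_sq_half (β : ℝ) : Real.exp β = Real.exp (β / 2) ^ 2 := by
  rw [← Real.exp_nat_mul]; congr 1; push_cast; ring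

lemma one_le_exp_mul (hβ : 0 < β) {x : ℝ} (hx : x ∈ Icc (0 : ℝ) 1) :
    1 ≤ Real.exp (β * x) ∧ Real.exp (β * x) ≤ Real.exp (β / 2) ^ 2 := by
  rw [← exp_sq_half]
  exact ⟨Real.one_le_exp (mul_nonneg hβ.le hx.1), Real.exp_le_exp.2 (by nlinarith [hx.2])⟩

lemma exp_mul_f321 (hβ : 0 < β) {x : ℝ} (hx : x ∈ Icc (0 : ℝ) 1) :
    Real.exp (β * f321 β x) = Real.exp (β / 2) * ((Real.exp (β * x) + Real.exp (β / 2)) /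
      (1 + Real.exp (β / 2) + Real.exp (β / 2) ^ 2 - Real.exp (β * x))) := by
  have h1 := (one_le_exp_mul hβ hx).2
  have h2 := Real.exp_pos (β / 2)
  have h3 : 0 < (Real.exp (β * x) + Real.exp (β / 2)) /
      (1 + Real.exp (β / 2) + Real.exp (β / 2) ^ 2 - Real.exp (β * x)) :=
    div_pos (by positivity) (by linarith)
  rw [f321, exp_sq_half β]
  generalize hq : (Real.exp (β * x) + Real.exp (β / 2)) /
      (1 + Real.exp (β / 2) + Real.exp (β / 2) ^ 2 - Real.exp (β * x)) = q at h3 ⊢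
  rw [show β * (1 / 2 + 1 / β * Real.log q) = β / 2 + Real.log q by field_simp,
    Real.exp_add, Real.exp_log h3]

lemma hasDerivAt_f321 (hβ : 0 < β) {x : ℝ} (hx : x ∈ Icc (0 : ℝ) 1) :
    HasDerivAt (f321 β) (rho321 β x / (1 - rho321 β (f321 β x))) x ∧
      0 < rho321 β x ∧ 0 < 1 - rho321 β (f321 β x) := by
  obtain ⟨h0, h1⟩ := one_le_exp_mul hβ hx
  have h2 := Real.exp_pos (β / 2)
  have hρ : rho321 β (f321 β x) = 1 - (1 + Real.exp (β / 2) + Real.exp (β / 2) ^ 2 -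
      Real.exp (β * x)) / (1 + Real.exp (β / 2)) ^ 2 := by
    rw [rho321_eq, exp_mul_f321 hβ hx]
    generalize Real.exp (β * x) = X at *
    generalize Real.exp (β / 2) = a at *
    have h3 : 0 < 1 + a + a ^ 2 - X := by linarith
    have h4 : 0 < X + a := by linarith
    have h5 : a * ((X + a) / (1 + a + a ^ 2 - X)) + a = a * (1 + a) ^ 2 / (1 + a + a ^ 2 - X) := by
      field_simp
      ring
    rw [h5]
    field_simp
    ring
  have h3 : 0 < 1 + Real.exp (β / 2) + Real.exp (β / 2) ^ 2 - Real.exp (β * x) := by linarith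
  have h4 : 0 < Real.exp (β * x) + Real.exp (β / 2) := by positivity
  refine ⟨?_, ?_, ?_⟩
  · have hd := (((((hasDerivAt_exp_mul β x).add_const (Real.exp (β / 2))).div
      ((hasDerivAt_exp_mul β x).const_sub
        (1 + Real.exp (β / 2) + Real.exp (β / 2) ^ 2)) h3.ne').log
        (div_pos h4 h3).ne').const_mul (1 / β)).const_add (1 / 2)
    rw [← exp_sq_half] at hd
    refine HasDerivAt.congr_deriv (f := f321 β) hd ?_
    rw [hρ, rho321_eq, exp_sq_half β, sub_sub_cancel]
    simp only [Pi.div_apply]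
    generalize Real.exp (β * x) = X at *
    generalize Real.exp (β / 2) = a at *
    field_simp
    ring
  · rw [rho321_eq]; positivity
  · rw [hρ, sub_sub_cancel]; positivity

lemma limitShape_321 (hβ : 0 < β) :
    LimitShape (rho321 β) (f321 β) ⌈1 + Real.exp (β / 2)⌉₊ β := by
  have ha := Real.exp_pos (β / 2)
  have ha1 : 1 ≤ Real.exp (β / 2) := Real.one_le_exp (by positivity)
  have hC : 1 + Real.exp (β / 2) ≤ ⌈1 + Real.exp (β / 2)⌉₊ := Nat.le_ceil _
  refine ⟨?_, hβ.le, abs_rho321_sub_le hβ, fun x hx => ?_, fun x hx => ?_, ?_, fun x hx => ?_,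
    fun x hx => ?_⟩
  · exact Nat.one_le_iff_ne_zero.2 (Nat.ceil_pos.2 (by positivity)).ne'
  · obtain ⟨h0, h1⟩ := one_le_exp_mul hβ hx
    have h2 : 1 / (⌈1 + Real.exp (β / 2)⌉₊ : ℝ) ≤ 1 / (1 + Real.exp (β / 2)) := by gcongr
    have h3 : 1 / (1 + Real.exp (β / 2)) ≤ rho321 β x := by
      rw [rho321_eq, div_le_div_iff₀ (by positivity) (by positivity)]
      nlinarith
    have h4 : rho321 β x ≤ 1 - 1 / (1 + Real.exp (β / 2)) := by
      rw [rho321_eq, one_sub_div (by positivity), div_le_div_iff₀ (by positivity) (by positivity)]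
      nlinarith
    exact ⟨h2.trans h3, h4.trans (by linarith)⟩
  · rw [integral_rho321 hβ, ← Real.log_div (by positivity) (by positivity)]
    have h1 : Real.log ((Real.exp (β * x) + Real.exp (β / 2)) / (1 + Real.exp (β / 2))) ≤
        β * x / 2 := by
      rw [Real.log_le_iff_le_exp (by positivity), div_le_iff₀ (by positivity)]
      have h2 : Real.exp (β * x) = Real.exp (β * x / 2) ^ 2 := exp_sq_half _
      have h3 : 1 ≤ Real.exp (β * x / 2) :=
        Real.one_le_exp (by have := hx.1; positivity)
      have h4 : Real.exp (β * x / 2) ≤ Real.exp (β / 2) :=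
        Real.exp_le_exp.2 (by nlinarith [hx.2])
      rw [h2]
      nlinarith
    calc _ ≤ 1 / β * (β * x / 2) := by gcongr
      _ = x / 2 := by field_simp
  · rw [integral_rho321 hβ, mul_one, ← Real.log_div (by positivity) (by positivity),
      exp_sq_half β, show (Real.exp (β / 2) ^ 2 + Real.exp (β / 2)) / (1 + Real.exp (β / 2)) =
        Real.exp (β / 2) by field_simp; ring, Real.log_exp]
    field_simp
  · obtain ⟨h0, h1⟩ := one_le_exp_mul hβ hx
    have hY := exp_mul_f321 hβ hx
    have h3 : 0 < 1 + Real.exp (β / 2) + Real.exp (β / 2) ^ 2 - Real.exp (β * x) := by linarith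
    rw [← mul_div_assoc] at hY
    constructor
    · have h4 : 1 ≤ Real.exp (β * f321 β x) := by
        rw [hY, le_div_iff₀ h3]
        nlinarith
      have h5 := Real.one_le_exp_iff.1 h4
      exact nonneg_of_mul_nonneg_right h5 hβ
    · have h4 : Real.exp (β * f321 β x) ≤ Real.exp β := by
        rw [hY, exp_sq_half β, div_le_iff₀ h3]
        nlinarith [mul_nonneg (mul_nonneg ha.le (by linarith : 0 ≤ 1 + Real.exp (β / 2)))
          (sub_nonneg.2 h1)]
      have h5 := Real.exp_le_exp.1 h4
      exact le_of_mul_le_mul_left (by linarith) hβ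
  · obtain ⟨h0, h1⟩ := one_le_exp_mul hβ hx
    have hY := exp_mul_f321 hβ hx
    have h3 : 0 < 1 + Real.exp (β / 2) + Real.exp (β / 2) ^ 2 - Real.exp (β * x) := by linarith
    have hq : Real.exp (β * f321 β x) / (Real.exp (β * f321 β x) + Real.exp (β / 2)) *
        (1 + Real.exp (β / 2)) =
        (Real.exp (β * x) + Real.exp (β / 2)) / (1 + Real.exp (β / 2)) := by
      rw [hY]
      generalize Real.exp (β * x) = X at *
      generalize Real.exp (β / 2) = a at *
      have h5 : a * ((X + a) / (1 + a + a ^ 2 - X)) + a =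
          a * (1 + a) ^ 2 / (1 + a + a ^ 2 - X) := by
        field_simp
        ring
      rw [h5]
      field_simp
    have hl := congrArg Real.log hq
    rw [Real.log_mul (by positivity) (by positivity), Real.log_div (by positivity) (by positivity),
      Real.log_div (by positivity) (by positivity), Real.log_exp] at hl
    rw [integral_rho321 hβ, integral_rho321 hβ, ← hl]
    field_simp
    ring

lemma f321_zero (hβ : 0 < β) : f321 β 0 = 0 := by
  have h := exp_mul_f321 hβ (x := 0) (by simp)
  have ha := Real.exp_pos (β / 2)
  rw [mul_zero, Real.exp_zero, add_assoc, add_sub_cancel_left,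
    show Real.exp (β / 2) * ((1 + Real.exp (β / 2)) / (Real.exp (β / 2) + Real.exp (β / 2) ^ 2)) = 1
      by field_simp, Real.exp_eq_one_iff] at h
  exact (mul_eq_zero.1 h).resolve_left hβ.ne'

lemma f321_one (hβ : 0 < β) : f321 β 1 = 1 := by
  have h := exp_mul_f321 hβ (x := 1) (by simp)
  have ha := Real.exp_pos (β / 2)
  rw [mul_one, exp_sq_half β, add_sub_cancel_right,
    show Real.exp (β / 2) * ((Real.exp (β / 2) ^ 2 + Real.exp (β / 2)) / (1 + Real.exp (β / 2))) =
      Real.exp (β / 2) ^ 2 by field_simp; ring, ← exp_sq_half, Real.exp_eq_exp] at h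
  exact mul_left_cancel₀ hβ.ne' (h.trans (mul_one β).symm)

lemma continuousOn_f321 (hβ : 0 < β) : ContinuousOn (f321 β) (Icc 0 1) := fun _ hx =>
  (hasDerivAt_f321 hβ hx).1.continuousAt.continuousWithinAt

lemma strictMonoOn_f321 (hβ : 0 < β) : StrictMonoOn (f321 β) (Icc 0 1) := by
  refine strictMonoOn_of_deriv_pos (convex_Icc 0 1) (continuousOn_f321 hβ) fun x hx => ?_
  obtain ⟨h1, h2, h3⟩ := hasDerivAt_f321 hβ (interior_subset hx)
  rw [h1.deriv]
  exact div_pos h2 h3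

lemma image_f321 (hβ : 0 < β) : f321 β '' Icc 0 1 = Icc 0 1 := by
  refine Subset.antisymm ?_ ?_
  · rintro _ ⟨x, hx, rfl⟩
    exact (limitShape_321 hβ).mem x hx
  · have := intermediate_value_Icc zero_le_one (continuousOn_f321 hβ)
    rwa [f321_zero hβ, f321_one hβ] at this

lemma rho321_mem (β x : ℝ) : 0 ≤ rho321 β x ∧ rho321 β x ≤ 1 := by
  have h1 := Real.exp_pos (β * x)
  have h2 := Real.exp_pos (β / 2)
  rw [rho321_eq]
  exact ⟨by positivity, (div_le_one (by positivity)).2 (by linarith)⟩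

lemma map_f321_withDensity (hβ : 0 < β) :
    ((volume.restrict (Icc (0 : ℝ) 1)).withDensity
      (fun x => ENNReal.ofReal (rho321 β x))).map (f321 β) =
    (volume.restrict (Icc (0 : ℝ) 1)).withDensity (fun x => ENNReal.ofReal (1 - rho321 β x)) := by
  ext E hE
  have hf := measurable_f321 β
  rw [Measure.map_apply hf hE, withDensity_apply _ (hf hE), withDensity_apply _ hE,
    ← lintegral_indicator (hf hE), ← lintegral_indicator hE]
  nth_rewrite 2 [← image_f321 hβ]
  rw [lintegral_image_eq_lintegral_abs_deriv_mul measurableSet_Icc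
    (fun x hx => (hasDerivAt_f321 hβ hx).1.hasDerivWithinAt) (strictMonoOn_f321 hβ).injOn]
  refine setLIntegral_congr_fun measurableSet_Icc fun x hx => ?_
  obtain ⟨-, h2, h3⟩ := hasDerivAt_f321 hβ hx
  by_cases hxE : f321 β x ∈ E
  · simp only [indicator_of_mem hxE, indicator_of_mem (mem_preimage.2 hxE)]
    rw [← ENNReal.ofReal_mul (abs_nonneg _), abs_of_pos (div_pos h2 h3), div_mul_cancel₀ _ h3.ne']
  · rw [indicator_of_notMem hxE, indicator_of_notMem (by exact hxE), mul_zero]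

lemma withDensity_rho321_add (β : ℝ) :
    (volume.restrict (Icc (0 : ℝ) 1)).withDensity (fun x => ENNReal.ofReal (rho321 β x)) +
    (volume.restrict (Icc (0 : ℝ) 1)).withDensity (fun x => ENNReal.ofReal (1 - rho321 β x)) =
    volume.restrict (Icc (0 : ℝ) 1) := by
  rw [← withDensity_add_left (continuous_rho321 β).measurable.ennreal_ofReal]
  have : ((fun x => ENNReal.ofReal (rho321 β x)) + fun x => ENNReal.ofReal (1 - rho321 β x)) =
      1 := by
    ext x
    have := rho321_mem β x
    simp only [Pi.add_apply, Pi.one_apply]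
    rw [← ENNReal.ofReal_add this.1 (by linarith), add_sub_cancel, ENNReal.ofReal_one]
  rw [this, withDensity_one]

lemma isPermuton_mu321 (hβ : 0 < β) : IsPermuton (mu321 β) := by
  have hf := measurable_f321 β
  have hm₁ : Measurable fun x => (x, f321 β x) := measurable_id.prodMk hf
  have hm₂ : Measurable fun x => (f321 β x, x) := hf.prodMk measurable_id
  have h1 : (mu321 β).map Prod.fst = volume.restrict (Icc (0 : ℝ) 1) := by
    rw [mu321, Measure.map_add _ _ measurable_fst, Measure.map_map measurable_fst hm₁,
      Measure.map_map measurable_fst hm₂]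
    change Measure.map id _ + Measure.map (f321 β) _ = _
    rw [Measure.map_id, map_f321_withDensity hβ, withDensity_rho321_add]
  have h2 : (mu321 β).map Prod.snd = volume.restrict (Icc (0 : ℝ) 1) := by
    rw [mu321, Measure.map_add _ _ measurable_snd, Measure.map_map measurable_snd hm₁,
      Measure.map_map measurable_snd hm₂]
    change Measure.map (f321 β) _ + Measure.map id _ = _
    rw [Measure.map_id, map_f321_withDensity hβ, add_comm, withDensity_rho321_add]
  refine ⟨⟨?_⟩, h1, h2⟩
  rw [← preimage_univ (f := Prod.fst), ← Measure.map_apply measurable_fst .univ, h1]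
  simp

lemma integral_map_withDensity_rho321 (β : ℝ) {φ : ℝ → ℝ × ℝ} (hφ : Measurable φ)
    (g : BoundedContinuousFunction (ℝ × ℝ) ℝ) :
    Integrable g (((volume.restrict (Icc (0 : ℝ) 1)).withDensity
      (fun x => ENNReal.ofReal (rho321 β x))).map φ) ∧
    ∫ z, g z ∂(((volume.restrict (Icc (0 : ℝ) 1)).withDensity
      (fun x => ENNReal.ofReal (rho321 β x))).map φ) =
      ∫ x in (0 : ℝ)..1, rho321 β x * g (φ x) := by
  have hfin : IsFiniteMeasure ((volume.restrict (Icc (0 : ℝ) 1)).withDensity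
      (fun x => ENNReal.ofReal (rho321 β x))) := by
    refine isFiniteMeasure_withDensity_ofReal ?_
    exact ((continuous_rho321 β).continuousOn.integrableOn_compact isCompact_Icc).2
  refine ⟨g.integrable _, ?_⟩
  rw [integral_map hφ.aemeasurable g.continuous.aestronglyMeasurable,
    integral_withDensity_eq_integral_toReal_smul
      (continuous_rho321 β).measurable.ennreal_ofReal (by simp),
    integral_Icc_eq_integral_Ioc, ← intervalIntegral.integral_of_le zero_le_one]
  simp only [ENNReal.toReal_ofReal (rho321_mem β _).1, smul_eq_mul]

lemma isShapePermuton_mu321 (hβ : 0 < β) :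
    IsShapePermuton (rho321 β) (f321 β) (mu321 β) := by
  have hp := isPermuton_mu321 hβ
  have hf := measurable_f321 β
  refine ⟨hp.1, hp.unitSquare, fun g => ?_⟩
  obtain ⟨hi₁, he₁⟩ := integral_map_withDensity_rho321 β (measurable_id.prodMk hf) g
  obtain ⟨hi₂, he₂⟩ := integral_map_withDensity_rho321 β (hf.prodMk measurable_id) g
  rw [mu321]
  exact (integral_add_measure hi₁ hi₂).trans (by rw [he₁, he₂]; rfl)

lemma one_sub_rho321 (β : ℝ) (n : ℕ) {j : ℕ} (hj : j < n) :
    1 - rho321 β (j / n) = rho321 β (j / n) * Real.exp (β / n * (n / 2 - j)) := by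
  have hn0 : (0 : ℝ) < n := by exact_mod_cast (Nat.zero_le j).trans_lt hj
  have h1 : β / n * (n / 2 - j) = β * (1 / 2 - j / n) := by field_simp
  have h2 := Real.exp_pos (β * (1 / 2 - j / n))
  rw [h1, rho321]
  field_simp
  ring

end rho

/-- Mallows random permutations with parameter `e^{β/n}` conditioned to avoid `321`
converge weakly in probability to the permuton `μ^{321}_β` when `β > 0`
(which is indeed a permuton), and to the diagonal permuton when `β ≤ 0`. -/
theorem mallows321_converges_to_explicit_permuton (β : ℝ)
    (Ω : Type) [MeasureSpace Ω] [IsProbabilityMeasure (volume : Measure Ω)]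
    (τ : (n : ℕ) → Ω → Equiv.Perm (Fin n))
    (hmeas : ∀ (n : ℕ) (σ : Equiv.Perm (Fin n)), MeasurableSet {ω | τ n ω = σ})
    (hlaw : ∀ (n : ℕ), 1 ≤ n → ∀ σ : Equiv.Perm (Fin n),
      volume {ω | τ n ω = σ} =
        ENNReal.ofReal
          (if Avoids321 σ then Real.exp (β / n * invCount σ) / Z321 β n else 0)) :
    (0 < β →
      IsPermuton (mu321 β) ∧
      ∀ d : Measure (ℝ × ℝ) → Measure (ℝ × ℝ) → ℝ, MetrizesWeakConvUnitSq d →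
        ∀ ε > (0:ℝ),
          Filter.Tendsto
            (fun n => volume {ω | ε < d (permutonOfPerm (τ n ω)) (mu321 β)})
            Filter.atTop (nhds 0)) ∧
    (β ≤ 0 →
      ∀ d : Measure (ℝ × ℝ) → Measure (ℝ × ℝ) → ℝ, MetrizesWeakConvUnitSq d →
        ∀ ε > (0:ℝ),
          Filter.Tendsto
            (fun n => volume {ω | ε < d (permutonOfPerm (τ n ω)) diagPermuton})
            Filter.atTop (nhds 0)) := by
  refine ⟨fun hβ => ⟨isPermuton_mu321 hβ, fun d hd ε hε => ?_⟩, fun hβ d hd ε hε => ?_⟩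
  · exact (limitShape_321 hβ).tendsto_volume_lt (isShapePermuton_mu321 hβ) le_rfl (Or.inl rfl)
      (fun n j hj => one_sub_rho321 β n hj) τ hlaw hd hε
  · exact limitShape_diag.tendsto_volume_lt isShapePermuton_diag hβ (Or.inr fun _ => rfl)
      (fun n j _ => by norm_num) τ hlaw hd hε

end
end

section
/- For every β > 0, lim_{n→∞} (1/n)·log(Z_n^{β,231}) = 2·log(1 + e^β) − β − (1/β)·∫_{e^{−β}}^{e^{β}} (log y)/(1+y) dy. -/
open MeasureTheory Filter Set

attribute [local instance] Classical.propDecidable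

noncomputable section

/-- `σ` avoids the pattern `231`. -/
def Avoids231 {n : ℕ} (σ : Equiv.Perm (Fin n)) : Prop :=
  ¬ ∃ i j k : Fin n, i < j ∧ j < k ∧ σ k < σ i ∧ σ i < σ j

/-- Partition function of the 231-avoiding Mallows model with parameter `e^{β/n}`. -/
def Z231 (β : ℝ) (n : ℕ) : ℝ :=
  ∑ σ ∈ Finset.univ.filter (fun σ : Equiv.Perm (Fin n) => Avoids231 σ),
    Real.exp (β / n * invCount σ)

/-- Append the value `v` at the end of `τ`, shifting the values of `τ` that are at least `v`. -/
def insertLast {n : ℕ} (v : Fin (n + 1)) (τ : Equiv.Perm (Fin n)) : Equiv.Perm (Fin (n + 1)) :=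
  (finSuccEquiv' (Fin.last n)).trans ((Equiv.optionCongr τ).trans (finSuccEquiv' v).symm)

@[simp]
theorem insertLast_last {n : ℕ} (v : Fin (n + 1)) (τ : Equiv.Perm (Fin n)) :
    insertLast v τ (Fin.last n) = v := by
  simp [insertLast]

@[simp]
theorem insertLast_castSucc {n : ℕ} (v : Fin (n + 1)) (τ : Equiv.Perm (Fin n)) (i : Fin n) :
    insertLast v τ i.castSucc = v.succAbove (τ i) := by
  rw [insertLast, ← Fin.succAbove_last_apply]
  simp only [Equiv.trans_apply, finSuccEquiv'_succAbove, Equiv.optionCongr_apply, Option.map_some,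
    finSuccEquiv'_symm_some]

theorem insertLast_bijective (n : ℕ) :
    Function.Bijective (fun p : Fin (n + 1) × Equiv.Perm (Fin n) => insertLast p.1 p.2) := by
  rw [Fintype.bijective_iff_injective_and_card]
  constructor
  · rintro ⟨v, τ⟩ ⟨w, ρ⟩ h
    have h' : insertLast v τ = insertLast w ρ := h
    have hv : v = w := by simpa using congrArg (fun σ => σ (Fin.last n)) h'
    subst hv
    congr 1
    ext i
    have := congrArg (fun σ => σ i.castSucc) h'
    simp only [insertLast_castSucc] at this
    rw [Fin.succAbove_right_injective this]
  · simp [Fintype.card_perm, Nat.factorial_succ]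

theorem invCount_eq_sum {n : ℕ} (σ : Equiv.Perm (Fin n)) :
    invCount σ = ∑ i, ∑ j, if i < j ∧ σ j < σ i then 1 else 0 := by
  rw [invCount, Finset.card_filter, ← Finset.univ_product_univ, Finset.sum_product]

theorem card_lt_succAbove {n : ℕ} (v : Fin (n + 1)) :
    (∑ i : Fin n, if v < v.succAbove i then 1 else 0) = n - (v : ℕ) := by
  have h := Fin.sum_univ_succAbove (fun i => if v < i then 1 else 0) v
  simp only [lt_self_iff_false, if_false, zero_add] at h
  rw [← h, ← Finset.card_filter]
  have : Finset.filter (fun i => v < i) Finset.univ = Finset.Ioi v := by ext; simp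
  rw [this, Fin.card_Ioi]
  omega

theorem invCount_insertLast {n : ℕ} (v : Fin (n + 1)) (τ : Equiv.Perm (Fin n)) :
    invCount (insertLast v τ) = invCount τ + (n - (v : ℕ)) := by
  rw [invCount_eq_sum, invCount_eq_sum, Fin.sum_univ_castSucc]
  simp only [Fin.sum_univ_castSucc, insertLast_last, insertLast_castSucc, Fin.castSucc_lt_castSucc_iff,
    Fin.castSucc_lt_last, true_and, lt_self_iff_false, false_and, if_false, add_zero,
    Fin.succAbove_lt_succAbove_iff, Finset.sum_add_distrib]
  have hlast : ∀ i : Fin n, ¬ Fin.last n < i.castSucc := fun i => (Fin.castSucc_lt_last i).le.not_gt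
  simp only [hlast, false_and, if_false, Finset.sum_const_zero, add_zero]
  rw [← card_lt_succAbove v, ← Equiv.sum_comp τ (fun i => if v < v.succAbove i then 1 else 0)]

/-- The `k` largest values of `τ` appear in decreasing order. -/
def TopDecreasing {n : ℕ} (k : ℕ) (τ : Equiv.Perm (Fin n)) : Prop :=
  ∀ i j : Fin n, i < j → n ≤ τ i + k → n ≤ τ j + k → τ j < τ i

theorem lt_succAbove_iff_le_add {n : ℕ} (v : Fin (n + 1)) (x : Fin n) :
    v < v.succAbove x ↔ n ≤ x + (n - (v : ℕ)) := by
  rw [Fin.lt_succAbove_iff_le_castSucc, Fin.le_def, Fin.val_castSucc]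
  omega

theorem avoids231_insertLast {n : ℕ} (v : Fin (n + 1)) (τ : Equiv.Perm (Fin n)) :
    Avoids231 (insertLast v τ) ↔ Avoids231 τ ∧ TopDecreasing (n - (v : ℕ)) τ := by
  constructor
  · intro h
    refine ⟨?_, ?_⟩
    · rintro ⟨i, j, k, hij, hjk, h1, h2⟩
      exact h ⟨i.castSucc, j.castSucc, k.castSucc, by simpa, by simpa, by simpa, by simpa⟩
    · intro i j hij hi _
      by_contra hle
      have hlt : τ i < τ j := lt_of_le_of_ne (not_lt.1 hle) fun e => hij.ne (τ.injective e)
      exact h ⟨i.castSucc, j.castSucc, Fin.last n, by simpa, Fin.castSucc_lt_last j,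
        by simpa [lt_succAbove_iff_le_add] using hi, by simpa⟩
  · rintro ⟨hτ, hd⟩ ⟨i, j, k, hij, hjk, h1, h2⟩
    obtain ⟨j, rfl⟩ := Fin.exists_castSucc_eq.2 (hjk.trans_le (Fin.le_last k)).ne
    obtain ⟨i, rfl⟩ := Fin.exists_castSucc_eq.2 ((hij.trans hjk).trans_le (Fin.le_last k)).ne
    simp only [insertLast_castSucc, Fin.succAbove_lt_succAbove_iff, Fin.castSucc_lt_castSucc_iff]
      at h1 h2 hij
    induction k using Fin.lastCases with
    | last =>
      rw [insertLast_last, lt_succAbove_iff_le_add] at h1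
      exact lt_asymm h2 (hd i j hij h1 (h1.trans (Nat.add_le_add_right (Fin.le_def.1 h2.le) _)))
    | cast k =>
      simp only [insertLast_castSucc, Fin.succAbove_lt_succAbove_iff,
        Fin.castSucc_lt_castSucc_iff] at h1 hjk
      exact hτ ⟨i, j, k, hij, hjk, h1, h2⟩

theorem topDecreasing_insertLast {n k : ℕ} (v : Fin (n + 1)) (τ : Equiv.Perm (Fin n))
    (hτ : TopDecreasing (n - (v : ℕ)) τ) (hk : k ≤ n + 1) :
    TopDecreasing k (insertLast v τ) ↔ k ≤ n - (v : ℕ) + 1 := by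
  have hv := v.is_lt
  constructor
  · intro h
    by_contra hlt
    let w : Fin n := ⟨v - 1, by omega⟩
    have hw : v.succAbove w = w.castSucc :=
      Fin.succAbove_of_castSucc_lt _ _ (by change (v : ℕ) - 1 < v; omega)
    have := h (τ.symm w).castSucc (Fin.last n) (Fin.castSucc_lt_last _)
      (by simp [hw, w]; omega) (by simp; omega)
    simp [hw, w, Fin.lt_def] at this
    omega
  · intro hkv i j hij hi hj
    obtain ⟨i, rfl⟩ := Fin.exists_castSucc_eq.2 (hij.trans_le (Fin.le_last j)).ne
    have hvi : v < v.succAbove (τ i) := by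
      refine lt_of_le_of_ne ?_ (Fin.succAbove_ne v _).symm
      rw [insertLast_castSucc] at hi
      rw [Fin.le_def]
      omega
    induction j using Fin.lastCases with
    | last => simpa using hvi
    | cast j =>
      have hvj : v < v.succAbove (τ j) := by
        refine lt_of_le_of_ne ?_ (Fin.succAbove_ne v _).symm
        rw [insertLast_castSucc] at hj
        rw [Fin.le_def]
        omega
      simp only [insertLast_castSucc, Fin.succAbove_lt_succAbove_iff]
      exact hτ i j (by simpa using hij) ((lt_succAbove_iff_le_add _ _).1 hvi)
        ((lt_succAbove_iff_le_add _ _).1 hvj)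

/-- Generating function by inversions of the `231`-avoiding permutations whose `k` largest values
appear in decreasing order. -/
def topWeight (q : ℝ) (n k : ℕ) : ℝ :=
  ∑ τ : Equiv.Perm (Fin n), if Avoids231 τ ∧ TopDecreasing k τ then q ^ invCount τ else 0

theorem topWeight_succ (q : ℝ) {n k : ℕ} (hk : k ≤ n + 1) :
    topWeight q (n + 1) k =
      ∑ a ∈ Finset.range (n + 1), if k ≤ a + 1 then q ^ a * topWeight q n a else 0 := by
  rw [topWeight, ← (insertLast_bijective n).sum_comp, Fintype.sum_prod_type,
    ← Finset.sum_range_reflect, ← Fin.sum_univ_eq_sum_range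
      (fun a => if k ≤ n + 1 - 1 - a + 1 then
        q ^ (n + 1 - 1 - a) * topWeight q n (n + 1 - 1 - a) else 0)]
  refine Finset.sum_congr rfl fun v _ => ?_
  simp only [Nat.add_sub_cancel, topWeight, Finset.mul_sum]
  have hterm : ∀ τ : Equiv.Perm (Fin n),
      (if Avoids231 (insertLast v τ) ∧ TopDecreasing k (insertLast v τ) then
        q ^ invCount (insertLast v τ) else 0) =
      if k ≤ n - (v : ℕ) + 1 then q ^ (n - (v : ℕ)) *
        (if Avoids231 τ ∧ TopDecreasing (n - (v : ℕ)) τ then q ^ invCount τ else 0) else 0 := by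
    intro τ
    rw [avoids231_insertLast, invCount_insertLast, pow_add, mul_comm (q ^ invCount τ)]
    by_cases hd : TopDecreasing (n - (v : ℕ)) τ
    · rw [topDecreasing_insertLast v τ hd hk]
      by_cases ha : Avoids231 τ <;> simp [ha, hd]
    · simp [hd]
  rw [Finset.sum_congr rfl fun τ _ => hterm τ]
  split_ifs <;> simp

theorem topWeight_zero_zero (q : ℝ) : topWeight q 0 0 = 1 := by
  simp [topWeight, Avoids231, TopDecreasing, invCount]

theorem topWeight_succ_self (q : ℝ) (n : ℕ) :
    topWeight q (n + 1) (n + 1) = q ^ n * topWeight q n n := by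
  rw [topWeight_succ q le_rfl, Finset.sum_range_succ, if_pos le_rfl, Finset.sum_eq_zero, zero_add]
  intro a ha
  rw [if_neg]
  have := Finset.mem_range.1 ha
  omega

theorem topWeight_succ_succ (q : ℝ) {n k : ℕ} (hk : k < n) :
    topWeight q (n + 1) (k + 1) = q ^ k * topWeight q n k + topWeight q (n + 1) (k + 2) := by
  rw [topWeight_succ q (by omega), topWeight_succ q (by omega),
    ← Finset.add_sum_erase _ _ (Finset.mem_range.2 (by omega : k < n + 1)), if_pos le_rfl,
    ← Finset.add_sum_erase (Finset.range (n + 1)) (fun a => if k + 2 ≤ a + 1 then _ else 0)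
      (Finset.mem_range.2 (by omega : k < n + 1)), if_neg (by omega), zero_add]
  congr 1
  refine Finset.sum_congr rfl fun a ha => ?_
  have := Finset.ne_of_mem_erase ha
  congr 1
  exact propext (by omega)

theorem topWeight_succ_zero (q : ℝ) (n : ℕ) :
    topWeight q (n + 1) 0 = topWeight q (n + 1) 1 := by
  rw [topWeight_succ q (by omega), topWeight_succ q (by omega)]
  simp

theorem Z231_eq_topWeight (β : ℝ) (n : ℕ) :
    Z231 β n = topWeight (Real.exp (β / n)) n 0 := by
  have h : ∀ τ : Equiv.Perm (Fin n), TopDecreasing 0 τ := fun τ i _ _ hi _ => by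
    have := (τ i).is_lt
    omega
  simp only [Z231, topWeight, h, and_true, Finset.sum_filter]
  refine Finset.sum_congr rfl fun τ _ => ?_
  rw [← Real.exp_nat_mul, mul_comm]

/-- The `q`-Pochhammer symbol `(s; s)_k`. -/
def qPoch (s : ℝ) (k : ℕ) : ℝ := ∏ i ∈ Finset.range k, (1 - s ^ (i + 1))

/-- Generating function by signed area of the lattice paths with `n` up-steps and `m` down-steps;
the weight per unit of area is `s⁻¹`. -/
def pathWeight (s : ℝ) (n m : ℕ) : ℝ :=
  s⁻¹ ^ n.choose 2 * (qPoch s (n + m) / (qPoch s n * qPoch s m))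

theorem qPoch_succ (s : ℝ) (k : ℕ) : qPoch s (k + 1) = qPoch s k * (1 - s ^ (k + 1)) := by
  simp [qPoch, Finset.prod_range_succ]

theorem one_sub_pow_pos {s : ℝ} (h0 : 0 < s) (h1 : s < 1) (k : ℕ) : 0 < 1 - s ^ (k + 1) :=
  sub_pos.2 (pow_lt_one₀ h0.le h1 k.succ_ne_zero)

theorem qPoch_pos {s : ℝ} (h0 : 0 < s) (h1 : s < 1) (k : ℕ) : 0 < qPoch s k :=
  Finset.prod_pos fun i _ => one_sub_pow_pos h0 h1 i

theorem pathWeight_pos {s : ℝ} (h0 : 0 < s) (h1 : s < 1) (n m : ℕ) : 0 < pathWeight s n m := by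
  have := qPoch_pos h0 h1 (n + m)
  have := qPoch_pos h0 h1 n
  have := qPoch_pos h0 h1 m
  unfold pathWeight
  positivity

theorem choose_two_succ (n : ℕ) : (n + 1).choose 2 = n + n.choose 2 := by
  simp [Nat.choose_succ_succ' n 1]

theorem pathWeight_zero_right {s : ℝ} (h0 : 0 < s) (h1 : s < 1) (n : ℕ) :
    pathWeight s n 0 = s⁻¹ ^ n.choose 2 := by
  have := (qPoch_pos h0 h1 n).ne'
  simp [pathWeight, qPoch] at this ⊢
  rw [div_self this, mul_one]

theorem pathWeight_up {s : ℝ} (h0 : 0 < s) (h1 : s < 1) (n m : ℕ) :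
    s⁻¹ ^ n * s ^ (m + 1) * pathWeight s n (m + 1) * (1 - s ^ (n + m + 2)) =
      s ^ (m + 1) * (1 - s ^ (n + 1)) * pathWeight s (n + 1) (m + 1) := by
  have hn := (qPoch_pos h0 h1 n).ne'
  have hm := (qPoch_pos h0 h1 (m + 1)).ne'
  have h := (one_sub_pow_pos h0 h1 n).ne'
  simp only [pathWeight, choose_two_succ, pow_add s⁻¹ n]
  rw [show n + 1 + (m + 1) = (n + m + 1) + 1 by ring, show n + (m + 1) = n + m + 1 by ring,
    qPoch_succ s (n + m + 1), qPoch_succ s n]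
  field_simp

theorem pathWeight_down {s : ℝ} (h0 : 0 < s) (h1 : s < 1) (n m : ℕ) :
    pathWeight s (n + 1) m * (1 - s ^ (n + m + 2)) =
      (1 - s ^ (m + 1)) * pathWeight s (n + 1) (m + 1) := by
  have hn := (qPoch_pos h0 h1 (n + 1)).ne'
  have hm := (qPoch_pos h0 h1 m).ne'
  have h := (one_sub_pow_pos h0 h1 m).ne'
  simp only [pathWeight]
  rw [show n + 1 + (m + 1) = (n + m + 1) + 1 by ring, show n + 1 + m = n + m + 1 by ring,
    qPoch_succ s (n + m + 1), qPoch_succ s m]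
  field_simp

theorem pathWeight_succ {s : ℝ} (h0 : 0 < s) (h1 : s < 1) (n m : ℕ) :
    pathWeight s (n + 1) (m + 1) =
      s⁻¹ ^ n * s ^ (m + 1) * pathWeight s n (m + 1) + pathWeight s (n + 1) m := by
  have hu := pathWeight_up h0 h1 n m
  have hd := pathWeight_down h0 h1 n m
  refine mul_right_cancel₀ (one_sub_pow_pos h0 h1 (n + m + 1)).ne' ?_
  rw [add_mul, hu, hd]
  ring

theorem succ_mul_pow_mul_one_sub_pow_le {s : ℝ} (h0 : 0 < s) (h1 : s < 1) (n m : ℕ) :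
    m * (s ^ m * (1 - s ^ n)) ≤ n * (1 - s ^ m) := by
  have hs : ∀ k : ℕ, k * (s ^ k * (1 - s)) ≤ 1 - s ^ k ∧ 1 - s ^ k ≤ k * (1 - s) := by
    intro k
    induction k with
    | zero => simp
    | succ k ih =>
      have hk : s ^ k ≤ 1 := pow_le_one₀ h0.le h1.le
      have hk0 : 0 < s ^ k := by positivity
      have hd : 0 < 1 - s := by linarith
      push_cast
      rw [pow_succ]
      constructor
      · have : 0 ≤ (k : ℝ) * s ^ k * (1 - s) * (1 - s) := by positivity
        nlinarith [ih.1, mul_pos hk0 (mul_pos hd hd)]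
      · nlinarith [ih.2]
  calc m * (s ^ m * (1 - s ^ n)) ≤ m * (s ^ m * (n * (1 - s))) := by
        gcongr; exact (hs n).2
    _ = n * (m * (s ^ m * (1 - s))) := by ring
    _ ≤ n * (1 - s ^ m) := by gcongr; exact (hs m).1

/-- The ballot factor turns `pathWeight` into a subsolution of the path recursion. -/
theorem ballot_pathWeight_succ_le {s : ℝ} (h0 : 0 < s) (h1 : s < 1) (n m : ℕ) :
    pathWeight s (n + 1) (m + 1) * (1 - (m + 1) / (n + 2)) ≤
      s⁻¹ ^ n * s ^ (m + 1) * (pathWeight s n (m + 1) * (1 - (m + 1) / (n + 1))) +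
        pathWeight s (n + 1) m * (1 - m / (n + 2)) := by
  have hu := pathWeight_up h0 h1 n m
  have hd := pathWeight_down h0 h1 n m
  have hX := pathWeight_pos h0 h1 (n + 1) (m + 1)
  have hp := one_sub_pow_pos h0 h1 (n + m + 1)
  have key := succ_mul_pow_mul_one_sub_pow_le h0 h1 (n + 1) (m + 1)
  refine le_of_mul_le_mul_right ?_ hp
  rw [add_mul]
  have e1 : s⁻¹ ^ n * s ^ (m + 1) * (pathWeight s n (m + 1) * (1 - ((m : ℝ) + 1) / (n + 1))) *
      (1 - s ^ (n + m + 1 + 1)) = s ^ (m + 1) * (1 - s ^ (n + 1)) * pathWeight s (n + 1) (m + 1) *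
        (1 - ((m : ℝ) + 1) / (n + 1)) := by rw [← hu]; ring
  have e2 : pathWeight s (n + 1) m * (1 - (m : ℝ) / (n + 2)) * (1 - s ^ (n + m + 1 + 1)) =
      (1 - s ^ (m + 1)) * pathWeight s (n + 1) (m + 1) * (1 - (m : ℝ) / (n + 2)) := by
    rw [← hd]; ring
  rw [e1, e2, show n + m + 1 + 1 = (n + 1) + (m + 1) by ring, pow_add s (n + 1) (m + 1)]
  rw [← sub_nonneg]
  generalize pathWeight s (n + 1) (m + 1) = X at *
  generalize s ^ (n + 1) = A at *
  generalize s ^ (m + 1) = C at *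
  push_cast at key
  have : C * (1 - A) * X * (1 - ((m : ℝ) + 1) / (n + 1)) + (1 - C) * X * (1 - (m : ℝ) / (n + 2)) -
      X * (1 - ((m : ℝ) + 1) / (n + 2)) * (1 - A * C) =
      X * (((n : ℝ) + 1) * (1 - C) - (m + 1) * (C * (1 - A))) / ((n + 1) * (n + 2)) := by
    field_simp
    ring
  rw [this]
  have := sub_nonneg.2 key
  positivity

theorem pathWeight_diag_bounds {s : ℝ} (h0 : 0 < s) (h1 : s < 1) (n : ℕ) :
    (∏ i ∈ Finset.range n, (1 + s ^ (i + 1))) ^ 2 / (n + 1) ≤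
        qPoch s (n + n) / (qPoch s n * qPoch s n) ∧
      qPoch s (n + n) / (qPoch s n * qPoch s n) ≤
        (∏ i ∈ Finset.range n, (1 + s ^ (i + 1))) ^ 2 := by
  induction n with
  | zero => simp [qPoch]
  | succ n ih =>
    have hn := qPoch_pos h0 h1 n
    have hnn := qPoch_pos h0 h1 (n + n)
    have a1 := one_sub_pow_pos h0 h1 n
    have a2 := one_sub_pow_pos h0 h1 (2 * n)
    have a3 := one_sub_pow_pos h0 h1 (2 * n + 1)
    have a4 : 1 - s ^ (2 * n + 1 + 1) = (1 - s ^ (n + 1)) * (1 + s ^ (n + 1)) := by ring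
    have hA : 0 < 1 + s ^ (n + 1) := by positivity
    have e : qPoch s (n + 1 + (n + 1)) / (qPoch s (n + 1) * qPoch s (n + 1)) =
        qPoch s (n + n) / (qPoch s n * qPoch s n) * (1 + s ^ (n + 1)) ^ 2 *
          ((1 - s ^ (2 * n + 1)) / (1 - s ^ (2 * n + 1 + 1))) := by
      rw [show n + 1 + (n + 1) = (n + n + 1) + 1 by ring, qPoch_succ s (n + n + 1),
        qPoch_succ s (n + n), qPoch_succ s n, show n + n = 2 * n by ring, a4]
      field_simp
    have r1 : (1 - s ^ (2 * n + 1)) / (1 - s ^ (2 * n + 1 + 1)) ≤ 1 := by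
      rw [div_le_one a3]
      have : s ^ (2 * n + 1 + 1) ≤ s ^ (2 * n + 1) :=
        pow_le_pow_of_le_one h0.le h1.le (by omega)
      linarith
    have r2 : ((n : ℝ) + 1) / (n + 2) ≤ (1 - s ^ (2 * n + 1)) / (1 - s ^ (2 * n + 1 + 1)) := by
      have key := succ_mul_pow_mul_one_sub_pow_le h0 h1 1 (2 * n + 1)
      rw [div_le_div_iff₀ (by positivity) a3]
      push_cast at key
      rw [pow_succ s (2 * n + 1)]
      generalize s ^ (2 * n + 1) = C at *
      nlinarith
    have hpos : 0 < qPoch s (n + n) / (qPoch s n * qPoch s n) := by positivity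
    rw [e, Finset.prod_range_succ, mul_pow]
    constructor
    · push_cast
      calc _ = (∏ i ∈ Finset.range n, (1 + s ^ (i + 1))) ^ 2 / (n + 1) * (1 + s ^ (n + 1)) ^ 2 *
            (((n : ℝ) + 1) / (n + 2)) := by
              field_simp
              ring
        _ ≤ _ := mul_le_mul (mul_le_mul_of_nonneg_right ih.1 (sq_nonneg _)) r2 (by positivity)
            (by positivity)
    · calc _ ≤ (∏ i ∈ Finset.range n, (1 + s ^ (i + 1))) ^ 2 * (1 + s ^ (n + 1)) ^ 2 * 1 := by
            gcongr; exact ih.2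
        _ = _ := mul_one _

theorem continuous_log_one_add_exp_neg : Continuous fun u : ℝ => Real.log (1 + Real.exp (-u)) := by
  refine Continuous.log (by fun_prop) fun u => ?_
  positivity

theorem antitone_log_one_add_exp_neg : Antitone fun u : ℝ => Real.log (1 + Real.exp (-u)) := by
  intro a b h
  simp only
  gcongr

theorem integral_log_one_add_exp_neg (β : ℝ) :
    β ^ 2 / 2 + 2 * ∫ u in (0 : ℝ)..β, Real.log (1 + Real.exp (-u)) =
      2 * β * Real.log (1 + Real.exp β) - β ^ 2 -
        ∫ y in Real.exp (-β)..Real.exp β, Real.log y / (1 + y) := by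
  have hc : ∀ y : ℝ, 0 < y → ContinuousAt (fun y : ℝ => Real.log y / (1 + y)) y := fun y hy =>
    (Real.continuousAt_log hy.ne').div (by fun_prop) (by positivity)
  have hcon : ContinuousOn (fun y : ℝ => Real.log y / (1 + y)) (Ioi 0) :=
    fun y hy => (hc y hy).continuousWithinAt
  have hint : ∀ a b : ℝ, 0 < a → 0 < b →
      IntervalIntegrable (fun y : ℝ => Real.log y / (1 + y)) volume a b := fun a b ha hb =>
    (hcon.mono fun y hy => lt_of_lt_of_le (lt_min ha hb) hy.1).intervalIntegrable
  have hmeas : ∀ y : ℝ, 0 < y →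
      StronglyMeasurableAtFilter (fun y : ℝ => Real.log y / (1 + y)) (nhds y) volume :=
    fun y hy => hcon.stronglyMeasurableAtFilter isOpen_Ioi y hy
  have hF : ∀ x : ℝ, 0 < x → HasDerivAt (fun t => ∫ y in (1 : ℝ)..t, Real.log y / (1 + y))
      (Real.log x / (1 + x)) x := fun x hx =>
    intervalIntegral.integral_hasDerivAt_right (hint 1 x one_pos hx) (hmeas x hx) (hc x hx)
  let D : ℝ → ℝ := fun b => b ^ 2 / 2 + 2 * (∫ u in (0 : ℝ)..b, Real.log (1 + Real.exp (-u))) -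
    (2 * b * Real.log (1 + Real.exp b) - b ^ 2 -
      ((∫ y in (1 : ℝ)..Real.exp b, Real.log y / (1 + y)) -
        ∫ y in (1 : ℝ)..Real.exp (-b), Real.log y / (1 + y)))
  have hD : ∀ b, HasDerivAt D 0 b := by
    intro b
    have d1 : HasDerivAt (fun b : ℝ => ∫ u in (0 : ℝ)..b, Real.log (1 + Real.exp (-u)))
        (Real.log (1 + Real.exp (-b))) b :=
      continuous_log_one_add_exp_neg.integral_hasStrictDerivAt 0 b |>.hasDerivAt
    have d2 := (hF _ (Real.exp_pos b)).comp b (Real.hasDerivAt_exp b)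
    have d3 := (hF _ (Real.exp_pos (-b))).comp b (hasDerivAt_neg b).exp
    have d4 : HasDerivAt (fun b : ℝ => Real.log (1 + Real.exp b))
        (Real.exp b / (1 + Real.exp b)) b :=
      ((Real.hasDerivAt_exp b).const_add 1).log (by positivity)
    have d5 : HasDerivAt (fun b : ℝ => b ^ 2) (2 * b) b := by simpa using hasDerivAt_pow 2 b
    have d6 : HasDerivAt (fun b : ℝ => 2 * b) 2 b := by
      simpa using (hasDerivAt_id b).const_mul (2 : ℝ)
    have d := ((d5.div_const 2).add (d1.const_mul 2)).sub
      (((d6.mul d4).sub d5).sub (d2.sub d3))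
    refine d.congr_deriv ?_
    have e : Real.log (1 + Real.exp (-b)) = Real.log (1 + Real.exp b) - b := by
      rw [show 1 + Real.exp (-b) = (1 + Real.exp b) / Real.exp b by
        rw [Real.exp_neg]; field_simp; ring, Real.log_div (by positivity) (by positivity),
        Real.log_exp]
    rw [e, Real.log_exp, Real.log_exp, Real.exp_neg]
    have := Real.exp_pos b
    field_simp
    ring
  have hconst := is_const_of_deriv_eq_zero (fun b => (hD b).differentiableAt)
    (fun b => (hD b).deriv) β 0
  have h0 : D 0 = 0 := by simp [D]
  have hs := intervalIntegral.integral_interval_sub_left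
    (hint 1 _ one_pos (Real.exp_pos β)) (hint 1 _ one_pos (Real.exp_pos (-β)))
  rw [h0] at hconst
  simp only [D, hs] at hconst
  linarith

theorem sum_log_one_add_exp_bounds {β : ℝ} (hβ : 0 < β) {n : ℕ} (hn : 0 < n) :
    (n / β * ∫ u in (0 : ℝ)..β, Real.log (1 + Real.exp (-u))) - Real.log 2 ≤
        ∑ i ∈ Finset.range n, Real.log (1 + Real.exp (-(β / n * (i + 1 : ℕ)))) ∧
      ∑ i ∈ Finset.range n, Real.log (1 + Real.exp (-(β / n * (i + 1 : ℕ)))) ≤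
        n / β * ∫ u in (0 : ℝ)..β, Real.log (1 + Real.exp (-u)) := by
  have hn' : (0 : ℝ) < n := by exact_mod_cast hn
  have hanti : AntitoneOn (fun x : ℝ => Real.log (1 + Real.exp (-(β / n * x))))
      (Icc (0 : ℝ) (0 + n)) := by
    intro a _ b _ h
    exact antitone_log_one_add_exp_neg (mul_le_mul_of_nonneg_left h (by positivity))
  have hI : ∫ x in (0 : ℝ)..(0 + n), Real.log (1 + Real.exp (-(β / n * x))) =
      n / β * ∫ u in (0 : ℝ)..β, Real.log (1 + Real.exp (-u)) := by
    rw [intervalIntegral.integral_comp_mul_left (fun u => Real.log (1 + Real.exp (-u)))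
      (by positivity : β / n ≠ 0)]
    simp [hn'.ne']
  have hup := hanti.sum_le_integral
  have hlo := hanti.integral_le_sum
  rw [hI] at hup hlo
  have htel := Finset.sum_range_succ' (fun i : ℕ => Real.log (1 + Real.exp (-(β / n * i)))) n
  rw [Finset.sum_range_succ] at htel
  simp only [Nat.cast_zero, mul_zero, neg_zero, Real.exp_zero, one_add_one_eq_two] at htel
  have hpos : 0 ≤ Real.log (1 + Real.exp (-(β / n * n))) :=
    Real.log_nonneg (by linarith [Real.exp_pos (-(β / n * n))])
  simp only [zero_add] at hup hlo
  push_cast at htel hup ⊢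
  constructor <;> linarith

theorem topWeight_le_pathWeight {s : ℝ} (h0 : 0 < s) (h1 : s < 1) {n m : ℕ} (hm : m ≤ n) :
    topWeight s⁻¹ n (n - m) ≤ pathWeight s n m := by
  induction n generalizing m with
  | zero =>
    obtain rfl : m = 0 := by omega
    simp [topWeight_zero_zero, pathWeight_zero_right h0 h1]
  | succ n ihn =>
    induction m with
    | zero =>
      have := ihn (Nat.zero_le n)
      rw [Nat.sub_zero, pathWeight_zero_right h0 h1] at this ⊢
      rw [topWeight_succ_self, choose_two_succ, pow_add]
      gcongr
    | succ m ihm =>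
      have ihm := ihm (by omega)
      have hpos := pathWeight_pos h0 h1 n (m + 1)
      rw [pathWeight_succ h0 h1]
      rcases Nat.lt_or_ge m n with hlt | hge
      · obtain ⟨k, rfl⟩ : ∃ k, n = m + 1 + k := ⟨n - (m + 1), by omega⟩
        have hk := ihn (m := m + 1) (by omega)
        rw [show m + 1 + k - (m + 1) = k by omega] at hk
        rw [show m + 1 + k + 1 - m = k + 2 by omega] at ihm
        rw [show m + 1 + k + 1 - (m + 1) = k + 1 by omega, topWeight_succ_succ _ (by omega)]
        have e : s⁻¹ ^ (m + 1 + k) * s ^ (m + 1) = s⁻¹ ^ k := by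
          rw [pow_add, mul_right_comm, ← mul_pow, inv_mul_cancel₀ h0.ne', one_pow, one_mul]
        rw [e]
        gcongr
      · obtain rfl : m = n := by omega
        rw [Nat.sub_self, topWeight_succ_zero]
        rw [show m + 1 - m = 1 by omega] at ihm
        have : 0 ≤ s⁻¹ ^ m * s ^ (m + 1) * pathWeight s m (m + 1) := by positivity
        linarith

theorem ballot_pathWeight_le_topWeight {s : ℝ} (h0 : 0 < s) (h1 : s < 1) {n m : ℕ} (hm : m ≤ n) :
    pathWeight s n m * (1 - m / (n + 1)) ≤ topWeight s⁻¹ n (n - m) := by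
  induction n generalizing m with
  | zero =>
    obtain rfl : m = 0 := by omega
    simp [topWeight_zero_zero, pathWeight_zero_right h0 h1]
  | succ n ihn =>
    induction m with
    | zero =>
      have := ihn (Nat.zero_le n)
      rw [Nat.cast_zero, zero_div, sub_zero, mul_one, Nat.sub_zero,
        pathWeight_zero_right h0 h1] at this ⊢
      rw [topWeight_succ_self, choose_two_succ, pow_add]
      gcongr
    | succ m ihm =>
      have ihm := ihm (by omega)
      have hsub := ballot_pathWeight_succ_le h0 h1 n m
      rw [Nat.cast_add_one n] at ihm ⊢
      rw [Nat.cast_add_one m]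
      rw [show (n : ℝ) + 1 + 1 = n + 2 by ring] at ihm ⊢
      refine hsub.trans ?_
      rcases Nat.lt_or_ge m n with hlt | hge
      · obtain ⟨k, rfl⟩ : ∃ k, n = m + 1 + k := ⟨n - (m + 1), by omega⟩
        have hk := ihn (m := m + 1) (by omega)
        rw [show m + 1 + k - (m + 1) = k by omega, Nat.cast_add_one] at hk
        rw [show m + 1 + k + 1 - m = k + 2 by omega] at ihm
        rw [show m + 1 + k + 1 - (m + 1) = k + 1 by omega, topWeight_succ_succ _ (by omega)]
        have e : s⁻¹ ^ (m + 1 + k) * s ^ (m + 1) = s⁻¹ ^ k := by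
          rw [pow_add, mul_right_comm, ← mul_pow, inv_mul_cancel₀ h0.ne', one_pow, one_mul]
        rw [e]
        gcongr
      · obtain rfl : m = n := by omega
        rw [Nat.sub_self, topWeight_succ_zero]
        rw [show m + 1 - m = 1 by omega] at ihm
        rw [div_self (by positivity), sub_self, mul_zero, mul_zero, zero_add]
        exact ihm

theorem log_topWeight_bounds {s : ℝ} (h0 : 0 < s) (h1 : s < 1) (n : ℕ) :
    n.choose 2 * Real.log s⁻¹ + 2 * ∑ i ∈ Finset.range n, Real.log (1 + s ^ (i + 1)) -
        2 * Real.log (n + 1) ≤ Real.log (topWeight s⁻¹ n 0) ∧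
      Real.log (topWeight s⁻¹ n 0) ≤
        n.choose 2 * Real.log s⁻¹ + 2 * ∑ i ∈ Finset.range n, Real.log (1 + s ^ (i + 1)) := by
  have hup := topWeight_le_pathWeight h0 h1 (le_refl n)
  have hlo := ballot_pathWeight_le_topWeight h0 h1 (le_refl n)
  obtain ⟨blo, bup⟩ := pathWeight_diag_bounds h0 h1 n
  rw [Nat.sub_self] at hup hlo
  set A := ∏ i ∈ Finset.range n, (1 + s ^ (i + 1)) with hA
  have hApos : 0 < A := Finset.prod_pos fun i _ => by positivity
  have hlog : ∑ i ∈ Finset.range n, Real.log (1 + s ^ (i + 1)) = Real.log A :=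
    (Real.log_prod fun i _ => by positivity).symm
  have hs : 0 < s⁻¹ ^ n.choose 2 := by positivity
  have hL : Real.log (s⁻¹ ^ n.choose 2 * A ^ 2) = n.choose 2 * Real.log s⁻¹ + 2 * Real.log A := by
    rw [Real.log_mul hs.ne' (by positivity), Real.log_pow, Real.log_pow]
    norm_num
  have hup' : topWeight s⁻¹ n 0 ≤ s⁻¹ ^ n.choose 2 * A ^ 2 :=
    hup.trans (mul_le_mul_of_nonneg_left bup hs.le)
  have hn : (0 : ℝ) < n + 1 := by positivity
  have hlo' : s⁻¹ ^ n.choose 2 * A ^ 2 / (n + 1) ^ 2 ≤ topWeight s⁻¹ n 0 := by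
    refine le_trans ?_ hlo
    have e : (1 : ℝ) - n / (n + 1) = 1 / (n + 1) := by
      field_simp
      ring
    rw [e]
    calc _ = s⁻¹ ^ n.choose 2 * (A ^ 2 / (n + 1)) * (1 / (n + 1)) := by
          field_simp
      _ ≤ _ := mul_le_mul_of_nonneg_right (mul_le_mul_of_nonneg_left blo hs.le) (by positivity)
  have hpos : 0 < s⁻¹ ^ n.choose 2 * A ^ 2 / (n + 1) ^ 2 := by positivity
  rw [hlog, ← hL]
  constructor
  · have := Real.log_le_log hpos hlo'
    rw [Real.log_div (by positivity) (by positivity), Real.log_pow] at this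
    exact_mod_cast this
  · exact Real.log_le_log (hpos.trans_le hlo') hup'

theorem tendsto_log_add_one_div_atTop :
    Tendsto (fun n : ℕ => Real.log (n + 1) / n) atTop (nhds 0) := by
  have h1 : Tendsto (fun n : ℕ => ((n : ℝ) + 1)) atTop atTop :=
    tendsto_atTop_add_const_right _ _ tendsto_natCast_atTop_atTop
  have h := (Real.isLittleO_log_id_atTop.comp_tendsto h1).tendsto_div_nhds_zero
  have h2 : Tendsto (fun n : ℕ => ((n : ℝ) + 1) / n) atTop (nhds 1) := by
    have := (tendsto_one_div_atTop_nhds_zero_nat (𝕜 := ℝ)).const_add 1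
    rw [add_zero] at this
    refine this.congr' ?_
    filter_upwards [eventually_gt_atTop 0] with n hn
    field_simp
  have := h.mul h2
  rw [zero_mul] at this
  refine this.congr fun n => ?_
  have : (n : ℝ) + 1 ≠ 0 := by positivity
  simp only [Function.comp_apply, id_eq]
  field_simp

/-- Asymptotics of the partition function of the 231-avoiding Mallows model. -/
theorem partition_asymptotics_231 (β : ℝ) (hβ : 0 < β) :
    Filter.Tendsto (fun n : ℕ => Real.log (Z231 β n) / n) Filter.atTop
      (nhds (2 * Real.log (1 + Real.exp β) - β -
        (1 / β) * ∫ y in Real.exp (-β)..Real.exp β, Real.log y / (1 + y))) := by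
  set I := ∫ u in (0 : ℝ)..β, Real.log (1 + Real.exp (-u)) with hI
  have hlim : 2 * Real.log (1 + Real.exp β) - β -
      (1 / β) * ∫ y in Real.exp (-β)..Real.exp β, Real.log y / (1 + y) = β / 2 + 2 / β * I := by
    have := integral_log_one_add_exp_neg β
    rw [← hI] at this
    field_simp
    linarith
  rw [hlim]
  have hinv : Tendsto (fun n : ℕ => 1 / (n : ℝ)) atTop (nhds 0) :=
    tendsto_one_div_atTop_nhds_zero_nat
  have hup : Tendsto (fun n : ℕ => β / 2 - β / 2 * (1 / (n : ℝ)) + 2 / β * I) atTop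
      (nhds (β / 2 + 2 / β * I)) := by
    simpa using ((hinv.const_mul (β / 2)).const_sub (β / 2)).add_const (2 / β * I)
  have hlo : Tendsto (fun n : ℕ => β / 2 - β / 2 * (1 / (n : ℝ)) + 2 / β * I -
      (2 * Real.log 2 * (1 / (n : ℝ)) + 2 * (Real.log (n + 1) / n))) atTop
      (nhds (β / 2 + 2 / β * I)) := by
    simpa using hup.sub ((hinv.const_mul (2 * Real.log 2)).add
      (tendsto_log_add_one_div_atTop.const_mul 2))
  have hbounds : ∀ n : ℕ, 0 < n →
      β / 2 * (n - 1) + 2 * (n / β * I - Real.log 2) - 2 * Real.log (n + 1) ≤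
        Real.log (Z231 β n) ∧
      Real.log (Z231 β n) ≤ β / 2 * (n - 1) + 2 * (n / β * I) := by
    intro n hn
    have hn' : (0 : ℝ) < n := by exact_mod_cast hn
    have hs1 : Real.exp (-(β / n)) < 1 := by
      rw [Real.exp_lt_one_iff, neg_lt_zero]
      positivity
    have hb := log_topWeight_bounds (Real.exp_pos (-(β / n))) hs1 n
    have hsum := sum_log_one_add_exp_bounds hβ hn
    have hp : ∀ i : ℕ, Real.exp (-(β / n)) ^ (i + 1) = Real.exp (-(β / n * (i + 1 : ℕ))) := by
      intro i
      rw [← Real.exp_nat_mul]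
      congr 1
      ring
    have hc : (n.choose 2 : ℝ) * (β / n) = β / 2 * (n - 1) := by
      rw [Nat.cast_choose_two]
      field_simp
    simp only [hp, ← Real.exp_neg, neg_neg, Real.log_exp, hc, ← Z231_eq_topWeight] at hb
    exact ⟨by linarith [hb.1, hsum.1], by linarith [hb.2, hsum.2]⟩
  refine tendsto_of_tendsto_of_tendsto_of_le_of_le' hlo hup ?_ ?_
  · filter_upwards [eventually_gt_atTop 0] with n hn
    have hn' : (0 : ℝ) < n := by exact_mod_cast hn
    rw [le_div_iff₀ hn']
    refine le_trans (le_of_eq ?_) (hbounds n hn).1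
    field_simp
    ring
  · filter_upwards [eventually_gt_atTop 0] with n hn
    have hn' : (0 : ℝ) < n := by exact_mod_cast hn
    rw [div_le_iff₀ hn']
    refine (hbounds n hn).2.trans (le_of_eq ?_)
    field_simp

end
end
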